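/- Let (ΛV,d) be a pure coformal elliptic minimal Sullivan model and B a basis of V^{even}. Then for every integer r ≥ 2, (r−1)·cat(ΛV) + L(ΛV,B) ≤ TC_r(ΛV). In fact (r−1)·cat(ΛV) + L(ΛV,B) ≤ MTC_r(ΛV) ≤ TC_r(ΛV). -/

import Mathlib

noncomputable section

namespace RHT

/-- A graded-commutative differential graded algebra over `ℚ`, graded by `ℕ`,
with a degree `+1` differential satisfying the graded Leibniz rule. -/
class GCDGA (A : Type) extends Ring A, Algebra ℚ A where
  grading : ℕ → Submodule ℚ A
  gradedAlgebra : GradedAlgebra grading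
  grading_comm : ∀ (i j : ℕ) (a b : A), a ∈ grading i → b ∈ grading j →
    a * b = ((-1 : ℚ) ^ (i * j)) • (b * a)
  d : A →ₗ[ℚ] A
  d_sq : ∀ a : A, d (d a) = 0
  d_grading : ∀ (i : ℕ) (a : A), a ∈ grading i → d a ∈ grading (i + 1)
  d_leibniz : ∀ (i : ℕ) (a b : A), a ∈ grading i →
    d (a * b) = d a * b + ((-1 : ℚ) ^ i) • (a * d b)

/-- The grading of a gcdga, with the algebra explicit. -/
def Gr (A : Type) [GCDGA A] : ℕ → Submodule ℚ A := GCDGA.grading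

/-- The differential of a gcdga, with the algebra explicit. -/
def Dd (A : Type) [GCDGA A] : A →ₗ[ℚ] A := GCDGA.d

/-- Morphisms of cdga's: `ℚ`-algebra morphisms preserving the grading and
commuting with the differentials. -/
def IsDGAHom {A B : Type} [GCDGA A] [GCDGA B] (f : A →ₐ[ℚ] B) : Prop :=
  (∀ a : A, f (Dd A a) = Dd B (f a)) ∧
    ∀ (i : ℕ) (a : A), a ∈ Gr A i → f a ∈ Gr B i

theorem isDGAHom_id (A : Type) [GCDGA A] : IsDGAHom (AlgHom.id ℚ A) :=
  ⟨fun _ => rfl, fun _ _ h => h⟩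

/-- A quasi-isomorphism: a morphism inducing an isomorphism in cohomology
(stated elementwise: surjectivity and injectivity on cohomology classes). -/
def QuasiIso {A B : Type} [GCDGA A] [GCDGA B] (f : A →ₐ[ℚ] B) : Prop :=
  (∀ b : B, Dd B b = 0 → ∃ a : A, Dd A a = 0 ∧ ∃ c : B, f a - b = Dd B c) ∧
    ∀ a : A, Dd A a = 0 → (∃ c : B, f a = Dd B c) → ∃ e : A, a = Dd A e

/-- Injectivity in cohomology, stated elementwise. -/
def CohomologyInjective {A B : Type} [GCDGA A] [GCDGA B] (f : A →ₐ[ℚ] B) : Prop :=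
  ∀ a : A, Dd A a = 0 → (∃ c : B, f a = Dd B c) → ∃ e : A, a = Dd A e

/-- A homotopy retraction for a morphism `ρ` of cdga's: a factorization of `ρ`
through a surjective quasi-isomorphism `q : C → Q` (playing the role of the
relative Sullivan model of `ρ`) together with a cdga retraction `τ`. -/
structure HtpyRetraction {T Q : Type} [GCDGA T] [GCDGA Q] (ρ : T →ₐ[ℚ] Q) where
  C : Type
  [instC : GCDGA C]
  j : T →ₐ[ℚ] C
  q : C →ₐ[ℚ] Q
  τ : C →ₐ[ℚ] T
  j_dga : IsDGAHom j
  q_dga : IsDGAHom q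
  τ_dga : IsDGAHom τ
  q_surj : Function.Surjective q
  q_quasi : QuasiIso q
  hqj : q.comp j = ρ
  hτj : τ.comp j = AlgHom.id ℚ T

attribute [instance] HtpyRetraction.instC

/-- A homotopy retraction of `T`-modules for a morphism `ρ : T → Q` of cdga's:
as above, but the retraction `τ` is only required to be a morphism of
differential `T`-modules. -/
structure ModHtpyRetraction {T Q : Type} [GCDGA T] [GCDGA Q] (ρ : T →ₐ[ℚ] Q) where
  C : Type
  [instC : GCDGA C]
  j : T →ₐ[ℚ] C
  q : C →ₐ[ℚ] Q
  τ : C →ₗ[ℚ] T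
  j_dga : IsDGAHom j
  q_dga : IsDGAHom q
  q_surj : Function.Surjective q
  q_quasi : QuasiIso q
  hqj : q.comp j = ρ
  τ_chain : ∀ c : C, τ (Dd C c) = Dd T (τ c)
  τ_mod : ∀ (t : T) (c : C), τ (j t * c) = t * τ c
  hτj : ∀ t : T, τ (j t) = t

attribute [instance] ModHtpyRetraction.instC

/-- `T`, together with the morphisms `ι j : A → T`, is the `r`-fold (graded)
tensor power of `A`, characterized as the `r`-fold coproduct of copies of `A`
in the category of cdga's. -/
structure TensorPower (A : Type) [GCDGA A] (r : ℕ) (T : Type) [GCDGA T] where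
  ι : Fin r → (A →ₐ[ℚ] T)
  ι_dga : ∀ j, IsDGAHom (ι j)
  coprod : ∀ (B : Type) [GCDGA B] (f : Fin r → (A →ₐ[ℚ] B)), (∀ j, IsDGAHom (f j)) →
    ∃! g : T →ₐ[ℚ] B, IsDGAHom g ∧ ∀ j, g.comp (ι j) = f j

/-- The `r`-fold multiplication morphism `μ : A^{⊗ r} → A`, i.e. the fold map
of the coproduct. -/
noncomputable def TensorPower.mu {A : Type} [GCDGA A] {r : ℕ} {T : Type} [GCDGA T]
    (TP : TensorPower A r T) : T →ₐ[ℚ] A :=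
  (TP.coprod A (fun _ => AlgHom.id ℚ A) (fun _ => isDGAHom_id A)).choose

/-- The kernel of the `r`-fold multiplication, as a `ℚ`-submodule (ideal). -/
noncomputable def TensorPower.kerMu {A : Type} [GCDGA A] {r : ℕ} {T : Type} [GCDGA T]
    (TP : TensorPower A r T) : Submodule ℚ T :=
  LinearMap.ker TP.mu.toLinearMap

/-- A witness that `TC_r(ΛV) ≤ n`: the projection
`ρ^r_n : (ΛV)^{⊗ r} → (ΛV)^{⊗ r}/(ker μ^r)^{n+1}` admits a homotopy retraction
of cdga's.  The quotient is encoded as a surjective cdga morphism with kernel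
`(ker μ^r)^{n+1}`. -/
structure TCWitness (A : Type) [GCDGA A] (r n : ℕ) where
  T : Type
  [instT : GCDGA T]
  TP : TensorPower A r T
  Q : Type
  [instQ : GCDGA Q]
  ρ : T →ₐ[ℚ] Q
  ρ_dga : IsDGAHom ρ
  ρ_surj : Function.Surjective ρ
  ρ_ker : LinearMap.ker ρ.toLinearMap = TP.kerMu ^ (n + 1)
  retr : Nonempty (HtpyRetraction ρ)

/-- The higher rational topological complexity `TC_r`. -/
noncomputable def TC (A : Type) [GCDGA A] (r : ℕ) : ℕ :=
  sInf {n | Nonempty (TCWitness A r n)}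

/-- A witness that `MTC_r(ΛV) ≤ n`: `ρ^r_n` admits a homotopy retraction of
`(ΛV)^{⊗ r}`-modules. -/
structure MTCWitness (A : Type) [GCDGA A] (r n : ℕ) where
  T : Type
  [instT : GCDGA T]
  TP : TensorPower A r T
  Q : Type
  [instQ : GCDGA Q]
  ρ : T →ₐ[ℚ] Q
  ρ_dga : IsDGAHom ρ
  ρ_surj : Function.Surjective ρ
  ρ_ker : LinearMap.ker ρ.toLinearMap = TP.kerMu ^ (n + 1)
  retr : Nonempty (ModHtpyRetraction ρ)

/-- The higher module rational topological complexity `MTC_r`. -/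
noncomputable def MTC (A : Type) [GCDGA A] (r : ℕ) : ℕ :=
  sInf {n | Nonempty (MTCWitness A r n)}

/-- A witness that `HTC_r(ΛV) ≤ n`: `ρ^r_n` is injective in cohomology. -/
structure HTCWitness (A : Type) [GCDGA A] (r n : ℕ) where
  T : Type
  [instT : GCDGA T]
  TP : TensorPower A r T
  Q : Type
  [instQ : GCDGA Q]
  ρ : T →ₐ[ℚ] Q
  ρ_dga : IsDGAHom ρ
  ρ_surj : Function.Surjective ρ
  ρ_ker : LinearMap.ker ρ.toLinearMap = TP.kerMu ^ (n + 1)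
  inj : CohomologyInjective ρ

/-- The invariant `HTC_r`. -/
noncomputable def HTC (A : Type) [GCDGA A] (r : ℕ) : ℕ :=
  sInf {n | Nonempty (HTCWitness A r n)}

/-- A minimal Sullivan model structure on a gcdga `A`: a simply-connected
graded space of generators `V` of finite type, the word-length grading `lam`
(`lam k` is `Λ^k V`), freeness of `A` over `V` as a graded-commutative
algebra (expressed by the universal property), and minimality `d V ⊆ Λ^{≥2}V`. -/
structure MinimalSullivan (A : Type) [GCDGA A] where
  V : ℕ → Submodule ℚ A
  lam : ℕ → Submodule ℚ A
  V_le : ∀ n, V n ≤ Gr A n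
  V0 : V 0 = ⊥
  V1 : V 1 = ⊥
  V_fin : ∀ n, FiniteDimensional ℚ (V n)
  lam_zero : lam 0 = 1
  lam_one : lam 1 = ⨆ n, V n
  lam_mul : ∀ p q, lam p * lam q ≤ lam (p + q)
  lam_internal : DirectSum.IsInternal lam
  minimal : ∀ (n : ℕ), ∀ v ∈ V n, Dd A v ∈ ⨆ k, ⨆ (_ : 2 ≤ k), lam k
  free : ∀ (B : Type) [GCDGA B] (f : ∀ n, V n →ₗ[ℚ] B),
    (∀ (n : ℕ) (v : V n), f n v ∈ Gr B n) →
    ∃! g : A →ₐ[ℚ] B, (∀ (i : ℕ) (a : A), a ∈ Gr A i → g a ∈ Gr B i) ∧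
      ∀ (n : ℕ) (v : V n), g (v : A) = f n v

namespace MinimalSullivan

variable {A : Type} [GCDGA A] (S : MinimalSullivan A)

/-- The even part of the space of generators. -/
def Veven : Submodule ℚ A := ⨆ n, S.V (2 * n)

/-- The odd part of the space of generators. -/
def Vodd : Submodule ℚ A := ⨆ n, S.V (2 * n + 1)

/-- The homotopy characteristic `χ_π = dim V^even - dim V^odd`. -/
noncomputable def chiPi : ℤ :=
  (Module.finrank ℚ S.Veven : ℤ) - (Module.finrank ℚ S.Vodd : ℤ)

/-- Purity: `d V^even = 0` and `d V^odd ⊆ Λ V^even`. -/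
def Pure : Prop :=
  (∀ a ∈ S.Veven, Dd A a = 0) ∧
    ∀ a ∈ S.Vodd, Dd A a ∈ Algebra.adjoin ℚ (S.Veven : Set A)

/-- Coformality: the differential is quadratic, `d V ⊆ Λ² V`. -/
def Coformal : Prop := ∀ (n : ℕ), ∀ v ∈ S.V n, Dd A v ∈ S.lam 2

/-- Constant length `l` of the differential: `d V ⊆ Λ^l V`. -/
def ConstantLength (l : ℕ) : Prop := ∀ (n : ℕ), ∀ v ∈ S.V n, Dd A v ∈ S.lam l

end MinimalSullivan

/-- The cohomology of a gcdga, as a `ℚ`-module. -/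
def CohClasses (A : Type) [GCDGA A] :=
  LinearMap.ker (Dd A) ⧸ ((LinearMap.range (Dd A)).comap (LinearMap.ker (Dd A)).subtype)

instance (A : Type) [GCDGA A] : AddCommGroup (CohClasses A) := by
  unfold CohClasses; infer_instance

instance (A : Type) [GCDGA A] : Module ℚ (CohClasses A) := by
  unfold CohClasses; infer_instance

/-- Ellipticity: both the generating space `V` and the cohomology are
finite-dimensional. -/
def Elliptic (A : Type) [GCDGA A] (S : MinimalSullivan A) : Prop :=
  FiniteDimensional ℚ (⨆ n, S.V n : Submodule ℚ A) ∧ FiniteDimensional ℚ (CohClasses A)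

/-- A witness of formality: a quasi-isomorphism to a gcdga with zero
differential. -/
structure FormalityWitness (A : Type) [GCDGA A] where
  B : Type
  [instB : GCDGA B]
  hd : Dd B = 0
  ψ : A →ₐ[ℚ] B
  ψ_dga : IsDGAHom ψ
  ψ_quasi : QuasiIso ψ

/-- Formality of a (Sullivan) cdga. -/
def Formal (A : Type) [GCDGA A] : Prop := Nonempty (FormalityWitness A)

/-- A witness that `cat(ΛV) ≤ n`: the projection `ΛV → ΛV/Λ^{>n}V` admits a
homotopy retraction.  The quotient is encoded as a surjective cdga morphism
whose kernel is `Λ^{>n}V`. -/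
structure CatWitness (A : Type) [GCDGA A] (S : MinimalSullivan A) (n : ℕ) where
  Q : Type
  [instQ : GCDGA Q]
  π : A →ₐ[ℚ] Q
  π_dga : IsDGAHom π
  π_surj : Function.Surjective π
  π_ker : LinearMap.ker π.toLinearMap = ⨆ k, ⨆ (_ : n < k), S.lam k
  retr : Nonempty (HtpyRetraction π)

/-- The rational LS-category. -/
noncomputable def cat (A : Type) [GCDGA A] (S : MinimalSullivan A) : ℕ :=
  sInf {n | Nonempty (CatWitness A S n)}

/-- A witness that `zcl_r(ΛV) ≥ p`: `p` cocycles in `(ΛV)^{⊗ r}` whose classes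
are zero-divisors (killed by `H(μ^r)`) and whose product is not exact. -/
structure ZclWitness (A : Type) [GCDGA A] (r p : ℕ) where
  T : Type
  [instT : GCDGA T]
  TP : TensorPower A r T
  a : Fin p → T
  closed : ∀ i, Dd T (a i) = 0
  zero_div : ∀ i, ∃ b : A, TP.mu (a i) = Dd A b
  prod_ne : ∀ b : T, (List.ofFn a).prod ≠ Dd T b

/-- The `r`-zero-divisor-cuplength `zcl_r`. -/
noncomputable def zcl (A : Type) [GCDGA A] (r : ℕ) : ℕ :=
  sSup {p | Nonempty (ZclWitness A r p)}

/-- A witness that `cl_ℚ(ΛV) ≥ p`: `p` cocycles of positive degree with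
non-exact product. -/
structure ClWitness (A : Type) [GCDGA A] (p : ℕ) where
  a : Fin p → A
  pos : ∀ i, a i ∈ ⨆ k, ⨆ (_ : 0 < k), Gr A k
  closed : ∀ i, Dd A (a i) = 0
  prod_ne : ∀ b : A, (List.ofFn a).prod ≠ Dd A b

/-- The rational cuplength `cl_ℚ`. -/
noncomputable def clQ (A : Type) [GCDGA A] : ℕ :=
  sSup {p | Nonempty (ClWitness A p)}


/-- Given a pure coformal model `(ΛV,d)` with a (homogeneous) basis
`x₁,…,x_n` of `X = V^even`, the extension `ΛW_B = Λ(V ⊕ U)` obtained by adding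
odd generators `u_i` with `du_i = x_i²`, together with its bigrading by the
word length in `X` (`bl p q` encodes `Λ^p X ⊗ Λ^q (Y ⊕ U)`), for which the
quadratic differential has bidegree `(+2,−1)`. -/
structure LExt (A : Type) [GCDGA A] (S : MinimalSullivan A) {n : ℕ}
    (x : Fin n → A) (e : Fin n → ℕ) (W : Type) [GCDGA W] where
  incl : A →ₐ[ℚ] W
  incl_dga : IsDGAHom incl
  u : Fin n → W
  u_mem : ∀ i, u i ∈ Gr W (2 * e i - 1)
  hdu : ∀ i, Dd W (u i) = incl (x i) ^ 2
  free : ∀ (B : Type) [GCDGA B] (f : A →ₐ[ℚ] B), IsDGAHom f →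
    ∀ b : Fin n → B, (∀ i, b i ∈ Gr B (2 * e i - 1)) →
    (∀ i, Dd B (b i) = f (x i) ^ 2) →
    ∃! g : W →ₐ[ℚ] B, IsDGAHom g ∧ g.comp incl = f ∧ ∀ i, g (u i) = b i
  bl : ℕ → ℕ → Submodule ℚ W
  bl_internal : DirectSum.IsInternal fun pq : ℕ × ℕ => bl pq.1 pq.2
  bl_one : (1 : W) ∈ bl 0 0
  bl_mul : ∀ (p q p' q' : ℕ) (a b : W), a ∈ bl p q → b ∈ bl p' q' →
    a * b ∈ bl (p + p') (q + q')
  bl_x : ∀ i, incl (x i) ∈ bl 1 0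
  bl_y : ∀ a ∈ S.Vodd, incl a ∈ bl 0 1
  bl_u : ∀ i, u i ∈ bl 0 1
  bl_d : ∀ (p q : ℕ), ∀ a ∈ bl p q, Dd W a ∈ bl (p + 2) (q - 1)

/-- A witness that `L(ΛV, B) ≥ i`: `i` cocycles of odd `X`-word-length
(representing classes of `H_{odd,*}(ΛW_B)`) with non-exact product. -/
structure LWitness {A : Type} [GCDGA A] {S : MinimalSullivan A} {n : ℕ}
    {x : Fin n → A} {e : Fin n → ℕ} {W : Type} [GCDGA W]
    (ext : LExt A S x e W) (i : ℕ) where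
  z : Fin i → W
  closed : ∀ j, Dd W (z j) = 0
  odd_wl : ∀ j, z j ∈ ⨆ (p : ℕ) (_ : Odd p) (q : ℕ), ext.bl p q
  prod_ne : ∀ c : W, (List.ofFn z).prod ≠ Dd W c

/-- The invariant `L(ΛV, B)`. -/
noncomputable def Lval {A : Type} [GCDGA A] {S : MinimalSullivan A} {n : ℕ}
    {x : Fin n → A} {e : Fin n → ℕ} {W : Type} [GCDGA W]
    (ext : LExt A S x e W) : ℕ :=
  sSup {i | Nonempty (LWitness ext i)}

section InternalProjections

variable {ι M : Type} [DecidableEq ι] [AddCommGroup M] [Module ℚ M] {G : ι → Submodule ℚ M}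

/-- The projection onto the `i`-th summand of an internal direct sum. -/
def ipr (h : DirectSum.IsInternal G) (i : ι) : M →ₗ[ℚ] M :=
  let _ := h.chooseDecomposition
  (G i).subtype ∘ₗ DirectSum.component ℚ ι (fun i => G i) i ∘ₗ
    (DirectSum.decomposeLinearEquiv G).toLinearMap

theorem ipr_mem (h : DirectSum.IsInternal G) (i : ι) (a : M) : ipr h i a ∈ G i := by
  simp [ipr]

theorem ipr_same (h : DirectSum.IsInternal G) {i : ι} {a : M} (ha : a ∈ G i) : ipr h i a = a := by
  let _ := h.chooseDecomposition
  exact DirectSum.decompose_of_mem_same G ha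

theorem ipr_ne (h : DirectSum.IsInternal G) {i j : ι} {a : M} (ha : a ∈ G j) (hij : i ≠ j) :
    ipr h i a = 0 := by
  let _ := h.chooseDecomposition
  exact DirectSum.decompose_of_mem_ne G ha hij.symm

theorem internal_induction (h : DirectSum.IsInternal G) {P : M → Prop} (h0 : P 0)
    (h1 : ∀ i, ∀ a ∈ G i, P a) (h2 : ∀ a b, P a → P b → P (a + b)) (a : M) : P a := by
  let _ := h.chooseDecomposition
  exact DirectSum.Decomposition.inductionOn G h0 (fun m => h1 _ _ m.2) h2 a

theorem exists_sum_ipr (h : DirectSum.IsInternal G) (a : M) :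
    ∃ s : Finset ι, ∑ i ∈ s, ipr h i a = a := by
  classical
  let _ := h.chooseDecomposition
  exact ⟨_, DirectSum.sum_support_decompose G a⟩

theorem mem_of_ipr_mem (h : DirectSum.IsInternal G) {N : Submodule ℚ M} {a : M}
    (ha : ∀ i, ipr h i a ∈ N) : a ∈ N := by
  obtain ⟨s, hs⟩ := exists_sum_ipr h a
  rw [← hs]
  exact Submodule.sum_mem _ fun i _ => ha i

theorem eq_zero_of_ipr (h : DirectSum.IsInternal G) {a : M} (ha : ∀ i, ipr h i a = 0) : a = 0 := by
  simpa using mem_of_ipr_mem h (N := ⊥) (a := a) (by simpa using ha)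

theorem isInternal_of_proj (p : ι → M →ₗ[ℚ] M) (h1 : ∀ i, ∀ a ∈ G i, p i a = a)
    (h2 : ∀ i j, i ≠ j → ∀ a ∈ G j, p i a = 0) (h3 : ∀ a, a ∈ ⨆ i, G i) :
    DirectSum.IsInternal G := by
  rw [DirectSum.isInternal_submodule_iff_iSupIndep_and_iSup_eq_top]
  refine ⟨?_, eq_top_iff.2 fun a _ => h3 a⟩
  rw [iSupIndep_def]
  intro i
  rw [Submodule.disjoint_def]
  intro a ha hb
  rw [← h1 i a ha]
  have : (⨆ j, ⨆ (_ : j ≠ i), G j) ≤ LinearMap.ker (p i) :=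
    iSup₂_le fun j hj b hb => h2 i j hj.symm b hb
  exact this hb

theorem ipr_eq_of_proj (h : DirectSum.IsInternal G) (p : ι → M →ₗ[ℚ] M)
    (h1 : ∀ i, ∀ a ∈ G i, p i a = a) (h2 : ∀ i j, i ≠ j → ∀ a ∈ G j, p i a = 0) (i : ι) (a : M) :
    ipr h i a = p i a := by
  induction a using internal_induction h with
  | h0 => simp
  | h2 a b ha hb => simp [ha, hb]
  | h1 j a ha =>
    by_cases hij : i = j
    · subst hij
      rw [ipr_same h ha, h1 i a ha]
    · rw [ipr_ne h ha hij, h2 i j hij a ha]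

/-- An element of a sum of subfamilies which is homogeneous lies in the corresponding piece. -/
theorem mem_of_mem_iSup (h : DirectSum.IsInternal G) {H : ι → Submodule ℚ M}
    (hH : ∀ i, H i ≤ G i) {a : M} (ha : a ∈ ⨆ i, H i) {i : ι} (hai : a ∈ G i) : a ∈ H i := by
  have : (⨆ j, H j) ≤ (H i).comap (ipr h i) := by
    refine iSup_le fun j b hb => ?_
    by_cases hij : i = j
    · subst hij
      simpa [ipr_same h (hH _ hb)] using hb
    · simp [ipr_ne h (hH _ hb) hij]
  simpa [ipr_same h hai] using this ha

end InternalProjections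

section Basics

variable {A : Type} [GCDGA A]

instance : GradedAlgebra (Gr A) := GCDGA.gradedAlgebra

variable (A) in
theorem gr_internal : DirectSum.IsInternal (Gr A) := DirectSum.Decomposition.isInternal _

/-- The component of degree `i`. -/
abbrev pr (i : ℕ) : A →ₗ[ℚ] A := ipr (gr_internal A) i

theorem gr_one : (1 : A) ∈ Gr A 0 := SetLike.GradedOne.one_mem

theorem gr_mul {i j : ℕ} {a b : A} (ha : a ∈ Gr A i) (hb : b ∈ Gr A j) : a * b ∈ Gr A (i + j) :=
  SetLike.GradedMul.mul_mem ha hb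

theorem gr_comm {i j : ℕ} {a b : A} (ha : a ∈ Gr A i) (hb : b ∈ Gr A j) :
    a * b = ((-1 : ℚ) ^ (i * j)) • (b * a) := GCDGA.grading_comm i j a b ha hb

theorem Dd_Dd (a : A) : Dd A (Dd A a) = 0 := GCDGA.d_sq a

theorem Dd_gr {i : ℕ} {a : A} (ha : a ∈ Gr A i) : Dd A a ∈ Gr A (i + 1) := GCDGA.d_grading i a ha

theorem Dd_leib {i : ℕ} {a : A} (b : A) (ha : a ∈ Gr A i) :
    Dd A (a * b) = Dd A a * b + ((-1 : ℚ) ^ i) • (a * Dd A b) := GCDGA.d_leibniz i a b ha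

theorem gr_induction {P : A → Prop} (h0 : P 0)
    (h1 : ∀ i, ∀ a ∈ Gr A i, P a) (h2 : ∀ a b, P a → P b → P (a + b)) (a : A) : P a :=
  internal_induction (gr_internal A) h0 h1 h2 a

/-- The parity involution `a ↦ (-1)^{|a|} a`. -/
def sg : A →ₗ[ℚ] A :=
  DirectSum.toModule ℚ ℕ A (fun i => ((-1 : ℚ) ^ i) • (Gr A i).subtype) ∘ₗ
    (DirectSum.decomposeLinearEquiv (Gr A)).toLinearMap

theorem sg_of_mem {i : ℕ} {a : A} (ha : a ∈ Gr A i) : sg a = ((-1 : ℚ) ^ i) • a := by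
  lift a to Gr A i using ha
  simp [sg]

theorem sg_even {i : ℕ} {a : A} (hi : Even i) (ha : a ∈ Gr A i) : sg a = a := by
  simp [sg_of_mem ha, hi.neg_one_pow]

theorem sg_odd {i : ℕ} {a : A} (hi : Odd i) (ha : a ∈ Gr A i) : sg a = -a := by
  simp [sg_of_mem ha, hi.neg_one_pow]

@[simp] theorem sg_one : sg (1 : A) = 1 := sg_even (by simp) gr_one

@[simp] theorem sg_mul (a b : A) : sg (a * b) = sg a * sg b := by
  induction a using gr_induction with
  | h0 => simp
  | h2 a a' h h' => simp [add_mul, h, h']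
  | h1 i a ha =>
    induction b using gr_induction with
    | h0 => simp
    | h2 b b' h h' => simp [mul_add, h, h']
    | h1 j b hb =>
      rw [sg_of_mem (gr_mul ha hb), sg_of_mem ha, sg_of_mem hb, smul_mul_smul_comm, pow_add]

theorem sg_mem {i : ℕ} {a : A} (ha : a ∈ Gr A i) : sg a ∈ Gr A i := by
  rw [sg_of_mem ha]; exact Submodule.smul_mem _ _ ha

theorem Dd_sg (a : A) : Dd A (sg a) = - sg (Dd A a) := by
  induction a using gr_induction with
  | h0 => simp
  | h2 a a' h h' => simp [h, h', add_comm]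
  | h1 i a ha => rw [sg_of_mem ha, sg_of_mem (Dd_gr ha), map_smul, pow_succ]; simp

theorem Dd_mul (a b : A) : Dd A (a * b) = Dd A a * b + sg a * Dd A b := by
  induction a using gr_induction with
  | h0 => simp
  | h2 a a' h h' => simp only [add_mul, map_add, h, h']; abel
  | h1 i a ha => rw [Dd_leib b ha, sg_of_mem ha, smul_mul_assoc]

theorem Dd_one : Dd A (1 : A) = 0 := by
  have := Dd_mul (1 : A) 1
  simpa using this

theorem even_comm {i : ℕ} (hi : Even i) {a : A} (ha : a ∈ Gr A i) (b : A) : a * b = b * a := by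
  induction b using gr_induction with
  | h0 => simp
  | h2 b b' h h' => simp [add_mul, mul_add, h, h']
  | h1 j b hb => rw [gr_comm ha hb, (hi.mul_right j).neg_one_pow, one_smul]

theorem odd_comm {i : ℕ} (hi : Odd i) {a : A} (ha : a ∈ Gr A i) (b : A) : b * a = a * sg b := by
  induction b using gr_induction with
  | h0 => simp
  | h2 b b' h h' => simp [add_mul, mul_add, h, h']
  | h1 j b hb =>
    rw [gr_comm hb ha, sg_of_mem hb, mul_smul_comm, mul_comm j, pow_mul, hi.neg_one_pow]

theorem odd_sq {i : ℕ} (hi : Odd i) {a : A} (ha : a ∈ Gr A i) : a * a = 0 := by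
  have h := odd_comm hi ha a
  rw [sg_odd hi ha, mul_neg] at h
  have h2 : (2 : ℚ) • (a * a) = 0 := by
    rw [two_smul]; nth_rewrite 1 [h]; simp
  simpa using h2

theorem pr_Dd (i : ℕ) (a : A) : pr (i + 1) (Dd A a) = Dd A (pr i a) := by
  induction a using gr_induction with
  | h0 => simp
  | h2 a a' h h' => simp [h, h']
  | h1 j a ha =>
    by_cases h : i = j
    · subst h; rw [pr, ipr_same _ ha, ipr_same _ (Dd_gr ha)]
    · rw [pr, pr, ipr_ne _ ha h, ipr_ne _ (Dd_gr ha) (by omega), map_zero]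

theorem pr_zero_Dd (a : A) : pr 0 (Dd A a) = 0 := by
  induction a using gr_induction with
  | h0 => simp
  | h2 a a' h h' => simp [h, h']
  | h1 j a ha => exact ipr_ne _ (Dd_gr ha) (by omega)

theorem pr_of_hom {B : Type} [GCDGA B] (f : A →ₗ[ℚ] B) (hf : ∀ i, ∀ a ∈ Gr A i, f a ∈ Gr B i)
    (i : ℕ) (a : A) : pr i (f a) = f (pr i a) := by
  induction a using gr_induction with
  | h0 => simp
  | h2 a a' h h' => simp [h, h']
  | h1 j a ha =>
    by_cases h : i = j
    · subst h; rw [pr, pr, ipr_same _ ha, ipr_same _ (hf _ _ ha)]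
    · rw [pr, pr, ipr_ne _ ha h, ipr_ne _ (hf _ _ ha) h, map_zero]

theorem sg_of_hom {B : Type} [GCDGA B] (f : A →ₗ[ℚ] B) (hf : ∀ i, ∀ a ∈ Gr A i, f a ∈ Gr B i)
    (a : A) : sg (f a) = f (sg a) := by
  induction a using gr_induction with
  | h0 => simp
  | h2 a a' h h' => simp [h, h']
  | h1 j a ha => rw [sg_of_mem ha, sg_of_mem (hf _ _ ha), map_smul]

theorem sg_eq_sum_pr (a : A) {N : Submodule ℚ A} (h : ∀ i, pr i a ∈ N) : sg a ∈ N := by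
  have hs : ∀ i, pr i (sg a) = sg (pr i a) := fun i =>
    pr_of_hom sg (fun i a ha => sg_mem ha) i a
  refine mem_of_ipr_mem (gr_internal A) fun i => ?_
  rw [hs, sg_of_mem (ipr_mem _ _ _)]
  exact Submodule.smul_mem _ _ (h i)

end Basics

section Morphisms

variable {A B C : Type} [GCDGA A] [GCDGA B] [GCDGA C]

theorem IsDGAHom.comp {g : B →ₐ[ℚ] C} {f : A →ₐ[ℚ] B} (hg : IsDGAHom g) (hf : IsDGAHom f) :
    IsDGAHom (g.comp f) :=
  ⟨fun a => by simp [hf.1, hg.1], fun i a ha => hg.2 _ _ (hf.2 _ _ ha)⟩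

theorem IsDGAHom.sg {f : A →ₐ[ℚ] B} (hf : IsDGAHom f) (a : A) : sg (f a) = f (sg a) :=
  sg_of_hom f.toLinearMap hf.2 a

/-- A degree-preserving algebra morphism is a dga morphism as soon as it commutes with the
differentials on a generating set. -/
theorem isDGAHom_of_generators {f : A →ₐ[ℚ] B} (hf : ∀ i, ∀ a ∈ Gr A i, f a ∈ Gr B i)
    {s : Set A} (hs : Algebra.adjoin ℚ s = ⊤) (h : ∀ a ∈ s, f (Dd A a) = Dd B (f a)) :
    IsDGAHom f := by
  refine ⟨fun a => ?_, hf⟩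
  have ha : a ∈ Algebra.adjoin ℚ s := by rw [hs]; trivial
  have hsg : ∀ a, RHT.sg (f a) = f (RHT.sg a) := sg_of_hom f.toLinearMap hf
  induction ha using Algebra.adjoin_induction with
  | mem x hx => exact h x hx
  | algebraMap q => simp [Algebra.algebraMap_eq_smul_one, Dd_one]
  | add x y _ _ hx hy => simp [hx, hy]
  | mul x y _ _ hx hy => simp [Dd_mul, hx, hy, hsg]

end Morphisms

/-- A ring with an internal grading and a differential is a gcdga. -/
@[reducible] def GCDGA.ofInternal (B : Type) [Ring B] [Algebra ℚ B] (G : ℕ → Submodule ℚ B)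
    (hG : DirectSum.IsInternal G) (h1 : (1 : B) ∈ G 0)
    (hmul : ∀ i j a b, a ∈ G i → b ∈ G j → a * b ∈ G (i + j))
    (hcomm : ∀ (i j : ℕ) (a b : B), a ∈ G i → b ∈ G j → a * b = ((-1 : ℚ) ^ (i * j)) • (b * a))
    (d : B →ₗ[ℚ] B) (hd : ∀ b, d (d b) = 0) (hdG : ∀ i, ∀ b ∈ G i, d b ∈ G (i + 1))
    (hleib : ∀ (i : ℕ) (a b : B), a ∈ G i →
      d (a * b) = d a * b + ((-1 : ℚ) ^ i) • (a * d b)) : GCDGA B where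
  grading := G
  gradedAlgebra :=
    { toGradedMonoid := { one_mem := h1, mul_mem := fun _ _ _ _ ha hb => hmul _ _ _ _ ha hb }
      toDecomposition := hG.chooseDecomposition }
  grading_comm := hcomm
  d := d
  d_sq := hd
  d_grading := hdG
  d_leibniz := hleib

section Shift

variable {M : Type} [AddCommGroup M] [Module ℚ M]

/-- A grading shifted upwards by `s`. -/
def shiftG (G : ℕ → Submodule ℚ M) (s i : ℕ) : Submodule ℚ M := if s ≤ i then G (i - s) else ⊥

theorem mem_shiftG_add {G : ℕ → Submodule ℚ M} {s i : ℕ} {b : M} :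
    b ∈ shiftG G s (i + s) ↔ b ∈ G i := by simp [shiftG]

theorem mem_shiftG {G : ℕ → Submodule ℚ M} {s i : ℕ} {b : M} (h : b ∈ shiftG G s i) :
    b = 0 ∨ ∃ j, i = j + s ∧ b ∈ G j := by
  by_cases hs : s ≤ i
  · exact Or.inr ⟨i - s, by omega, by simpa [shiftG, hs] using h⟩
  · exact Or.inl (by simpa [shiftG, hs] using h)

/-- The grading of `M ⊕ M[-s]`. -/
def shiftProd (G : ℕ → Submodule ℚ M) (s i : ℕ) : Submodule ℚ (M × M) := (G i).prod (shiftG G s i)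

/-- The projections of `shiftProd`. -/
def shiftProj {G : ℕ → Submodule ℚ M} (hG : DirectSum.IsInternal G) (s i : ℕ) : M × M →ₗ[ℚ] M × M :=
  (ipr hG i).prodMap (if s ≤ i then ipr hG (i - s) else 0)

theorem shiftProj_same {G : ℕ → Submodule ℚ M} (hG : DirectSum.IsInternal G) (s i : ℕ) :
    ∀ a ∈ shiftProd G s i, shiftProj hG s i a = a := by
  rintro ⟨a, b⟩ ⟨ha, hb⟩
  refine Prod.ext (ipr_same hG ha) ?_
  by_cases hs : s ≤ i
  · simp only [shiftG, hs, if_true] at hb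
    simp [shiftProj, hs, ipr_same hG hb]
  · simp only [shiftG, hs, if_false] at hb
    simp [shiftProj, hs, (Submodule.mem_bot ℚ).1 hb]

theorem shiftProj_ne {G : ℕ → Submodule ℚ M} (hG : DirectSum.IsInternal G) (s i j : ℕ)
    (hij : i ≠ j) : ∀ a ∈ shiftProd G s j, shiftProj hG s i a = 0 := by
  rintro ⟨a, b⟩ ⟨ha, hb⟩
  refine Prod.ext (ipr_ne hG ha hij) ?_
  by_cases hs : s ≤ i
  · rcases mem_shiftG hb with rfl | ⟨l, rfl, hl⟩
    · simp [shiftProj]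
    · simpa [shiftProj, hs] using ipr_ne hG hl (i := i - s) (by omega)
  · simp [shiftProj, hs]

theorem shiftProd_internal {G : ℕ → Submodule ℚ M} (hG : DirectSum.IsInternal G) (s : ℕ) :
    DirectSum.IsInternal (shiftProd G s) := by
  have hinl : ∀ a : M, ((a, 0) : M × M) ∈ ⨆ i, shiftProd G s i := fun a => by
    have : a ∈ (⨆ i, shiftProd G s i).comap (LinearMap.inl ℚ M M) :=
      mem_of_ipr_mem hG fun i =>
        Submodule.mem_iSup_of_mem i ⟨ipr_mem hG i a, Submodule.zero_mem _⟩
    simpa using this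
  have hinr : ∀ b : M, ((0, b) : M × M) ∈ ⨆ i, shiftProd G s i := fun b => by
    have : b ∈ (⨆ i, shiftProd G s i).comap (LinearMap.inr ℚ M M) :=
      mem_of_ipr_mem hG fun i =>
        Submodule.mem_iSup_of_mem (i + s)
          ⟨Submodule.zero_mem _, mem_shiftG_add.2 (ipr_mem hG i b)⟩
    simpa using this
  refine isInternal_of_proj (shiftProj hG s) (shiftProj_same hG s) (shiftProj_ne hG s) ?_
  rintro ⟨a, b⟩
  simpa using Submodule.add_mem _ (hinl a) (hinr b)

end Shift

/-- The data needed to adjoin one odd generator `u` with `du = f`. -/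
structure OData (T : Type) [GCDGA T] where
  k : ℕ
  hk : Odd k
  f : T
  f_mem : f ∈ Gr T (k + 1)
  f_closed : Dd T f = 0

/-- The extension `T ⊗ Λu = T ⊕ uT`. -/
def OExt {T : Type} [GCDGA T] (_ : OData T) : Type := T × T

namespace OExt

variable {T : Type} [GCDGA T] (o : OData T)

theorem f_comm (b : T) : o.f * b = b * o.f := even_comm (o.hk.add_odd odd_one) o.f_mem b

theorem sg_f : sg o.f = o.f := sg_even (o.hk.add_odd odd_one) o.f_mem

theorem sg_sg {A : Type} [GCDGA A] (a : A) : sg (sg a) = a := by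
  induction a using gr_induction with
  | h0 => simp
  | h2 a a' h h' => simp [h, h']
  | h1 i a ha =>
    rw [sg_of_mem ha, map_smul, sg_of_mem ha, smul_smul, ← mul_pow]; simp

instance : AddCommGroup (OExt o) := inferInstanceAs (AddCommGroup (T × T))
instance : Module ℚ (OExt o) := inferInstanceAs (Module ℚ (T × T))

variable {o} in
/-- The element `a + u b`. -/
def mk (a b : T) : OExt o := (a, b)

instance : Mul (OExt o) := ⟨fun p q => mk (p.1 * q.1) (sg p.1 * q.2 + p.2 * q.1)⟩
instance : One (OExt o) := ⟨mk 1 0⟩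

variable {o}

theorem mk_mul (a b c e : T) : (mk a b : OExt o) * mk c e = mk (a * c) (sg a * e + b * c) := rfl

theorem mk_add (a b c e : T) : (mk a b : OExt o) + mk c e = mk (a + c) (b + e) := rfl

theorem mk_smul (q : ℚ) (a b : T) : q • (mk a b : OExt o) = mk (q • a) (q • b) := rfl

theorem one_def : (1 : OExt o) = mk 1 0 := rfl

theorem zero_def : (0 : OExt o) = mk 0 0 := rfl

@[elab_as_elim]
theorem ind {P : OExt o → Prop} (h : ∀ a b, P (mk a b)) (x : OExt o) : P x := h x.1 x.2

theorem mk_inj {a b c e : T} : (mk a b : OExt o) = mk c e ↔ a = c ∧ b = e := Prod.ext_iff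

instance : Ring (OExt o) where
  __ := (inferInstance : AddCommGroup (OExt o))
  left_distrib x y z := by
    induction x using ind; induction y using ind; induction z using ind
    simp only [mk_mul, mk_add, mk_inj, mul_add, true_and]; abel
  right_distrib x y z := by
    induction x using ind; induction y using ind; induction z using ind
    simp only [mk_mul, mk_add, mk_inj, add_mul, true_and, map_add]; abel
  zero_mul x := by
    induction x using ind
    rw [zero_def, mk_mul]; simp
  mul_zero x := by
    induction x using ind
    rw [zero_def, mk_mul]; simp
  mul_assoc x y z := by
    induction x using ind; induction y using ind; induction z using ind
    simp only [mk_mul, mk_inj, mul_assoc, true_and, mul_add, add_mul, sg_mul]; abel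
  one_mul x := by
    induction x using ind
    rw [one_def, mk_mul]; simp
  mul_one x := by
    induction x using ind
    rw [one_def, mk_mul]; simp

instance : Algebra ℚ (OExt o) := Algebra.ofModule
  (fun r x y => by
    induction x using ind; induction y using ind
    simp only [mk_mul, mk_smul, smul_mul_assoc, smul_add, map_smul])
  (fun r x y => by
    induction x using ind; induction y using ind
    simp only [mk_mul, mk_smul, mul_smul_comm, smul_add])

variable (o) in
/-- The differential `d(a + ub) = da + fb - u db`. -/
def dd : OExt o →ₗ[ℚ] OExt o where
  toFun p := mk (Dd T p.1 + o.f * p.2) (-Dd T p.2)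
  map_add' p q := by
    induction p using ind with | h a b
    induction q using ind with | h c e
    change mk (Dd T (a + c) + o.f * (b + e)) (-Dd T (b + e)) =
      mk (Dd T a + o.f * b) (-Dd T b) + mk (Dd T c + o.f * e) (-Dd T e)
    simp only [mk_add, mk_inj, map_add, mul_add]
    constructor <;> abel
  map_smul' r p := by
    induction p using ind with | h a b
    change mk (Dd T (r • a) + o.f * (r • b)) (-Dd T (r • b)) = r • mk (Dd T a + o.f * b) (-Dd T b)
    simp [mk_smul]

theorem dd_mk (a b : T) : dd o (mk a b) = mk (Dd T a + o.f * b) (-Dd T b) := rfl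

variable (o) in
/-- The degree grading. -/
def gr : ℕ → Submodule ℚ (OExt o) := shiftProd (Gr T) o.k

theorem mem_gr {i : ℕ} {a b : T} :
    (mk a b : OExt o) ∈ gr o i ↔ a ∈ Gr T i ∧ b ∈ shiftG (Gr T) o.k i := Iff.rfl

theorem shiftG_mul_left {lam : ℕ → Submodule ℚ T} {s i j : ℕ} {a b : T}
    (hmul : ∀ i j a b, a ∈ lam i → b ∈ lam j → a * b ∈ lam (i + j))
    (ha : a ∈ lam i) (hb : b ∈ shiftG lam s j) : a * b ∈ shiftG lam s (i + j) := by
  rcases mem_shiftG hb with rfl | ⟨l, rfl, hl⟩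
  · simp
  · rw [← add_assoc, mem_shiftG_add]; exact hmul _ _ _ _ ha hl

theorem shiftG_mul_right {lam : ℕ → Submodule ℚ T} {s i j : ℕ} {a b : T}
    (hmul : ∀ i j a b, a ∈ lam i → b ∈ lam j → a * b ∈ lam (i + j))
    (ha : a ∈ shiftG lam s i) (hb : b ∈ lam j) : a * b ∈ shiftG lam s (i + j) := by
  rcases mem_shiftG ha with rfl | ⟨l, rfl, hl⟩
  · simp
  · rw [add_right_comm, mem_shiftG_add]; exact hmul _ _ _ _ hl hb

theorem sg_mem_shift {i : ℕ} {b : T} (hb : b ∈ shiftG (Gr T) o.k i) :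
    sg b = (-((-1 : ℚ) ^ i)) • b := by
  rcases mem_shiftG hb with rfl | ⟨l, rfl, hl⟩
  · simp
  · rw [sg_of_mem hl, pow_add, o.hk.neg_one_pow]; simp

instance : GCDGA (OExt o) := GCDGA.ofInternal (OExt o) (gr o)
  (shiftProd_internal (gr_internal T) o.k)
  (by rw [one_def, mem_gr]; exact ⟨gr_one, Submodule.zero_mem _⟩)
  (by
    intro i j x y hx hy
    induction x using ind with | h a b
    induction y using ind with | h c e
    rw [mem_gr] at hx hy
    rw [mk_mul, mem_gr]
    have hm : ∀ i j (a b : T), a ∈ Gr T i → b ∈ Gr T j → a * b ∈ Gr T (i + j) :=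
      fun _ _ _ _ => gr_mul
    exact ⟨gr_mul hx.1 hy.1, Submodule.add_mem _ (shiftG_mul_left hm (sg_mem hx.1) hy.2)
      (shiftG_mul_right hm hx.2 hy.1)⟩)
  (by
    intro i j x y hx hy
    induction x using ind with | h a b
    induction y using ind with | h c e
    rw [mem_gr] at hx hy
    have h1 : a * e = ((-1 : ℚ) ^ (i * (j + 1))) • (e * a) := by
      rcases mem_shiftG hy.2 with rfl | ⟨l, rfl, hl⟩
      · simp
      · rw [gr_comm hx.1 hl]
        obtain ⟨t, ht⟩ := o.hk
        have : i * (l + o.k + 1) = i * l + 2 * (i * (t + 1)) := by rw [ht]; ring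
        rw [this, pow_add, pow_mul _ 2]; simp
    have h2 : b * c = ((-1 : ℚ) ^ ((i + 1) * j)) • (c * b) := by
      rcases mem_shiftG hx.2 with rfl | ⟨l, rfl, hl⟩
      · simp
      · rw [gr_comm hl hy.1]
        obtain ⟨t, ht⟩ := o.hk
        have : (l + o.k + 1) * j = l * j + 2 * (j * (t + 1)) := by rw [ht]; ring
        rw [this, pow_add, pow_mul _ 2]; simp
    rw [mk_mul, mk_mul, mk_smul, mk_inj]
    refine ⟨gr_comm hx.1 hy.1, ?_⟩
    rw [sg_of_mem hx.1, sg_of_mem hy.1, smul_mul_assoc, smul_mul_assoc, h1, h2, smul_smul, smul_add,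
      smul_smul, add_comm]
    congr 2
    · ring
    · rw [← pow_add, show i + i * (j + 1) = i * j + 2 * i by ring, pow_add, pow_mul _ 2]; simp)
  (dd o)
  (by
    intro x
    induction x using ind with | h a b
    have : Dd T o.f = 0 := o.f_closed
    rw [dd_mk, dd_mk, zero_def, mk_inj]
    simp [Dd_mul, this, Dd_Dd, sg_f])
  (by
    intro i x hx
    induction x using ind with | h a b
    rw [mem_gr] at hx
    rw [dd_mk, mem_gr]
    rcases mem_shiftG hx.2 with rfl | ⟨l, rfl, hl⟩
    · simpa using Dd_gr hx.1
    · refine ⟨Submodule.add_mem _ (Dd_gr hx.1) ?_, ?_⟩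
      · have := gr_mul o.f_mem hl
        rwa [show l + o.k + 1 = o.k + 1 + l by ring]
      · rw [add_right_comm, mem_shiftG_add]
        exact Submodule.neg_mem _ (Dd_gr hl))
  (by
    intro i x y hx
    induction x using ind with | h a b
    induction y using ind with | h c e
    rw [mem_gr] at hx
    have h1 := sg_of_mem hx.1
    have h2 := sg_mem_shift hx.2
    have h3 : ((-1 : ℚ) ^ i) • b = - sg b := by rw [h2]; simp
    simp only [mk_mul, dd_mk, mk_add, mk_smul, mk_inj, Dd_mul, map_add, mul_add, add_mul, smul_add,
      ← smul_mul_assoc, ← h1, h3, Dd_sg, sg_sg, ← map_smul]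
    constructor
    · rw [f_comm o (sg a * e), f_comm o e, mul_assoc, mul_assoc]; abel
    · rw [sg_mul, sg_f, f_comm o (sg b)]
      simp only [mul_neg, neg_mul, mul_assoc]; abel)

theorem Dd_mk (a b : T) : Dd (OExt o) (mk a b) = mk (Dd T a + o.f * b) (-Dd T b) := rfl

theorem mem_Gr {i : ℕ} {a b : T} :
    (mk a b : OExt o) ∈ Gr (OExt o) i ↔ a ∈ Gr T i ∧ b ∈ shiftG (Gr T) o.k i := Iff.rfl

end OExt

/-- A complex with commuting chain endomorphisms `F₁, …, F_s` raising the length filtration degree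
by `c`, the differential raising it by one. -/
structure KData (s : ℕ) (c : ℤ) where
  N : Type
  [ac : AddCommGroup N]
  [mo : Module ℚ N]
  d : N →ₗ[ℚ] N
  F : Fin s → N →ₗ[ℚ] N
  l : ℤ → Submodule ℚ N
  d_sq : ∀ a, d (d a) = 0
  d_F : ∀ j a, d (F j a) = F j (d a)
  F_F : ∀ i j a, F i (F j a) = F j (F i a)
  d_l : ∀ k, ∀ a ∈ l k, d a ∈ l (k + 1)
  F_l : ∀ j k, ∀ a ∈ l k, F j a ∈ l (k + c)

namespace KData

attribute [instance] KData.ac KData.mo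

variable {s : ℕ} {c : ℤ}

/-- The mapping cone of the first endomorphism. -/
def cone (D : KData (s + 1) c) : KData s c where
  N := D.N × D.N
  d := (D.d ∘ₗ LinearMap.fst ℚ D.N D.N + D.F 0 ∘ₗ LinearMap.snd ℚ D.N D.N).prod
    (-(D.d ∘ₗ LinearMap.snd ℚ D.N D.N))
  F j := (D.F j.succ).prodMap (D.F j.succ)
  l k := (D.l k).prod (D.l (k + 1 - c))
  d_sq := by
    rintro ⟨a, b⟩
    simp [D.d_sq, D.d_F]
  d_F := by
    rintro j ⟨a, b⟩
    simp [D.d_F, D.F_F j.succ 0]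
  F_F := by
    rintro i j ⟨a, b⟩
    simp [D.F_F i.succ j.succ]
  d_l := by
    rintro k ⟨a, b⟩ ⟨ha, hb⟩
    refine ⟨Submodule.add_mem _ (D.d_l _ _ ha) ?_, Submodule.neg_mem _ ?_⟩
    · have := D.F_l 0 _ _ hb
      rwa [sub_add_cancel] at this
    · have := D.d_l _ _ hb
      rwa [show k + 1 - c + 1 = k + 1 + 1 - c by ring] at this
  F_l := by
    rintro j k ⟨a, b⟩ ⟨ha, hb⟩
    refine ⟨D.F_l _ _ _ ha, ?_⟩
    have := D.F_l j.succ _ _ hb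
    rwa [show k + 1 - c + c = k + c + 1 - c by ring] at this

/-- Every cocycle of length greater than `w` is a coboundary. -/
def Van (D : KData s c) (w : ℤ) : Prop :=
  ∀ k, w < k → ∀ a ∈ D.l k, D.d a = 0 → ∃ b ∈ D.l (k - 1), D.d b = a

/-- Vanishing above length `w` for the iterated cone. -/
def KVan : ∀ {s : ℕ}, KData s c → ℤ → Prop
  | 0, D, w => D.Van w
  | _ + 1, D, w => D.cone.KVan w

theorem Van.cone {D : KData (s + 1) c} {w : ℤ} (hc : 1 ≤ c) (h : D.Van w) :
    D.cone.Van (w + c - 1) := by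
  rintro k hk ⟨a, b⟩ hab hd
  have hd1 : D.d a + D.F 0 b = 0 := congrArg Prod.fst hd
  have hd2 : -D.d b = 0 := congrArg Prod.snd hd
  obtain ⟨b', hb', rfl⟩ := h _ (by omega) b hab.2 (neg_eq_zero.1 hd2)
  have hF := D.F_l 0 _ _ hb'
  rw [show k + 1 - c - 1 + c = k by ring] at hF
  obtain ⟨a', ha', h'⟩ := h k (by omega) (a + D.F 0 b') (Submodule.add_mem _ hab.1 hF)
    (by rw [map_add, D.d_F]; exact hd1)
  refine ⟨(a', -b'), ⟨ha', Submodule.neg_mem _ ?_⟩, Prod.ext ?_ ?_⟩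
  · rwa [show k - 1 + 1 - c = k + 1 - c - 1 by ring]
  · change D.d a' + D.F 0 (-b') = a
    rw [h', map_neg, add_neg_cancel_right]
  · change -D.d (-b') = D.d b'
    rw [map_neg, neg_neg]

theorem Van.of_cone {D : KData (s + 1) c} {w w₀ : ℤ} (hc : 1 ≤ c) (h0 : D.Van w₀)
    (h : D.cone.Van (w + c - 1)) : D.Van w := by
  have key : ∀ m : ℕ, D.Van (w + m) → D.Van w := by
    intro m
    induction m with
    | zero => simp
    | succ m ih =>
      intro hm
      refine ih fun k hk a ha hda => ?_
      obtain ⟨b, hb, hb'⟩ := hm (k + c) (by push_cast; omega) _ (D.F_l 0 _ _ ha)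
        (by rw [D.d_F, hda, map_zero])
      obtain ⟨⟨p, q⟩, hpq, hd⟩ := h (k + c - 1) (by omega) (-b, a)
        ⟨Submodule.neg_mem _ hb, by rwa [show k + c - 1 + 1 - c = k by ring]⟩
        (Prod.ext (show D.d (-b) + D.F 0 a = 0 by rw [map_neg, hb', neg_add_cancel])
          (show -D.d a = 0 by rw [hda, neg_zero]))
      have hd2 : -D.d q = a := congrArg Prod.snd hd
      refine ⟨-q, Submodule.neg_mem _ ?_, by rw [map_neg, hd2]⟩
      have : q ∈ D.l _ := hpq.2
      rwa [show k + c - 1 - 1 + 1 - c = k - 1 by ring] at this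
  exact key (w₀ - w).toNat fun k hk => h0 k (by omega)

theorem KVan.van {D : KData s c} {w w₀ : ℤ} (hc : 1 ≤ c) (h0 : D.Van w₀)
    (h : D.KVan (w + s * (c - 1))) : D.Van w := by
  induction s generalizing w w₀ with
  | zero => simpa [KVan] using h
  | succ s ih =>
    refine Van.of_cone hc h0 (ih (h0.cone hc) ?_)
    have : w + c - 1 + s * (c - 1) = w + (s + 1 : ℕ) * (c - 1) := by push_cast; ring
    rw [this]
    exact h

/-- A length-preserving short exact sequence `D₁ → D₂ → D₃[-1]`. -/
structure SES (D₁ D₂ D₃ : KData s c) (i : D₁.N →ₗ[ℚ] D₂.N) (p : D₂.N →ₗ[ℚ] D₃.N) : Prop where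
  inj : Function.Injective i
  i_d : ∀ a, i (D₁.d a) = D₂.d (i a)
  i_F : ∀ j a, i (D₁.F j a) = D₂.F j (i a)
  i_l : ∀ k, ∀ a ∈ D₁.l k, i a ∈ D₂.l k
  p_d : ∀ a, p (D₂.d a) = -D₃.d (p a)
  p_F : ∀ j a, p (D₂.F j a) = D₃.F j (p a)
  p_l : ∀ k, ∀ a ∈ D₂.l k, p a ∈ D₃.l (k - 1)
  surj : ∀ k, ∀ a ∈ D₃.l (k - 1), ∃ b ∈ D₂.l k, p b = a
  exact : ∀ k, ∀ b ∈ D₂.l k, p b = 0 → ∃ a ∈ D₁.l k, i a = b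

theorem SES.cone {D₁ D₂ D₃ : KData (s + 1) c} {i : D₁.N →ₗ[ℚ] D₂.N} {p : D₂.N →ₗ[ℚ] D₃.N}
    (h : SES D₁ D₂ D₃ i p) : SES D₁.cone D₂.cone D₃.cone (i.prodMap i) (p.prodMap (-p)) where
  inj := h.inj.prodMap h.inj
  i_d := by
    rintro ⟨a, b⟩
    refine Prod.ext ?_ ?_
    · exact (map_add i _ _).trans (congrArg₂ _ (h.i_d a) (h.i_F 0 b))
    · exact (map_neg i _).trans (congrArg _ (h.i_d b))
  i_F := by
    rintro j ⟨a, b⟩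
    exact Prod.ext (h.i_F _ a) (h.i_F _ b)
  i_l := by
    rintro k ⟨a, b⟩ hab
    exact ⟨h.i_l _ _ hab.1, h.i_l _ _ hab.2⟩
  p_d := by
    rintro ⟨a, b⟩
    refine Prod.ext ?_ ?_
    · change p (D₂.d a + D₂.F 0 b) = -(D₃.d (p a) + D₃.F 0 (-p b))
      rw [map_add, h.p_d, h.p_F, map_neg]; abel
    · change -p (-D₂.d b) = - -D₃.d (-p b)
      rw [map_neg, h.p_d, map_neg]
  p_F := by
    rintro j ⟨a, b⟩
    refine Prod.ext (h.p_F _ a) ?_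
    exact (congrArg Neg.neg (h.p_F _ b)).trans (map_neg _ _).symm
  p_l := by
    rintro k ⟨a, b⟩ hab
    refine ⟨h.p_l _ _ hab.1, Submodule.neg_mem _ ?_⟩
    have := h.p_l _ _ hab.2
    rwa [show k + 1 - c - 1 = k - 1 + 1 - c by ring] at this
  surj := by
    rintro k ⟨a, b⟩ hab
    obtain ⟨a', ha', rfl⟩ := h.surj _ a hab.1
    have h2 : b ∈ D₃.l _ := hab.2
    rw [show k - 1 + 1 - c = k + 1 - c - 1 by ring] at h2
    obtain ⟨b', hb', rfl⟩ := h.surj _ _ h2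
    exact ⟨(a', -b'), ⟨ha', Submodule.neg_mem _ hb'⟩,
      Prod.ext rfl (show -p (-b') = p b' by rw [map_neg, neg_neg])⟩
  exact := by
    rintro k ⟨a, b⟩ hab hp
    have hp2 : -p b = 0 := congrArg Prod.snd hp
    obtain ⟨a', ha', rfl⟩ := h.exact _ a hab.1 (congrArg Prod.fst hp)
    obtain ⟨b', hb', rfl⟩ := h.exact _ b hab.2 (neg_eq_zero.1 hp2)
    exact ⟨(a', b'), ⟨ha', hb'⟩, rfl⟩

theorem SES.kvan {D₁ D₂ D₃ : KData s c} {i : D₁.N →ₗ[ℚ] D₂.N} {p : D₂.N →ₗ[ℚ] D₃.N}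
    (h : SES D₁ D₂ D₃ i p) {w : ℤ} (h1 : D₁.KVan (w + 1)) (h3 : D₃.KVan w) : D₂.KVan (w + 1) := by
  induction s with
  | succ s ih => exact ih h.cone h1 h3
  | zero =>
    intro k hk b hb hdb
    obtain ⟨e, he, he'⟩ := h3 (k - 1) (by omega) (p b) (h.p_l _ _ hb)
      (by rw [← neg_eq_zero, ← h.p_d, hdb, map_zero])
    obtain ⟨e, he2, rfl⟩ := h.surj _ _ he
    have h2 := D₂.d_l _ _ he2
    rw [sub_add_cancel] at h2
    obtain ⟨a, ha, hab⟩ := h.exact k (b + D₂.d e) (Submodule.add_mem _ hb h2)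
      (by rw [map_add, h.p_d, he']; simp)
    obtain ⟨a', ha', rfl⟩ := h1 k (by omega) a ha
      (h.inj (by rw [h.i_d, hab, map_add, hdb, D₂.d_sq, map_zero, add_zero]))
    refine ⟨i a' - e, Submodule.sub_mem _ (h.i_l _ _ ha') he2, ?_⟩
    rw [map_sub, ← h.i_d, hab, add_sub_cancel_right]

theorem KVan.mono {D : KData s c} {w w' : ℤ} (h : D.KVan w) (hw : w ≤ w') : D.KVan w' := by
  induction s with
  | zero => exact fun k hk => h k (by omega)
  | succ s ih => exact ih h

/-- Left inverses of the endomorphisms `F_i`. -/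
structure Split (D : KData s c) (P : Fin s → D.N →ₗ[ℚ] D.N) : Prop where
  P_F : ∀ i a, P i (D.F i a) = a
  P_F_ne : ∀ i j, i ≠ j → ∀ a, P i (D.F j a) = D.F j (P i a)
  P_P : ∀ i j a, P i (P j a) = P j (P i a)
  P_d : ∀ i a, P i (D.d a) = D.d (P i a)
  P_l : ∀ i k, ∀ a ∈ D.l k, P i a ∈ D.l (k - c)

theorem Split.kvan {D : KData s c} {P : Fin s → D.N →ₗ[ℚ] D.N} (h : Split D P) {w : ℤ}
    (hw : ∀ k, w < k → ∀ a ∈ D.l k, D.d a = 0 → (∀ i, P i a = 0) → ∃ b ∈ D.l (k - 1), D.d b = a) :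
    D.KVan w := by
  induction s with
  | zero => exact fun k hk a ha hda => hw k hk a ha hda fun i => i.elim0
  | succ s ih =>
    refine ih (D := D.cone) (P := fun i => (P i.succ).prodMap (P i.succ)) ?_ ?_
    · refine ⟨?_, ?_, ?_, ?_, ?_⟩
      · rintro i ⟨a, b⟩
        exact Prod.ext (h.P_F _ a) (h.P_F _ b)
      · rintro i j hij ⟨a, b⟩
        have hij' : i.succ ≠ j.succ := fun e => hij (Fin.succ_injective _ e)
        exact Prod.ext (h.P_F_ne _ _ hij' a) (h.P_F_ne _ _ hij' b)
      · rintro i j ⟨a, b⟩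
        exact Prod.ext (h.P_P _ _ a) (h.P_P _ _ b)
      · rintro i ⟨a, b⟩
        refine Prod.ext ?_ ?_
        · exact (map_add (P i.succ) _ _).trans
            (congrArg₂ _ (h.P_d _ a) (h.P_F_ne _ _ (Fin.succ_ne_zero i) b))
        · exact (map_neg (P i.succ) _).trans (congrArg _ (h.P_d _ b))
      · rintro i k ⟨a, b⟩ hab
        refine ⟨h.P_l _ _ _ hab.1, ?_⟩
        have := h.P_l i.succ _ _ hab.2
        rwa [show k + 1 - c - c = k - c + 1 - c by ring] at this
    · rintro k hk ⟨a, b⟩ hab hd hP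
      have hd1 : D.d a + D.F 0 b = 0 := congrArg Prod.fst hd
      have hPa : ∀ i : Fin s, P i.succ a = 0 := fun i => congrArg Prod.fst (hP i)
      have ha : a ∈ D.l k := hab.1
      have hPl := h.P_l 0 _ _ ha
      have hFl := D.F_l 0 _ _ hPl
      rw [sub_add_cancel] at hFl
      have hb : b + D.d (P 0 a) = 0 := by
        have := congrArg (P 0) hd1
        rw [map_add, h.P_F, h.P_d, map_zero] at this
        exact (add_comm _ _).trans this
      obtain ⟨e, he, hea⟩ := hw k hk (a - D.F 0 (P 0 a)) (Submodule.sub_mem _ ha hFl)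
        (by
          rw [map_sub, D.d_F, sub_eq_add_neg, ← map_neg]
          rw [← eq_neg_iff_add_eq_zero.2 hb]; exact hd1)
        (by
          intro i
          refine Fin.cases ?_ (fun i => ?_) i
          · rw [map_sub, h.P_F, sub_self]
          · rw [map_sub, hPa, h.P_F_ne _ _ (Fin.succ_ne_zero i), h.P_P, hPa]; simp)
      refine ⟨(e, P 0 a), ⟨he, ?_⟩, Prod.ext ?_ ?_⟩
      · rwa [sub_add_cancel]
      · change D.d e + D.F 0 (P 0 a) = a
        rw [hea, sub_add_cancel]
      · exact (eq_neg_iff_add_eq_zero.2 hb).symm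

/-- Contracting homotopies of the endomorphisms `F_i`. -/
structure Null (D : KData s c) (H : Fin s → D.N →ₗ[ℚ] D.N) : Prop where
  hom : ∀ i a, D.d (H i a) + H i (D.d a) = D.F i a
  H_F : ∀ i j a, H i (D.F j a) = D.F j (H i a)
  H_l : ∀ i k, ∀ a ∈ D.l k, H i a ∈ D.l (k + c - 1)

theorem Null.van {D : KData s c} {H : Fin s → D.N →ₗ[ℚ] D.N} (h : Null D H) (hc : 1 ≤ c) {w : ℤ}
    (hw : D.KVan w) : D.Van w := by
  induction s with
  | zero => exact hw
  | succ s ih =>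
    have := ih (D := D.cone) (H := fun i => (H i.succ).prodMap (-H i.succ)) ?_ hw
    · intro k hk b hb hdb
      obtain ⟨⟨p, q⟩, hpq, hd⟩ := this (k + c - 1) (by omega) (-H 0 b, b)
        ⟨Submodule.neg_mem _ (h.H_l _ _ _ hb), by rwa [show k + c - 1 + 1 - c = k by ring]⟩
        (by
          have h0 := h.hom 0 b
          rw [hdb, map_zero, add_zero] at h0
          exact Prod.ext (show D.d (-H 0 b) + D.F 0 b = 0 by rw [map_neg, h0, neg_add_cancel])
            (show -D.d b = 0 by rw [hdb, neg_zero]))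
      have hd2 : -D.d q = b := congrArg Prod.snd hd
      refine ⟨-q, Submodule.neg_mem _ ?_, by rw [map_neg, hd2]⟩
      have : q ∈ D.l _ := hpq.2
      rwa [show k + c - 1 - 1 + 1 - c = k - 1 by ring] at this
    · refine ⟨?_, ?_, ?_⟩
      · rintro i ⟨a, b⟩
        refine Prod.ext ?_ ?_
        · change D.d (H i.succ a) + D.F 0 (-H i.succ b) + H i.succ (D.d a + D.F 0 b) = D.F i.succ a
          rw [← h.hom i.succ a, map_add, h.H_F, map_neg]; abel
        · change -D.d (-H i.succ b) + -H i.succ (-D.d b) = D.F i.succ b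
          rw [← h.hom i.succ b, map_neg, map_neg, neg_neg, neg_neg]
      · rintro i j ⟨a, b⟩
        refine Prod.ext (h.H_F _ _ a) ?_
        exact (congrArg Neg.neg (h.H_F _ _ b)).trans (map_neg _ _).symm
      · rintro i k ⟨a, b⟩ hab
        refine ⟨h.H_l _ _ _ hab.1, Submodule.neg_mem _ ?_⟩
        have := h.H_l i.succ _ _ hab.2
        rwa [show k + 1 - c + c - 1 = k + c - 1 + 1 - c by ring] at this

end KData

/-- A word-length grading for which the differential is quadratic. -/
structure LengthGrading (T : Type) [GCDGA T] (lam : ℕ → Submodule ℚ T) : Prop where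
  internal : DirectSum.IsInternal lam
  zero : lam 0 = 1
  mul : ∀ p q a b, a ∈ lam p → b ∈ lam q → a * b ∈ lam (p + q)
  d : ∀ k, ∀ a ∈ lam k, Dd T a ∈ lam (k + 1)
  hom : ∀ k i, ∀ a ∈ lam k, pr i a ∈ lam k

/-- Extension by zero of an `ℕ`-indexed family to `ℤ`. -/
def zext {M : Type} [AddCommGroup M] [Module ℚ M] (lam : ℕ → Submodule ℚ M) (k : ℤ) :
    Submodule ℚ M := if 0 ≤ k then lam k.toNat else ⊥

section zext

variable {M : Type} [AddCommGroup M] [Module ℚ M] {lam : ℕ → Submodule ℚ M}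

@[simp] theorem zext_natCast (k : ℕ) : zext lam k = lam k := by simp [zext]

theorem mem_zext {k : ℤ} {a : M} (h : a ∈ zext lam k) : a = 0 ∨ ∃ j : ℕ, k = j ∧ a ∈ lam j := by
  by_cases hk : 0 ≤ k
  · exact Or.inr ⟨k.toNat, by omega, by simpa [zext, hk] using h⟩
  · exact Or.inl (by simpa [zext, hk] using h)

theorem mem_zext_of_eq {k : ℤ} {j : ℕ} {a : M} (h : k = j) (ha : a ∈ lam j) : a ∈ zext lam k := by
  subst h; simpa using ha

theorem mem_zext_shiftG_iff {k : ℤ} {a : M} :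
    a ∈ zext (shiftG lam 1) k ↔ a ∈ zext lam (k - 1) := by
  constructor
  · intro h
    rcases mem_zext h with rfl | ⟨j, rfl, hj⟩
    · simp
    · rcases mem_shiftG hj with rfl | ⟨l, rfl, hl⟩
      · simp
      · exact mem_zext_of_eq (by push_cast; ring) hl
  · intro h
    rcases mem_zext h with rfl | ⟨j, hk, hj⟩
    · simp
    · exact mem_zext_of_eq (j := j + 1) (by push_cast; omega) (mem_shiftG_add.2 hj)

theorem mem_zext_shiftProd {k : ℤ} {s : ℕ} {a b : M} :
    (a, b) ∈ zext (shiftProd lam s) k ↔ a ∈ zext lam k ∧ b ∈ zext (shiftG lam s) k := by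
  by_cases hk : 0 ≤ k <;> simp [zext, hk, shiftProd]

end zext

/-- A family of closed even elements of length `c`. -/
structure KFam {T : Type} [GCDGA T] (lam : ℕ → Submodule ℚ T) (c : ℕ) {s : ℕ} (h : Fin s → T) :
    Prop where
  even : ∀ j, ∃ m, Even m ∧ h j ∈ Gr T m
  closed : ∀ j, Dd T (h j) = 0
  len : ∀ j, h j ∈ lam c

section TK

variable {T : Type} [GCDGA T] {lam : ℕ → Submodule ℚ T}

theorem KFam.comm {c s : ℕ} {h : Fin s → T} (hh : KFam lam c h) (j : Fin s) (a : T) :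
    h j * a = a * h j := by
  obtain ⟨m, hm, hj⟩ := hh.even j
  exact even_comm hm hj a

theorem KFam.sg {c s : ℕ} {h : Fin s → T} (hh : KFam lam c h) (j : Fin s) :
    RHT.sg (h j) = h j := by
  obtain ⟨m, hm, hj⟩ := hh.even j
  exact sg_even hm hj

/-- The Koszul data of a family acting by multiplication. -/
def TK (hL : LengthGrading T lam) {c s : ℕ} {h : Fin s → T} (hh : KFam lam c h) : KData s c where
  N := T
  d := Dd T
  F j := LinearMap.mulLeft ℚ (h j)
  l := zext lam
  d_sq := Dd_Dd
  d_F j a := by simp [Dd_mul, hh.closed, hh.sg]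
  F_F i j a := by simp [← mul_assoc, hh.comm i (h j)]
  d_l k a ha := by
    rcases mem_zext ha with rfl | ⟨j, rfl, hj⟩
    · simp
    · exact mem_zext_of_eq (by simp) (hL.d _ _ hj)
  F_l i k a ha := by
    rcases mem_zext ha with rfl | ⟨j, rfl, hj⟩
    · simp
    · exact mem_zext_of_eq (by push_cast; ring) (hL.mul _ _ _ _ (hh.len i) hj)

end TK

namespace OExt

variable {T : Type} [GCDGA T] (o : OData T)

/-- The inclusion of the base. -/
def inc : T →ₐ[ℚ] OExt o :=
  AlgHom.ofLinearMap
    { toFun := fun t => mk t 0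
      map_add' := by simp [mk_add]
      map_smul' := fun q a => by simp [mk_smul] } rfl (by simp [mk_mul])

theorem inc_apply (a : T) : inc o a = mk a 0 := rfl

theorem inc_dga : IsDGAHom (inc o) :=
  ⟨fun a => by simp [inc_apply, Dd_mk], fun i a ha => by
    rw [inc_apply, mem_Gr]; exact ⟨ha, Submodule.zero_mem _⟩⟩

theorem inc_inj : Function.Injective (inc o) := fun _ _ h => (mk_inj.1 h).1

/-- The new generator. -/
def u : OExt o := mk 0 1

theorem u_mem : u o ∈ Gr (OExt o) o.k := by
  rw [u, mem_Gr]
  refine ⟨Submodule.zero_mem _, ?_⟩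
  have := (mem_shiftG_add (G := Gr T) (s := o.k) (i := 0) (b := 1)).2 gr_one
  rwa [zero_add] at this

theorem Dd_u : Dd (OExt o) (u o) = inc o o.f := by simp [u, Dd_mk, inc_apply, Dd_one]

theorem mk_eq (a b : T) : (mk a b : OExt o) = inc o a + u o * inc o b := by
  simp [inc_apply, u, mk_mul, mk_add]

variable {o}

theorem exists_lift {B : Type} [GCDGA B] (h : T →ₐ[ℚ] B) (hh : IsDGAHom h) {b : B}
    (hb : b ∈ Gr B o.k) (hd : Dd B b = h o.f) :
    ∃ H : OExt o →ₐ[ℚ] B, IsDGAHom H ∧ H.comp (inc o) = h ∧ H (u o) = b := by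
  let L : OExt o →ₗ[ℚ] B :=
    { toFun := fun p => h p.1 + b * h p.2
      map_add' := fun p q => by
        induction p using ind; induction q using ind
        rw [mk_add]; simp only [mk, map_add, mul_add]; abel
      map_smul' := fun q p => by
        induction p using ind
        rw [mk_smul]; simp [mk] }
  have hL : ∀ x y, L (mk x y) = h x + b * h y := fun _ _ => rfl
  let H : OExt o →ₐ[ℚ] B := AlgHom.ofLinearMap L (by rw [one_def, hL]; simp) (by
    intro p q
    induction p using ind with | h a c
    induction q using ind with | h a' c'
    rw [mk_mul, hL, hL, hL]
    have h1 : h a * b = b * h (sg a) := by rw [odd_comm o.hk hb, hh.sg]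
    have h2 : b * h c * b = 0 := by
      rw [mul_assoc, odd_comm o.hk hb, ← mul_assoc, odd_sq o.hk hb, zero_mul]
    simp only [map_mul, map_add, mul_add, add_mul, ← mul_assoc, h1, h2, add_zero]
    abel)
  have hH : ∀ x y, H (mk x y) = h x + b * h y := fun _ _ => rfl
  refine ⟨H, ⟨?_, ?_⟩, ?_, ?_⟩
  · intro p
    induction p using ind with | h a c
    rw [Dd_mk, hH, hH]
    simp only [map_add, map_mul, map_neg, Dd_mul, hd, hh.1, sg_odd o.hk hb]
    simp [mul_neg, add_assoc]
  · intro i p hp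
    induction p using ind with | h a c
    rw [mem_Gr] at hp
    rw [hH]
    refine Submodule.add_mem _ (hh.2 _ _ hp.1) ?_
    rcases mem_shiftG hp.2 with rfl | ⟨l, rfl, hl⟩
    · simp
    · rw [add_comm]; exact gr_mul hb (hh.2 _ _ hl)
  · ext a
    simp [inc_apply, hH]
  · rw [u, hH]; simp

theorem gen {S : Subalgebra ℚ (OExt o)} (h1 : ∀ t, inc o t ∈ S) (h2 : u o ∈ S) : S = ⊤ := by
  refine eq_top_iff.2 fun x _ => ?_
  induction x using ind with | h a b
  rw [mk_eq]
  exact S.add_mem (h1 a) (S.mul_mem h2 (h1 b))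

theorem pr_mk (i : ℕ) (a b : T) :
    pr i (mk a b : OExt o) = mk (pr i a) (if o.k ≤ i then pr (i - o.k) b else 0) := by
  have := ipr_eq_of_proj (M := OExt o) (gr_internal (OExt o)) (shiftProj (gr_internal T) o.k)
    (shiftProj_same _ _) (shiftProj_ne _ _) i (mk a b)
  refine this.trans ?_
  refine Prod.ext rfl ?_
  change (if o.k ≤ i then ipr (gr_internal T) (i - o.k) else 0) b = _
  split_ifs <;> rfl

variable (o) in
/-- The length grading of the extension. -/
def len (lam : ℕ → Submodule ℚ T) (k : ℕ) : Submodule ℚ (OExt o) := shiftProd lam 1 k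

theorem mem_len {lam : ℕ → Submodule ℚ T} {k : ℕ} {a b : T} :
    (mk a b : OExt o) ∈ len o lam k ↔ a ∈ lam k ∧ b ∈ shiftG lam 1 k := Iff.rfl

theorem _root_.RHT.LengthGrading.sg {lam : ℕ → Submodule ℚ T} (hL : LengthGrading T lam) {k : ℕ}
    {a : T} (ha : a ∈ lam k) : RHT.sg a ∈ lam k :=
  sg_eq_sum_pr a fun i => hL.hom k i a ha

theorem lengthGrading {lam : ℕ → Submodule ℚ T} (hL : LengthGrading T lam) (hf : o.f ∈ lam 2) :
    LengthGrading (OExt o) (len o lam) where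
  internal := shiftProd_internal hL.internal 1
  zero := by
    ext x
    induction x using ind with | h a b
    have hb : b ∈ shiftG lam 1 0 ↔ b = 0 := by simp [shiftG]
    rw [mem_len, hL.zero, hb, Submodule.mem_one, Submodule.mem_one]
    simp only [Algebra.algebraMap_eq_smul_one]
    constructor
    · rintro ⟨⟨q, rfl⟩, rfl⟩
      exact ⟨q, by rw [one_def, mk_smul, smul_zero]⟩
    · rintro ⟨q, hq⟩
      rw [one_def, mk_smul, smul_zero, mk_inj] at hq
      exact ⟨⟨q, hq.1⟩, hq.2.symm⟩
  mul p q x y hx hy := by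
    induction x using ind with | h a b
    induction y using ind with | h c e
    rw [mem_len] at hx hy
    rw [mk_mul, mem_len]
    exact ⟨hL.mul _ _ _ _ hx.1 hy.1, Submodule.add_mem _ (shiftG_mul_left hL.mul (hL.sg hx.1) hy.2)
      (shiftG_mul_right hL.mul hx.2 hy.1)⟩
  d k x hx := by
    induction x using ind with | h a b
    rw [mem_len] at hx
    rw [Dd_mk, mem_len]
    rcases mem_shiftG hx.2 with rfl | ⟨l, rfl, hl⟩
    · simpa using hL.d _ _ hx.1
    · refine ⟨Submodule.add_mem _ (hL.d _ _ hx.1) ?_, ?_⟩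
      · have := hL.mul _ _ _ _ hf hl
        rwa [show l + 1 + 1 = 2 + l by ring]
      · rw [mem_shiftG_add]
        exact Submodule.neg_mem _ (hL.d _ _ hl)
  hom k i x hx := by
    induction x using ind with | h a b
    rw [mem_len] at hx
    rw [pr_mk, mem_len]
    refine ⟨hL.hom _ _ _ hx.1, ?_⟩
    split_ifs
    · rcases mem_shiftG hx.2 with rfl | ⟨l, rfl, hl⟩
      · simp
      · rw [mem_shiftG_add]; exact hL.hom _ _ _ hl
    · exact Submodule.zero_mem _

theorem kvan {lam : ℕ → Submodule ℚ T} (hL : LengthGrading T lam) (hf : o.f ∈ lam 2) {c s : ℕ}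
    {h : Fin s → T} (hh : KFam lam c h) (hh' : KFam (len o lam) c fun j => inc o (h j)) {w : ℤ}
    (hw : (TK hL hh).KVan w) : (TK (lengthGrading hL hf) hh').KVan (w + 1) := by
  have ses : KData.SES (TK hL hh) (TK (lengthGrading hL hf) hh') (TK hL hh)
      (inc o).toLinearMap (LinearMap.snd ℚ T T) := by
    refine ⟨inc_inj o, (inc_dga o).1, fun j a => map_mul (inc o) _ _, ?_, ?_, ?_, ?_, ?_, ?_⟩
    · intro k a ha
      exact mem_zext_shiftProd.2 ⟨ha, Submodule.zero_mem _⟩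
    · exact fun _ => rfl
    · intro j x
      obtain ⟨a, b⟩ : T × T := x
      exact (congrArg₂ (· + ·) (congrArg (· * b) (hh.sg j)) (zero_mul a)).trans (add_zero _)
    · intro k x hx
      obtain ⟨a, b⟩ : T × T := x
      exact mem_zext_shiftG_iff.1 (mem_zext_shiftProd.1 hx).2
    · intro k a ha
      exact ⟨(mk 0 a : OExt o), mem_zext_shiftProd.2 ⟨Submodule.zero_mem _, mem_zext_shiftG_iff.2 ha⟩, rfl⟩
    · intro k x hx h0
      obtain ⟨a, b⟩ : T × T := x
      have : b = 0 := h0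
      subst this
      exact ⟨a, (mem_zext_shiftProd.1 hx).1, rfl⟩
  exact ses.kvan (hw.mono (by omega)) hw

end OExt

/-- The data needed to adjoin a family of odd generators `g_a` with `dg_a = f_a`. -/
structure Attach (T : Type) [GCDGA T] (ι : Type) where
  k : ι → ℕ
  hk : ∀ a, Odd (k a)
  f : ι → T
  f_mem : ∀ a, f a ∈ Gr T (k a + 1)
  f_closed : ∀ a, Dd T (f a) = 0

/-- A module retraction of the inclusion of `T` in a complex with an acyclic subcomplex `N`,
compatible with multiplication by the elements `f_a`; the left ideal `I` is sent into `N`. -/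
structure Retr (T : Type) [GCDGA T] {ι : Type} (f : ι → T) (I : Submodule ℚ T) where
  C : Type
  [ac : AddCommGroup C]
  [mo : Module ℚ C]
  d : C →ₗ[ℚ] C
  F : ι → C →ₗ[ℚ] C
  j : T →ₗ[ℚ] C
  τ : C →ₗ[ℚ] T
  N : Submodule ℚ C
  d_F : ∀ a c, d (F a c) = F a (d c)
  F_F : ∀ a b c, F a (F b c) = F b (F a c)
  j_d : ∀ t, j (Dd T t) = d (j t)
  j_F : ∀ a t, j (f a * t) = F a (j t)
  τ_d : ∀ c, τ (d c) = Dd T (τ c)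
  τ_F : ∀ a c, τ (F a c) = f a * τ c
  τ_j : ∀ t, τ (j t) = t
  F_N : ∀ a, ∀ c ∈ N, F a c ∈ N
  N_acyclic : ∀ c ∈ N, d c = 0 → ∃ e ∈ N, d e = c
  j_I : ∀ t ∈ I, j t ∈ N

attribute [instance] Retr.ac Retr.mo

/-- The extension of `T` by a finite family of odd generators, with the properties needed below. -/
structure ExtData (T : Type) [GCDGA T] {ι : Type} (at' : Attach T ι) where
  D : Type
  [inst : GCDGA D]
  i : T →ₐ[ℚ] D
  g : ι → D
  i_dga : IsDGAHom i
  i_inj : Function.Injective i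
  g_mem : ∀ a, g a ∈ Gr D (at'.k a)
  g_d : ∀ a, Dd D (g a) = i (at'.f a)
  lift : ∀ (B : Type) [GCDGA B] (h : T →ₐ[ℚ] B), IsDGAHom h → ∀ b : ι → B,
    (∀ a, b a ∈ Gr B (at'.k a)) → (∀ a, Dd B (b a) = h (at'.f a)) →
    ∃ H : D →ₐ[ℚ] B, IsDGAHom H ∧ (∀ t, H (i t) = h t) ∧ ∀ a, H (g a) = b a
  gen : ∀ S : Subalgebra ℚ D, (∀ t, i t ∈ S) → (∀ a, g a ∈ S) → S = ⊤
  retr : ∀ I : Submodule ℚ T, Retr T at'.f I → (∀ t, ∀ a ∈ I, t * a ∈ I) →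
    ∃ J : Submodule ℚ D, (∀ t, ∀ a ∈ J, t * a ∈ J) ∧ (∀ a ∈ I, i a ∈ J) ∧
      ∀ z ∈ J, Dd D z = 0 → ∃ e, z = Dd D e
  top : ∃ l : List ι, (∀ a, a ∈ l) ∧ ((∀ a, at'.f a = 0) → ∀ π : D →ₐ[ℚ] T, IsDGAHom π →
    (∀ t, π (i t) = t) → (∀ a, π (g a) = 0) → ∀ m e, (l.map g).prod * m = Dd D e →
    ∃ e', π m = Dd T e')
  len : ∀ lam : ℕ → Submodule ℚ T, ∀ hL : LengthGrading T lam, (∀ a, at'.f a ∈ lam 2) →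
    ∃ lam' : ℕ → Submodule ℚ D, ∃ hL' : LengthGrading D lam', (∀ k, ∀ a ∈ lam k, i a ∈ lam' k) ∧
      (∀ a, g a ∈ lam' 1) ∧
      (∀ (B : Type) [Ring B] [Algebra ℚ B] (M : ℕ → Submodule ℚ B) (H : D →ₐ[ℚ] B),
        (∀ p q a b, a ∈ M p → b ∈ M q → a * b ∈ M (p + q)) →
        (∀ k, ∀ a ∈ lam k, H (i a) ∈ M k) → (∀ a, H (g a) ∈ M 1) →
        ∀ k, ∀ a ∈ lam' k, H a ∈ M k) ∧
      ∀ (s c : ℕ) (h : Fin s → T) (hh : KFam lam c h) (hh' : KFam lam' c fun j => i (h j)) (w : ℤ),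
        (TK hL hh).KVan w → (TK hL' hh').KVan (w + Nat.card ι)

attribute [instance] ExtData.inst

namespace ExtData

variable {T : Type} [GCDGA T]

theorem of_isEmpty {ι : Type} [IsEmpty ι] (α : Attach T ι) : Nonempty (ExtData T α) := by
  refine ⟨{ D := T, i := AlgHom.id ℚ T, g := isEmptyElim, i_dga := isDGAHom_id T
            i_inj := Function.injective_id, g_mem := isEmptyElim, g_d := isEmptyElim
            lift := fun B _ h hh b _ _ => ⟨h, hh, fun _ => rfl, isEmptyElim⟩
            gen := fun S h _ => eq_top_iff.2 fun t _ => h t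
            retr := ?_, top := ?_, len := ?_ }⟩
  · refine fun I R hI => ⟨I, hI, fun _ h => h, fun z hz hd => ?_⟩
    obtain ⟨e, -, he⟩ := R.N_acyclic _ (R.j_I z hz) (by rw [← R.j_d, hd, map_zero])
    exact ⟨R.τ e, by rw [← R.τ_d, he, R.τ_j]⟩
  · refine ⟨[], isEmptyElim, fun _ π _ h _ m e he => ⟨e, ?_⟩⟩
    rw [← he]
    simpa using h m
  · refine fun lam hL _ => ⟨lam, hL, fun _ _ h => h, isEmptyElim, fun B _ _ M H _ h _ => h, ?_⟩
    intro s c h hh hh' w hw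
    simpa using hw

theorem of_equiv {ι κ : Type} (e : ι ≃ κ)
    (h : ∀ α : Attach T ι, Nonempty (ExtData T α)) (β : Attach T κ) : Nonempty (ExtData T β) := by
  obtain ⟨E⟩ := h ⟨fun a => β.k (e a), fun a => β.hk _, fun a => β.f (e a), fun a => β.f_mem _,
    fun a => β.f_closed _⟩
  refine ⟨{ D := E.D, i := E.i, g := fun a => E.g (e.symm a), i_dga := E.i_dga, i_inj := E.i_inj
            g_mem := fun a => by simpa using E.g_mem (e.symm a)
            g_d := fun a => by simpa using E.g_d (e.symm a)
            lift := ?_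
            gen := fun S h1 h2 => E.gen S h1 fun a => by simpa using h2 (e a)
            retr := ?_, top := ?_, len := ?_ }⟩
  · intro B _ h hh b hb hd
    obtain ⟨H, h1, h2, h3⟩ := E.lift B h hh (fun a => b (e a)) (fun a => hb _) fun a => hd _
    exact ⟨H, h1, h2, fun a => by simpa using h3 (e.symm a)⟩
  · intro I R hI
    refine E.retr I ⟨R.C, R.d, fun a => R.F (e a), R.j, R.τ, R.N, fun a => R.d_F _,
      fun a b => R.F_F _ _, R.j_d, fun a => R.j_F _, R.τ_d, fun a => R.τ_F _, R.τ_j,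
      fun a => R.F_N _, R.N_acyclic, R.j_I⟩ hI
  · obtain ⟨l, hl, h⟩ := E.top
    refine ⟨l.map e, fun a => List.mem_map.2 ⟨e.symm a, hl _, by simp⟩, ?_⟩
    intro h0 π h1 h2 h3 m x hx
    refine h (fun a => h0 _) π h1 h2 (fun a => by simpa using h3 (e a)) m x ?_
    rw [← hx, List.map_map]
    congr 3
    funext a
    simp
  · intro lam hL hf
    obtain ⟨lam', hL', h1, h2, h3, h4⟩ := E.len lam hL fun a => hf _
    refine ⟨lam', hL', h1, fun a => h2 _, ?_, ?_⟩
    · intro B _ _ M H hM hi hg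
      exact h3 B M H hM hi fun a => by simpa using hg (e a)
    · intro s c h hh hh' w hw
      have := h4 s c h hh hh' w hw
      rwa [Nat.card_congr e] at this

/-- The cone of a retraction along the first element. -/
def _root_.RHT.Retr.cone {ι : Type} {α : Attach T (Option ι)} {I : Submodule ℚ T}
    (R : Retr T α.f I) (o : OData T) (ho : o.f = α.f none) :
    Retr (OExt o) (fun a => OExt.inc o (α.f (some a))) (I.prod I : Submodule ℚ (T × T)) where
  C := R.C × R.C
  d := (R.d ∘ₗ LinearMap.fst ℚ R.C R.C + R.F none ∘ₗ LinearMap.snd ℚ R.C R.C).prod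
    (-(R.d ∘ₗ LinearMap.snd ℚ R.C R.C))
  F a := (R.F (some a)).prodMap (R.F (some a))
  j := R.j.prodMap R.j
  τ := R.τ.prodMap R.τ
  N := R.N.prod R.N
  d_F := by
    rintro a ⟨x, y⟩
    simp [R.d_F, R.F_F (some a) none]
  F_F := by
    rintro a b ⟨x, y⟩
    simp [R.F_F (some a) (some b)]
  j_d := by
    rintro ⟨x, y⟩
    refine Prod.ext ?_ ?_
    · change R.j (Dd T x + o.f * y) = R.d (R.j x) + R.F none (R.j y)
      rw [map_add, R.j_d, ho, R.j_F]
    · change R.j (-Dd T y) = -R.d (R.j y)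
      rw [map_neg, R.j_d]
  j_F := by
    rintro a ⟨x, y⟩
    refine Prod.ext (R.j_F _ x) ?_
    change R.j (sg (α.f (some a)) * y + 0 * x) = _
    rw [sg_even ((α.hk _).add_odd odd_one) (α.f_mem _), zero_mul, add_zero]
    exact R.j_F _ y
  τ_d := by
    rintro ⟨x, y⟩
    refine Prod.ext ?_ ?_
    · change R.τ (R.d x + R.F none y) = Dd T (R.τ x) + o.f * R.τ y
      rw [map_add, R.τ_d, ho, R.τ_F]
    · change R.τ (-R.d y) = -Dd T (R.τ y)
      rw [map_neg, R.τ_d]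
  τ_F := by
    rintro a ⟨x, y⟩
    refine Prod.ext (R.τ_F _ x) ?_
    change R.τ (R.F (some a) y) = sg (α.f (some a)) * R.τ y + 0 * R.τ x
    rw [sg_even ((α.hk _).add_odd odd_one) (α.f_mem _), zero_mul, add_zero]
    exact R.τ_F _ y
  τ_j := by
    rintro ⟨x, y⟩
    exact Prod.ext (R.τ_j x) (R.τ_j y)
  F_N := by
    rintro a ⟨x, y⟩ h
    exact ⟨R.F_N _ _ h.1, R.F_N _ _ h.2⟩
  N_acyclic := by
    rintro ⟨x, y⟩ ⟨hx, hy⟩ hd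
    have hd1 : R.d x + R.F none y = 0 := congrArg Prod.fst hd
    have hd2 : -R.d y = 0 := congrArg Prod.snd hd
    obtain ⟨y', hy', hyd⟩ := R.N_acyclic y hy (neg_eq_zero.1 hd2)
    obtain ⟨x', hx', hxd⟩ := R.N_acyclic (x + R.F none y') (R.N.add_mem hx (R.F_N _ _ hy'))
      (by rw [map_add, R.d_F, hyd, hd1])
    refine ⟨(x', -y'), ⟨hx', R.N.neg_mem hy'⟩, Prod.ext ?_ ?_⟩
    · change R.d x' + R.F none (-y') = x
      rw [hxd, map_neg, add_neg_cancel_right]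
    · change -R.d (-y') = y
      rw [map_neg, neg_neg, hyd]
  j_I := by
    rintro ⟨x, y⟩ ⟨hx, hy⟩
    exact ⟨R.j_I _ hx, R.j_I _ hy⟩

theorem of_option {ι : Type} [Finite ι]
    (h : ∀ (T : Type) [GCDGA T] (α : Attach T ι), Nonempty (ExtData T α))
    (α : Attach T (Option ι)) : Nonempty (ExtData T α) := by
  let o : OData T := ⟨α.k none, α.hk none, α.f none, α.f_mem none, α.f_closed none⟩
  obtain ⟨E⟩ := h (OExt o) ⟨fun a => α.k (some a), fun a => α.hk _,
    fun a => OExt.inc o (α.f (some a)), fun a => (OExt.inc_dga o).2 _ _ (α.f_mem _),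
    fun a => by rw [← (OExt.inc_dga o).1, α.f_closed, map_zero]⟩
  let g : Option ι → E.D := fun a => a.elim (E.i (OExt.u o)) E.g
  refine ⟨{ D := E.D, i := E.i.comp (OExt.inc o), g := g, i_dga := E.i_dga.comp (OExt.inc_dga o)
            i_inj := E.i_inj.comp (OExt.inc_inj o), g_mem := ?_, g_d := ?_
            lift := ?_, gen := ?_, retr := ?_, top := ?_, len := ?_ }⟩
  · rintro (_ | a)
    · exact E.i_dga.2 _ _ (OExt.u_mem o)
    · exact E.g_mem a
  · rintro (_ | a)
    · exact (E.i_dga.1 _).symm.trans (congrArg E.i (OExt.Dd_u o))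
    · exact E.g_d a
  · intro B _ h hh b hb hd
    obtain ⟨H, h1, h2, h3⟩ := OExt.exists_lift (o := o) h hh (hb none) (hd none)
    have h2' : ∀ t, H (OExt.inc o t) = h t := fun t => DFunLike.congr_fun h2 t
    obtain ⟨K, k1, k2, k3⟩ := E.lift B H h1 (fun a => b (some a)) (fun a => hb _)
      (fun a => by rw [hd, h2'])
    refine ⟨K, k1, fun t => by simp [k2, h2'], ?_⟩
    rintro (_ | a)
    · exact (k2 _).trans h3
    · exact k3 a
  · intro S h1 h2
    refine E.gen S (fun t => ?_) fun a => h2 (some a)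
    have : S.comap E.i = ⊤ := OExt.gen (fun t => h1 t) (h2 none)
    have ht : t ∈ S.comap E.i := by rw [this]; trivial
    exact ht
  · intro I R hI
    obtain ⟨J, h1, h2, h3⟩ := E.retr _ (R.cone o rfl) (by
      rintro ⟨s, t⟩ ⟨x, y⟩ ⟨hx, hy⟩
      exact ⟨hI _ _ hx, I.add_mem (hI _ _ hy) (hI _ _ hx)⟩)
    exact ⟨J, h1, fun a ha => h2 _ ⟨ha, I.zero_mem⟩, h3⟩
  · obtain ⟨l, hl, h⟩ := E.top
    refine ⟨l.map some ++ [none], ?_, ?_⟩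
    · rintro (_ | a)
      · simp
      · simp [hl]
    · intro h0 π hπ h1 h2 m x hx
      obtain ⟨π₂, p1, p2, p3⟩ := E.lift (OExt o) (AlgHom.id ℚ _) (isDGAHom_id _) (fun _ => 0)
        (fun _ => Submodule.zero_mem _) (fun a => by simp [h0])
      obtain ⟨π₁, q1, q2, q3⟩ := OExt.exists_lift (o := o) (AlgHom.id ℚ T) (isDGAHom_id T)
        (b := 0) (Submodule.zero_mem _) (by rw [map_zero]; exact (h0 none).symm)
      have hq : ∀ t, π₁ (OExt.inc o t) = t := fun t => DFunLike.congr_fun q2 t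
      have hcomp : π = π₁.comp π₂ := by
        have : AlgHom.equalizer π (π₁.comp π₂) = ⊤ := by
          refine E.gen _ (fun t => ?_) fun a => ?_
          · have : (AlgHom.equalizer π (π₁.comp π₂)).comap E.i = ⊤ := by
              refine OExt.gen (fun t => ?_) ?_
              · change π (E.i (OExt.inc o t)) = π₁ (π₂ (E.i (OExt.inc o t)))
                rw [p2]
                exact (h1 t).trans (hq t).symm
              · change π (E.i (OExt.u o)) = π₁ (π₂ (E.i (OExt.u o)))
                rw [p2]
                exact (h2 none).trans q3.symm
            have ht : t ∈ (AlgHom.equalizer π (π₁.comp π₂)).comap E.i := by rw [this]; trivial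
            exact ht
          · change π (E.g a) = π₁ (π₂ (E.g a))
            exact (h2 (some a)).trans ((congrArg π₁ (p3 a)).trans (map_zero π₁)).symm
        ext t
        have ht : t ∈ AlgHom.equalizer π (π₁.comp π₂) := by rw [this]; trivial
        exact ht
      obtain ⟨y, hy⟩ := h (fun a => by simp [h0]) π₂ p1 p2 p3 (E.i (OExt.u o) * m) x (by
        rw [← hx, List.map_append, List.prod_append, List.map_map, mul_assoc]
        have : g ∘ some = E.g := rfl
        rw [this]
        simp [g])
      rw [map_mul, p2, AlgHom.id_apply] at hy
      subst hcomp
      rw [AlgHom.comp_apply]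
      generalize π₂ m = m' at hy
      induction m' using OExt.ind with | h a b
      induction y using OExt.ind with | h p q
      rw [OExt.u, OExt.mk_mul, OExt.Dd_mk, OExt.mk_inj] at hy
      refine ⟨-q, ?_⟩
      have hu : π₁ (OExt.u o) = 0 := q3
      rw [OExt.mk_eq, map_add, map_mul, hu, hq, zero_mul, add_zero, map_neg, ← hy.2]
      simp
  · intro lam hL hf
    obtain ⟨lam', hL', h1, h2, h3, h4⟩ := E.len (OExt.len o lam)
      (OExt.lengthGrading hL (hf none)) fun a => ⟨hf _, Submodule.zero_mem _⟩
    refine ⟨lam', hL', fun k a ha => h1 k _ ⟨ha, Submodule.zero_mem _⟩, ?_, ?_, ?_⟩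
    · rintro (_ | a)
      · refine h1 1 _ ⟨Submodule.zero_mem _, ?_⟩
        have : (1 : T) ∈ lam 0 := by rw [hL.zero]; exact Submodule.one_le.1 le_rfl
        exact mem_shiftG_add.2 this
      · exact h2 a
    · intro B _ _ M H hM hi hg
      refine h3 B M H hM ?_ fun a => hg (some a)
      intro k x hx
      induction x using OExt.ind with | h a b
      rw [OExt.mem_len] at hx
      rw [OExt.mk_eq, map_add, map_mul, map_add, map_mul]
      refine Submodule.add_mem _ (hi _ _ hx.1) ?_
      rcases mem_shiftG hx.2 with rfl | ⟨l, rfl, hl⟩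
      · simp
      · rw [add_comm]
        exact hM _ _ _ _ (hg none) (hi _ _ hl)
    · intro s c h hh hh' w hw
      have hh₁ : KFam (OExt.len o lam) c fun j => OExt.inc o (h j) := by
        refine ⟨fun j => ?_, fun j => ?_, fun j => ⟨hh.len j, Submodule.zero_mem _⟩⟩
        · obtain ⟨m, hm, hj⟩ := hh.even j
          exact ⟨m, hm, (OExt.inc_dga o).2 _ _ hj⟩
        · rw [← (OExt.inc_dga o).1, hh.closed, map_zero]
      have := h4 s c _ hh₁ hh' _ (OExt.kvan hL (hf none) hh hh₁ hw)
      rw [Finite.card_option]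
      push_cast
      exact (by ring : w + 1 + (Nat.card ι : ℤ) = w + ((Nat.card ι : ℤ) + 1)) ▸ this

end ExtData

/-- Finite families of odd generators can be adjoined. -/
theorem nonempty_extData {ι : Type} [Finite ι] : ∀ (T : Type) [GCDGA T] (α : Attach T ι),
    Nonempty (ExtData T α) :=
  Finite.induction_empty_option
    (P := fun ι => ∀ (T : Type) [GCDGA T] (α : Attach T ι), Nonempty (ExtData T α))
    (fun e h _ _ α => ExtData.of_equiv e (h _) α) (fun _ _ α => ExtData.of_isEmpty α)
    (fun h _ _ α => ExtData.of_option h α) ι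

/-- The extension by a finite family of odd generators. -/
def extData {T : Type} [GCDGA T] {ι : Type} [Finite ι] (α : Attach T ι) : ExtData T α :=
  (nonempty_extData T α).some

section Constructions

variable {A B : Type}

/-- A subalgebra stable under the homogeneous projections and the differential is a gcdga. -/
@[reducible] def GCDGA.subalg [GCDGA A] (S : Subalgebra ℚ A) (hpr : ∀ i, ∀ a ∈ S, pr i a ∈ S)
    (hd : ∀ a ∈ S, Dd A a ∈ S) : GCDGA S :=
  GCDGA.ofInternal S (fun i => (Gr A i).comap S.val.toLinearMap)
    (isInternal_of_proj (fun i => (pr i).restrict (p := S.toSubmodule) (q := S.toSubmodule) (hpr i))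
      (fun i a ha => Subtype.ext (ipr_same _ ha))
      (fun i j hij a ha => Subtype.ext (ipr_ne _ ha hij)) (by
        rintro ⟨a, ha⟩
        obtain ⟨s, hs⟩ := exists_sum_ipr (gr_internal A) a
        have : (⟨a, ha⟩ : S) = ∑ i ∈ s, ⟨pr i a, hpr i a ha⟩ := by
          refine Subtype.ext ?_
          rw [AddSubmonoidClass.coe_finsetSum]
          exact hs.symm
        rw [this]
        exact Submodule.sum_mem _ fun i _ => Submodule.mem_iSup_of_mem i (ipr_mem _ _ _)))
    gr_one (fun _ _ _ _ ha hb => gr_mul (A := A) ha hb)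
    (fun _ _ _ _ ha hb => Subtype.ext (gr_comm (A := A) ha hb))
    ((Dd A).restrict (p := S.toSubmodule) (q := S.toSubmodule) hd)
    (fun b => Subtype.ext (Dd_Dd (b : A))) (fun _ _ hb => Dd_gr (A := A) hb)
    (fun _ _ b ha => Subtype.ext (Dd_leib (A := A) b ha))

/-- The endomorphism induced on the target of a surjection. -/
def descend {M N : Type} [AddCommGroup M] [Module ℚ M] [AddCommGroup N] [Module ℚ N]
    (p : M →ₗ[ℚ] N) (hp : Function.Surjective p) (f : M →ₗ[ℚ] M)
    (hf : ∀ a, p a = 0 → p (f a) = 0) : N →ₗ[ℚ] N :=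
  have key : ∀ a b, p a = p b → p (f a) = p (f b) := fun a b h => by
    rw [← sub_eq_zero, ← map_sub, ← map_sub]
    exact hf _ (by rw [map_sub, h, sub_self])
  { toFun := fun b => p (f (Function.surjInv hp b))
    map_add' := fun b c => by
      rw [← map_add, ← map_add]
      exact key _ _ (by rw [map_add]; rw [Function.surjInv_eq hp, Function.surjInv_eq hp, Function.surjInv_eq hp])
    map_smul' := fun q b => by
      rw [RingHom.id_apply, ← map_smul, ← map_smul]
      exact key _ _ (by rw [map_smul]; rw [Function.surjInv_eq hp, Function.surjInv_eq hp]) }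

theorem descend_apply {M N : Type} [AddCommGroup M] [Module ℚ M] [AddCommGroup N] [Module ℚ N]
    (p : M →ₗ[ℚ] N) (hp : Function.Surjective p) (f : M →ₗ[ℚ] M)
    (hf : ∀ a, p a = 0 → p (f a) = 0) (a : M) : descend p hp f hf (p a) = p (f a) := by
  change p (f (Function.surjInv hp (p a))) = p (f a)
  rw [← sub_eq_zero, ← map_sub, ← map_sub]
  exact hf _ (by rw [map_sub, Function.surjInv_eq hp, sub_self])

/-- The gcdga structure on the target of a surjection with homogeneous differential kernel. -/
@[reducible] def GCDGA.ofSurj [GCDGA A] [Ring B] [Algebra ℚ B] (p : A →ₗ[ℚ] B)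
    (hp : Function.Surjective p) (h1 : p 1 = 1) (hm : ∀ a b, p (a * b) = p a * p b) (hpr : ∀ i a, p a = 0 → p (pr i a) = 0)
    (hd : ∀ a, p a = 0 → p (Dd A a) = 0) : GCDGA B :=
  have dd := descend_apply p hp (Dd A) hd
  GCDGA.ofInternal B (fun i => (Gr A i).map p)
    (isInternal_of_proj (fun i => descend p hp (pr i) (hpr i))
      (by
        rintro i _ ⟨a, ha, rfl⟩
        rw [descend_apply, pr, ipr_same _ ha])
      (by
        rintro i j hij _ ⟨a, ha, rfl⟩
        rw [descend_apply, pr, ipr_ne _ ha hij, map_zero])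
      (by
        intro b
        obtain ⟨a, rfl⟩ := hp b
        obtain ⟨s, hs⟩ := exists_sum_ipr (gr_internal A) a
        rw [← hs, map_sum]
        exact Submodule.sum_mem _ fun i _ => Submodule.mem_iSup_of_mem i ⟨_, ipr_mem _ _ _, rfl⟩))
    ⟨1, gr_one, h1⟩
    (by
      rintro i j _ _ ⟨a, ha, rfl⟩ ⟨b, hb, rfl⟩
      exact ⟨a * b, gr_mul ha hb, hm a b⟩)
    (by
      rintro i j _ _ ⟨a, ha, rfl⟩ ⟨b, hb, rfl⟩
      rw [← hm, ← hm, gr_comm ha hb, map_smul])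
    (descend p hp (Dd A) hd)
    (by
      intro b
      obtain ⟨a, rfl⟩ := hp b
      rw [dd, dd, Dd_Dd, map_zero])
    (by
      rintro i _ ⟨a, ha, rfl⟩
      rw [dd]
      exact ⟨_, Dd_gr ha, rfl⟩)
    (by
      rintro i _ b ⟨a, ha, rfl⟩
      obtain ⟨b, rfl⟩ := hp b
      rw [← hm, dd, dd, dd, Dd_leib b ha, map_add, map_smul, hm, hm])

theorem exists_quotient [GCDGA A] (I : Submodule ℚ A) (hl : ∀ t, ∀ a ∈ I, t * a ∈ I)
    (hr : ∀ t, ∀ a ∈ I, a * t ∈ I) (hpr : ∀ i, ∀ a ∈ I, pr i a ∈ I)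
    (hd : ∀ a ∈ I, Dd A a ∈ I) : ∃ (Q : Type) (_ : GCDGA Q) (ρ : A →ₐ[ℚ] Q), IsDGAHom ρ ∧
      Function.Surjective ρ ∧ LinearMap.ker ρ.toLinearMap = I := by
  let J : Ideal A := { I.toAddSubmonoid with smul_mem' := fun t a ha => hl t a ha }
  have : J.IsTwoSided := ⟨fun {a} b ha => hr b a ha⟩
  have hker : ∀ a, Ideal.Quotient.mkₐ ℚ J a = 0 ↔ a ∈ I := fun a => Ideal.Quotient.eq_zero_iff_mem
  have hs : Function.Surjective (Ideal.Quotient.mkₐ ℚ J) := Ideal.Quotient.mk_surjective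
  refine ⟨A ⧸ J, GCDGA.ofSurj (Ideal.Quotient.mkₐ ℚ J).toLinearMap hs
    (map_one (Ideal.Quotient.mkₐ ℚ J))
    (map_mul (Ideal.Quotient.mkₐ ℚ J)) (fun i a h => (hker _).2 (hpr i a ((hker _).1 h)))
    (fun a h => (hker _).2 (hd a ((hker _).1 h))),
    Ideal.Quotient.mkₐ ℚ J, ⟨fun a => ?_, fun i a ha => ⟨a, ha, rfl⟩⟩, hs, ?_⟩
  · exact (descend_apply (Ideal.Quotient.mkₐ ℚ J).toLinearMap hs _
      (fun a h => (hker _).2 (hd a ((hker _).1 h))) a).symm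
  · ext a
    exact hker a

instance instProdGCDGA [GCDGA A] [GCDGA B] : GCDGA (A × B) :=
  GCDGA.ofInternal (A × B) (fun i => (Gr A i).prod (Gr B i))
    (isInternal_of_proj (fun i => (pr i).prodMap (pr i))
      (fun i a ha => Prod.ext (ipr_same _ ha.1) (ipr_same _ ha.2))
      (fun i j hij a ha => Prod.ext (ipr_ne _ ha.1 hij) (ipr_ne _ ha.2 hij)) (by
        rintro ⟨a, b⟩
        have h : (a, b) = LinearMap.inl ℚ A B a + LinearMap.inr ℚ A B b := by simp
        rw [h]
        refine Submodule.add_mem _ ?_ ?_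
        · obtain ⟨s, hs⟩ := exists_sum_ipr (gr_internal A) a
          rw [← hs, map_sum]
          exact Submodule.sum_mem _ fun i _ => Submodule.mem_iSup_of_mem i
            ⟨ipr_mem _ _ _, Submodule.zero_mem _⟩
        · obtain ⟨s, hs⟩ := exists_sum_ipr (gr_internal B) b
          rw [← hs, map_sum]
          exact Submodule.sum_mem _ fun i _ => Submodule.mem_iSup_of_mem i
            ⟨Submodule.zero_mem _, ipr_mem _ _ _⟩))
    ⟨gr_one, gr_one⟩ (fun _ _ _ _ ha hb => ⟨gr_mul ha.1 hb.1, gr_mul ha.2 hb.2⟩)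
    (fun _ _ _ _ ha hb => Prod.ext (gr_comm ha.1 hb.1) (gr_comm ha.2 hb.2))
    ((Dd A).prodMap (Dd B)) (fun _ => Prod.ext (Dd_Dd _) (Dd_Dd _))
    (fun _ _ hb => ⟨Dd_gr hb.1, Dd_gr hb.2⟩)
    (fun _ _ _ ha => Prod.ext (Dd_leib _ ha.1) (Dd_leib _ ha.2))

end Constructions

/-- A surjection whose kernel lies in an acyclic ideal has a homotopy retraction. -/
theorem nonempty_htpyRetraction {T Q : Type} [GCDGA T] [GCDGA Q] {ρ : T →ₐ[ℚ] Q}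
    (hρ : IsDGAHom ρ) (hs : Function.Surjective ρ) {J : Submodule ℚ T}
    (hJ : ∀ a, ρ a = 0 → a ∈ J) (hl : ∀ t, ∀ a ∈ J, t * a ∈ J) (hr : ∀ t, ∀ a ∈ J, a * t ∈ J)
    (hpr : ∀ i, ∀ a ∈ J, pr i a ∈ J) (hd : ∀ a ∈ J, Dd T a ∈ J)
    (hac : ∀ a ∈ J, Dd T a = 0 → ∃ b ∈ J, Dd T b = a) : Nonempty (HtpyRetraction ρ) := by
  let S : Subalgebra ℚ (Q × T) :=
    { carrier := {p | ∃ a ∈ J, p.1 = ρ (p.2 + a)}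
      mul_mem' := by
        rintro ⟨q, t⟩ ⟨q', t'⟩ ⟨a, ha, h⟩ ⟨a', ha', h'⟩
        refine ⟨a * t' + t * a' + a * a', J.add_mem (J.add_mem (hr _ _ ha) (hl _ _ ha'))
          (hl _ _ ha'), ?_⟩
        change q = ρ (t + a) at h
        change q' = ρ (t' + a') at h'
        change q * q' = ρ (t * t' + (a * t' + t * a' + a * a'))
        rw [h, h', ← map_mul]
        congr 1
        noncomm_ring
      add_mem' := by
        rintro ⟨q, t⟩ ⟨q', t'⟩ ⟨a, ha, h⟩ ⟨a', ha', h'⟩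
        refine ⟨a + a', J.add_mem ha ha', ?_⟩
        change q = ρ (t + a) at h
        change q' = ρ (t' + a') at h'
        change q + q' = ρ (t + t' + (a + a'))
        rw [h, h', ← map_add]
        congr 1
        abel
      algebraMap_mem' := fun r => ⟨0, J.zero_mem, by simp⟩ }
  have hSpr : ∀ i, ∀ a ∈ S, pr i a ∈ S := by
    rintro i ⟨q, t⟩ ⟨a, ha, h⟩
    have : pr i ((q, t) : Q × T) = (pr i q, pr i t) := ipr_eq_of_proj (gr_internal (Q × T))
      (fun i => (pr i).prodMap (pr i)) (fun i a ha => Prod.ext (ipr_same _ ha.1) (ipr_same _ ha.2))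
      (fun i j hij a ha => Prod.ext (ipr_ne _ ha.1 hij) (ipr_ne _ ha.2 hij)) i (q, t)
    rw [this]
    refine ⟨pr i a, hpr i a ha, ?_⟩
    change q = ρ (t + a) at h
    change pr i q = ρ (pr i t + pr i a)
    rw [← map_add, h]
    exact pr_of_hom ρ.toLinearMap hρ.2 i _
  have hSd : ∀ a ∈ S, Dd (Q × T) a ∈ S := by
    rintro ⟨q, t⟩ ⟨a, ha, h⟩
    refine ⟨Dd T a, hd a ha, ?_⟩
    change q = ρ (t + a) at h
    change Dd Q q = ρ (Dd T t + Dd T a)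
    rw [← map_add, h, hρ.1]
  let inst : GCDGA S := GCDGA.subalg S hSpr hSd
  have hgr : ∀ i (a : S), a ∈ Gr S i ↔ a.1.1 ∈ Gr Q i ∧ a.1.2 ∈ Gr T i := fun i a => Iff.rfl
  refine ⟨{ C := S
            instC := inst
            j := (ρ.prod (AlgHom.id ℚ T)).codRestrict S fun t => ⟨0, J.zero_mem, by simp⟩
            q := (AlgHom.fst ℚ Q T).comp S.val
            τ := (AlgHom.snd ℚ Q T).comp S.val
            j_dga := ⟨fun t => Subtype.ext (Prod.ext (hρ.1 t) rfl), fun i a ha => (hgr _ _).2 ⟨hρ.2 i a ha, ha⟩⟩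
            q_dga := ⟨fun t => rfl, fun i a ha => ((hgr _ _).1 ha).1⟩
            τ_dga := ⟨fun t => rfl, fun i a ha => ((hgr _ _).1 ha).2⟩
            q_surj := fun q => ?_
            q_quasi := ⟨fun b hb => ?_, ?_⟩
            hqj := rfl
            hτj := rfl }⟩
  · obtain ⟨t, rfl⟩ := hs q
    exact ⟨⟨(ρ t, t), 0, J.zero_mem, by simp⟩, rfl⟩
  · obtain ⟨t, rfl⟩ := hs b
    obtain ⟨e, he, hde⟩ := hac (Dd T t) (hJ _ (by rw [hρ.1, hb])) (Dd_Dd _)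
    refine ⟨⟨(ρ t, t - e), e, he, by simp⟩, Subtype.ext (Prod.ext hb ?_), 0, ?_⟩
    · change Dd T (t - e) = 0
      rw [map_sub, hde, sub_self]
    · rw [map_zero]
      exact sub_self _
  · rintro ⟨⟨q, t⟩, a, ha, h⟩ hda ⟨c, hc⟩
    obtain ⟨s, rfl⟩ := hs c
    change q = ρ (t + a) at h
    change q = Dd Q (ρ s) at hc
    have hdt : Dd T t = 0 := congrArg (fun z : S => z.1.2) hda
    have hm : t - Dd T s ∈ J := by
      have : t + a - Dd T s ∈ J := hJ _ (by rw [map_sub, ← h, hc, hρ.1, sub_self])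
      have := J.sub_mem this ha
      rwa [show t + a - Dd T s - a = t - Dd T s by abel] at this
    obtain ⟨e, he, hde⟩ := hac _ hm (by rw [map_sub, hdt, Dd_Dd, sub_zero])
    refine ⟨⟨(ρ s, s + e), -e, J.neg_mem he, by simp⟩, Subtype.ext (Prod.ext hc ?_)⟩
    change t = Dd T (s + e)
    rw [map_add, hde]
    abel

section LengthFiltration

variable {T : Type} [GCDGA T] {lam : ℕ → Submodule ℚ T}

/-- The elements of length greater than `w`. -/
def lenGT (lam : ℕ → Submodule ℚ T) (w : ℕ) : Submodule ℚ T := ⨆ k, ⨆ (_ : w < k), lam k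

theorem mem_lenGT {w k : ℕ} (h : w < k) {a : T} (ha : a ∈ lam k) : a ∈ lenGT lam w :=
  Submodule.mem_iSup_of_mem k (Submodule.mem_iSup_of_mem h ha)

theorem lenGT_le {w : ℕ} {N : Submodule ℚ T} (h : ∀ k, w < k → ∀ a ∈ lam k, a ∈ N) :
    lenGT lam w ≤ N := iSup₂_le h

theorem LengthGrading.lenGT_mul_left (hL : LengthGrading T lam) {w : ℕ} (t : T) {a : T}
    (ha : a ∈ lenGT lam w) : t * a ∈ lenGT lam w := by
  induction t using internal_induction hL.internal with
  | h0 => simp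
  | h2 t t' h h' => rw [add_mul]; exact Submodule.add_mem _ h h'
  | h1 p t ht =>
    refine lenGT_le (N := (lenGT lam w).comap (LinearMap.mulLeft ℚ t)) (fun k hk b hb => ?_) ha
    exact mem_lenGT (by omega) (hL.mul _ _ _ _ ht hb)

theorem LengthGrading.lenGT_mul_right (hL : LengthGrading T lam) {w : ℕ} (t : T) {a : T}
    (ha : a ∈ lenGT lam w) : a * t ∈ lenGT lam w := by
  induction t using internal_induction hL.internal with
  | h0 => simp
  | h2 t t' h h' => rw [mul_add]; exact Submodule.add_mem _ h h'
  | h1 p t ht =>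
    refine lenGT_le (N := (lenGT lam w).comap (LinearMap.mulRight ℚ t)) (fun k hk b hb => ?_) ha
    exact mem_lenGT (by omega) (hL.mul _ _ _ _ hb ht)

theorem LengthGrading.lenGT_pr (hL : LengthGrading T lam) {w : ℕ} (i : ℕ) {a : T}
    (ha : a ∈ lenGT lam w) : pr i a ∈ lenGT lam w :=
  lenGT_le (N := (lenGT lam w).comap (pr i))
    (fun _ hk _ hb => mem_lenGT hk (hL.hom _ _ _ hb)) ha

theorem LengthGrading.lenGT_Dd (hL : LengthGrading T lam) {w : ℕ} {a : T}
    (ha : a ∈ lenGT lam w) : Dd T a ∈ lenGT lam (w + 1) :=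
  lenGT_le (N := (lenGT lam (w + 1)).comap (Dd T))
    (fun k hk b hb => mem_lenGT (by omega) (hL.d _ _ hb)) ha

theorem lenGT_mono {w w' : ℕ} (h : w ≤ w') : lenGT lam w' ≤ lenGT lam w :=
  lenGT_le fun _ hk _ hb => mem_lenGT (by omega) hb

theorem LengthGrading.ipr_lenGT (hL : LengthGrading T lam) {w k : ℕ} (hk : k ≤ w) {a : T}
    (ha : a ∈ lenGT lam w) : ipr hL.internal k a = 0 :=
  lenGT_le (N := LinearMap.ker (ipr hL.internal k))
    (fun _ hl _ hb => ipr_ne _ hb (by omega)) ha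

theorem LengthGrading.Dd_ipr (hL : LengthGrading T lam) (k : ℕ) (a : T) :
    ipr hL.internal (k + 1) (Dd T a) = Dd T (ipr hL.internal k a) := by
  induction a using internal_induction hL.internal with
  | h0 => simp
  | h2 a a' h h' => simp [h, h']
  | h1 j a ha =>
    by_cases h : k = j
    · subst h; rw [ipr_same _ ha, ipr_same _ (hL.d _ _ ha)]
    · rw [ipr_ne _ ha h, ipr_ne _ (hL.d _ _ ha) (by omega), map_zero]

theorem exists_compl_ker {M N : Type} [AddCommGroup M] [Module ℚ M] [AddCommGroup N] [Module ℚ N]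
    (f : M →ₗ[ℚ] N) (L : Submodule ℚ M) : ∃ K ≤ L, (∀ a ∈ K, f a = 0 → a = 0) ∧
      ∀ a ∈ L, ∃ b ∈ K, f b = f a := by
  obtain ⟨K', hK'⟩ := Submodule.exists_isCompl (LinearMap.ker f ⊓ L)
  refine ⟨K' ⊓ L, inf_le_right, fun a ha h => ?_, fun a ha => ?_⟩
  · exact Submodule.disjoint_def.1 hK'.disjoint a ⟨h, ha.2⟩ ha.1
  · have : a ∈ (LinearMap.ker f ⊓ L) ⊔ K' := by rw [hK'.sup_eq_top]; trivial
    obtain ⟨c, hc, b, hb, rfl⟩ := Submodule.mem_sup.1 this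
    refine ⟨b, ⟨hb, ?_⟩, ?_⟩
    · simpa using L.sub_mem ha hc.2
    · rw [map_add, LinearMap.mem_ker.1 hc.1, zero_add]

/-- The vanishing of the cohomology in lengths greater than `w`. -/
def LVan (lam : ℕ → Submodule ℚ T) (w : ℕ) : Prop :=
  ∀ k, w < k → ∀ a ∈ lam k, Dd T a = 0 → ∃ b ∈ lam (k - 1), Dd T b = a

theorem LengthGrading.nonempty_htpyRetraction (hL : LengthGrading T lam) {w : ℕ}
    (hv : LVan lam w) {Q : Type} [GCDGA Q] {ρ : T →ₐ[ℚ] Q} (hρ : IsDGAHom ρ)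
    (hs : Function.Surjective ρ) (hker : ∀ a, ρ a = 0 → a ∈ lenGT lam w) :
    Nonempty (HtpyRetraction ρ) := by
  choose K hKL hK0 hK using fun i => exists_compl_ker (Dd T) (lam w ⊓ Gr T i)
  have hKlam : ⨆ i, K i ≤ lam w := iSup_le fun i => (hKL i).trans inf_le_left
  have hmul : ∀ t, ∀ a ∈ lenGT lam w ⊔ ⨆ i, K i, t * a ∈ lenGT lam w ⊔ ⨆ i, K i := by
    intro t a ha
    obtain ⟨b, hb, c, hc, rfl⟩ := Submodule.mem_sup.1 ha
    rw [mul_add]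
    refine Submodule.add_mem _ (Submodule.mem_sup_left (hL.lenGT_mul_left t hb)) ?_
    induction t using internal_induction hL.internal with
    | h0 => simp
    | h2 t t' h h' => rw [add_mul]; exact Submodule.add_mem _ h h'
    | h1 p t ht =>
      rcases p with _ | p
      · rw [hL.zero] at ht
        obtain ⟨q, rfl⟩ := Submodule.mem_one.1 ht
        rw [← Algebra.smul_def]
        exact Submodule.smul_mem _ _ (Submodule.mem_sup_right hc)
      · exact Submodule.mem_sup_left (mem_lenGT (by omega) (hL.mul _ _ _ _ ht (hKlam hc)))
  have hmul' : ∀ t, ∀ a ∈ lenGT lam w ⊔ ⨆ i, K i, a * t ∈ lenGT lam w ⊔ ⨆ i, K i := by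
    intro t a ha
    obtain ⟨b, hb, c, hc, rfl⟩ := Submodule.mem_sup.1 ha
    rw [add_mul]
    refine Submodule.add_mem _ (Submodule.mem_sup_left (hL.lenGT_mul_right t hb)) ?_
    induction t using internal_induction hL.internal with
    | h0 => simp
    | h2 t t' h h' => rw [mul_add]; exact Submodule.add_mem _ h h'
    | h1 p t ht =>
      rcases p with _ | p
      · rw [hL.zero] at ht
        obtain ⟨q, rfl⟩ := Submodule.mem_one.1 ht
        rw [← Algebra.commutes, ← Algebra.smul_def]
        exact Submodule.smul_mem _ _ (Submodule.mem_sup_right hc)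
      · exact Submodule.mem_sup_left (mem_lenGT (by omega) (hL.mul _ _ _ _ (hKlam hc) ht))
  refine RHT.nonempty_htpyRetraction hρ hs (J := lenGT lam w ⊔ ⨆ i, K i)
    (fun a ha => Submodule.mem_sup_left (hker a ha)) hmul hmul' ?_ ?_ ?_
  · intro i a ha
    obtain ⟨b, hb, c, hc, rfl⟩ := Submodule.mem_sup.1 ha
    rw [map_add]
    refine Submodule.add_mem _ (Submodule.mem_sup_left (hL.lenGT_pr i hb)) ?_
    have : (⨆ i, K i) ≤ (lenGT lam w ⊔ ⨆ i, K i).comap (pr i) := by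
      refine iSup_le fun j b hb => ?_
      by_cases hij : i = j
      · subst hij
        have : pr i b = b := ipr_same _ (hKL i hb).2
        rw [Submodule.mem_comap, this]
        exact Submodule.mem_sup_right (Submodule.mem_iSup_of_mem i hb)
      · have : pr i b = 0 := ipr_ne _ (hKL j hb).2 hij
        rw [Submodule.mem_comap, this]
        exact Submodule.zero_mem _
    exact this hc
  · intro a ha
    obtain ⟨b, hb, c, hc, rfl⟩ := Submodule.mem_sup.1 ha
    rw [map_add]
    exact Submodule.mem_sup_left (Submodule.add_mem _ (lenGT_mono (by omega) (hL.lenGT_Dd hb))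
      (mem_lenGT (by omega) (hL.d _ _ (hKlam hc))))
  · intro a ha hd
    obtain ⟨b, hb, c, hc, rfl⟩ := Submodule.mem_sup.1 ha
    have hdc : Dd T c = 0 := by
      have h := congrArg (ipr hL.internal (w + 1)) hd
      rw [map_add, map_add, hL.ipr_lenGT le_rfl (hL.lenGT_Dd hb), zero_add, map_zero,
        ipr_same _ (hL.d _ _ (hKlam hc))] at h
      exact h
    have hc0 : c = 0 := by
      refine eq_zero_of_ipr (gr_internal T) fun i => ?_
      have hci : pr i c ∈ K i := by
        have : (⨆ j, K j) ≤ (K i).comap (pr i) := by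
          refine iSup_le fun j b hb => ?_
          by_cases hij : i = j
          · subst hij
            have : pr i b = b := ipr_same _ (hKL i hb).2
            rwa [Submodule.mem_comap, this]
          · have : pr i b = 0 := ipr_ne _ (hKL j hb).2 hij
            rw [Submodule.mem_comap, this]
            exact Submodule.zero_mem _
        exact this hc
      exact hK0 i _ hci (by rw [← pr_Dd, hdc, map_zero])
    subst hc0
    rw [add_zero] at hd ⊢
    have hdb : ∀ k, Dd T (ipr hL.internal k b) = 0 := fun k => by
      rw [← hL.Dd_ipr, hd, map_zero]
    have key : ∀ k, ∃ e ∈ lenGT lam w ⊔ ⨆ i, K i, Dd T e = ipr hL.internal k b := by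
      intro k
      by_cases hk : k ≤ w
      · exact ⟨0, Submodule.zero_mem _, by rw [map_zero, hL.ipr_lenGT hk hb]⟩
      · obtain ⟨e, he, hde⟩ := hv k (by omega) _ (ipr_mem _ _ _) (hdb k)
        rcases Nat.lt_or_ge w (k - 1) with h | h
        · exact ⟨e, Submodule.mem_sup_left (mem_lenGT h he), hde⟩
        · obtain rfl : k = w + 1 := by omega
          obtain ⟨s, hs⟩ := exists_sum_ipr (gr_internal T) e
          choose f hf hdf using fun i => hK i (pr i e) ⟨hL.hom _ _ _ he, ipr_mem _ _ _⟩
          refine ⟨∑ i ∈ s, f i, Submodule.mem_sup_right (Submodule.sum_mem _ fun i _ =>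
            Submodule.mem_iSup_of_mem i (hf i)), ?_⟩
          rw [← hde]
          conv_rhs => rw [← hs]
          rw [map_sum, map_sum]
          exact Finset.sum_congr rfl fun i _ => hdf i
    choose e he hde using key
    obtain ⟨s, hs⟩ := exists_sum_ipr hL.internal b
    refine ⟨∑ k ∈ s, e k, Submodule.sum_mem _ fun k _ => he k, ?_⟩
    rw [map_sum]
    conv_rhs => rw [← hs]
    exact Finset.sum_congr rfl fun k _ => hde k

theorem LengthGrading.van_iff (hL : LengthGrading T lam) {c s : ℕ} {h : Fin s → T}
    (hh : KFam lam c h) {w : ℕ} : (TK hL hh).Van w ↔ LVan lam w := by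
  constructor
  · intro hv k hk a ha hd
    obtain ⟨b, hb, hdb⟩ := hv k (by exact_mod_cast hk) a
      (mem_zext_of_eq (M := T) rfl ha) hd
    refine ⟨b, ?_, hdb⟩
    change b ∈ zext lam (k - 1) at hb
    rwa [show (k : ℤ) - 1 = ((k - 1 : ℕ) : ℤ) by omega, zext_natCast] at hb
  · intro hv k hk a ha hd
    obtain ⟨k, rfl⟩ : ∃ l : ℕ, k = l := ⟨k.toNat, by omega⟩
    change a ∈ zext lam k at ha
    rw [zext_natCast] at ha
    obtain ⟨b, hb, hdb⟩ := hv k (by exact_mod_cast hk) a ha hd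
    exact ⟨b, mem_zext_of_eq (M := T) (by omega) hb, hdb⟩

end LengthFiltration

/-- Vanishing of the cohomology in word lengths greater than `m` bounds the category. -/
theorem cat_le_of_lvan {A : Type} [GCDGA A] (S : MinimalSullivan A)
    (hL : LengthGrading A S.lam) {m : ℕ} (hv : LVan S.lam m) : cat A S ≤ m := by
  obtain ⟨Q, instQ, π, h1, h2, h3⟩ := exists_quotient (lenGT S.lam m)
    (fun t a ha => hL.lenGT_mul_left t ha) (fun t a ha => hL.lenGT_mul_right t ha)
    (fun i a ha => hL.lenGT_pr i ha) (fun a ha => lenGT_mono (by omega) (hL.lenGT_Dd ha))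
  refine Nat.sInf_le ⟨⟨Q, π, h1, h2, h3, hL.nonempty_htpyRetraction hv h1 h2 fun a ha => ?_⟩⟩
  rw [← h3]
  exact ha

section Polynomials

open MvPolynomial

section Monomials

variable {σ : Type} {B : Type} [Ring B] [Algebra ℚ B]

theorem map_mem_of_weighted (F : MvPolynomial σ ℚ →ₐ[ℚ] B) (w : σ → ℕ) (N : ℕ → Submodule ℚ B)
    (h1 : (1 : B) ∈ N 0) (hmul : ∀ p q a b, a ∈ N p → b ∈ N q → a * b ∈ N (p + q))
    (hX : ∀ i, F (X i) ∈ N (w i)) {k : ℕ} {a : MvPolynomial σ ℚ}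
    (ha : a ∈ weightedHomogeneousSubmodule ℚ w k) : F a ∈ N k := by
  have hpow : ∀ i n, F (X i) ^ n ∈ N (n * w i) := fun i n => by
    induction n with
    | zero => simpa using h1
    | succ n ih => rw [pow_succ, Nat.succ_mul]; exact hmul _ _ _ _ ih (hX i)
  have hmon : ∀ d : σ →₀ ℕ, F (monomial d 1) ∈ N (Finsupp.weight w d) := fun d => by
    induction d using Finsupp.induction_linear with
    | zero => simpa using h1
    | add d d' h h' =>
      have : monomial (d + d') (1 : ℚ) = monomial d 1 * monomial d' 1 := by
        rw [monomial_mul, one_mul]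
      rw [this, map_mul, map_add]
      exact hmul _ _ _ _ h h'
    | single i n =>
      rw [← X_pow_eq_monomial, map_pow, Finsupp.weight_single, smul_eq_mul]
      exact hpow i n
  rw [a.as_sum, map_sum]
  refine Submodule.sum_mem _ fun d hd => ?_
  have : monomial d (coeff d a) = coeff d a • monomial d 1 := by
    rw [smul_monomial, smul_eq_mul, mul_one]
  rw [this, map_smul]
  refine Submodule.smul_mem _ _ ?_
  rw [← ha (mem_support_iff.1 hd)]
  exact hmon d

theorem weighted_internal (w : σ → ℕ) :
    DirectSum.IsInternal (weightedHomogeneousSubmodule ℚ (σ := σ) w) :=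
  isInternal_of_proj (fun i => weightedHomogeneousComponent w i)
    (fun i a ha => weightedHomogeneousComponent_of_mem ha |>.trans (if_pos rfl))
    (fun i j hij a ha => weightedHomogeneousComponent_of_mem ha |>.trans (if_neg hij))
    (fun a => by
      rw [a.as_sum]
      exact Submodule.sum_mem _ fun d _ => Submodule.mem_iSup_of_mem (Finsupp.weight w d)
        (isWeightedHomogeneous_monomial w d _ rfl))

theorem exists_algHom_of_commute (b : σ → B) (hb : ∀ i j, b i * b j = b j * b i) :
    ∃ F : MvPolynomial σ ℚ →ₐ[ℚ] B, ∀ i, F (X i) = b i := by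
  let _ : CommRing (Algebra.adjoin ℚ (Set.range b)) :=
    { (inferInstance : Ring (Algebra.adjoin ℚ (Set.range b))) with
      mul_comm := fun x y => Subtype.ext (by
        have := Algebra.commute_of_mem_adjoin_of_forall_mem_commute
          (R := ℚ) (a := x.1) (s := Set.range b) (b := y.1) y.2 (by
            rintro _ ⟨j, rfl⟩
            refine (Algebra.commute_of_mem_adjoin_of_forall_mem_commute (R := ℚ) x.2 ?_).symm
            rintro _ ⟨i, rfl⟩
            exact hb j i)
        exact this) }
  refine ⟨(Algebra.adjoin ℚ (Set.range b)).val.comp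
    (aeval fun i => ⟨b i, Algebra.subset_adjoin ⟨i, rfl⟩⟩), fun i => ?_⟩
  rw [AlgHom.comp_apply, aeval_X]
  rfl

/-- Division by the `c`-th power of a variable. -/
def divPow (i : σ) (c : ℕ) : MvPolynomial σ ℚ →ₗ[ℚ] MvPolynomial σ ℚ where
  toFun p := p.divMonomial (Finsupp.single i c)
  map_add' p q := add_divMonomial _ _ _
  map_smul' r p := by ext m; simp [coeff_divMonomial]

theorem coeff_divPow (i : σ) (c : ℕ) (p : MvPolynomial σ ℚ) (m : σ →₀ ℕ) :
    coeff m (divPow i c p) = coeff (Finsupp.single i c + m) p := coeff_divMonomial _ _ _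

end Monomials

/-- A polynomial algebra on even generators with trivial differential, as a gcdga. -/
structure PolData (σ : Type) [Finite σ] (e : σ → ℕ) where
  R : Type
  [inst : GCDGA R]
  x : σ → R
  x_mem : ∀ i, x i ∈ Gr R (e i)
  d_zero : ∀ a, Dd R a = 0
  lift : ∀ (B : Type) [GCDGA B] (b : σ → B), (∀ i, b i ∈ Gr B (e i)) → (∀ i, Dd B (b i) = 0) →
    ∃ f : R →ₐ[ℚ] B, IsDGAHom f ∧ ∀ i, f (x i) = b i
  gen : Algebra.adjoin ℚ (Set.range x) = ⊤
  lam : ℕ → Submodule ℚ R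
  lengthGrading : LengthGrading R lam
  x_len : ∀ i, x i ∈ lam 1
  map_len : ∀ (B : Type) [Ring B] [Algebra ℚ B] (f : R →ₐ[ℚ] B) (M : ℕ → Submodule ℚ B),
    (1 : B) ∈ M 0 → (∀ p q a b, a ∈ M p → b ∈ M q → a * b ∈ M (p + q)) →
    (∀ i, f (x i) ∈ M 1) → ∀ k, ∀ a ∈ lam k, f a ∈ M k
  kvan : ∀ (s : ℕ) (ε : Fin s ≃ σ) (c : ℕ), 1 ≤ c →
    ∀ hh : KFam lam c fun j => x (ε j) ^ c, (TK lengthGrading hh).KVan (s * ((c : ℤ) - 1))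

attribute [instance] PolData.inst

theorem nonempty_polData {σ : Type} [Finite σ] (e : σ → ℕ) (he : ∀ i, Even (e i)) :
    Nonempty (PolData σ e) := by
  have hev : ∀ i, ∀ a ∈ weightedHomogeneousSubmodule ℚ e i, a ≠ 0 → Even i := by
    intro i a ha h0
    obtain ⟨d, hd⟩ := exists_coeff_ne_zero h0
    rw [← ha hd, Finsupp.weight_apply]
    exact Finset.even_sum _ fun j _ => (he j).mul_left _
  let inst : GCDGA (MvPolynomial σ ℚ) :=
    GCDGA.ofInternal (MvPolynomial σ ℚ) (weightedHomogeneousSubmodule ℚ e) (weighted_internal e)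
      (isWeightedHomogeneous_one ℚ e) (fun _ _ _ _ ha hb => IsWeightedHomogeneous.mul ha hb)
      (fun i j a b ha hb => by
        by_cases h0 : a = 0
        · simp [h0]
        · rw [((hev i a ha h0).mul_right j).neg_one_pow, one_smul, mul_comm])
      0 (fun _ => rfl) (fun _ _ _ => Submodule.zero_mem _) (fun _ _ _ _ => by simp)
  have hpr : ∀ i a, pr i a = weightedHomogeneousComponent e i a := fun i a =>
    ipr_eq_of_proj _ (fun i => weightedHomogeneousComponent e i)
      (fun i a ha => (weightedHomogeneousComponent_of_mem ha).trans (if_pos rfl))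
      (fun i j hij a ha => (weightedHomogeneousComponent_of_mem ha).trans (if_neg hij)) i a
  have hL : LengthGrading (MvPolynomial σ ℚ) (weightedHomogeneousSubmodule ℚ (1 : σ → ℕ)) :=
    { internal := weighted_internal 1
      zero := by
        refine le_antisymm (fun a ha => ?_) (Submodule.one_le.2 (isWeightedHomogeneous_one ℚ _))
        refine Submodule.mem_one.2 ⟨coeff 0 a, ?_⟩
        ext d
        classical
        by_cases hd : d = 0
        · simp [hd, algebraMap_eq]
        · rw [algebraMap_eq, coeff_C, if_neg (Ne.symm hd)]
          by_contra h
          refine hd ?_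
          have : Finsupp.weight (fun _ => 1) d = 0 := ha (Ne.symm h)
          rw [← Finsupp.degree_eq_weight_one] at this
          exact (Finsupp.degree_eq_zero_iff d).1 this
      mul := fun _ _ _ _ ha hb => IsWeightedHomogeneous.mul ha hb
      d := fun _ _ _ => Submodule.zero_mem _
      hom := fun k i a ha d hd => by
        rw [hpr, coeff_weightedHomogeneousComponent] at hd
        exact ha (fun h => hd (by rw [h, ite_self])) }
  refine ⟨{ R := MvPolynomial σ ℚ, inst := inst, x := X, x_mem := fun i => ?_
            d_zero := fun _ => rfl, lift := ?_, gen := adjoin_range_X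
            lam := weightedHomogeneousSubmodule ℚ (1 : σ → ℕ)
            lengthGrading := hL, x_len := fun i => ?_, map_len := ?_, kvan := ?_ }⟩
  · exact isWeightedHomogeneous_X ℚ e i
  · intro B _ b hb hd
    obtain ⟨f, hf⟩ := exists_algHom_of_commute b fun i j => even_comm (he i) (hb i) (b j)
    refine ⟨f, isDGAHom_of_generators (fun k a ha => ?_) adjoin_range_X ?_, hf⟩
    · exact map_mem_of_weighted f e (Gr B) gr_one (fun _ _ _ _ => gr_mul)
        (fun i => by rw [hf]; exact hb i) ha
    · rintro _ ⟨i, rfl⟩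
      rw [hf, hd]
      exact map_zero f
  · exact isWeightedHomogeneous_X ℚ (1 : σ → ℕ) i
  · intro B _ _ f M h1 hmul hX k a ha
    exact map_mem_of_weighted f 1 M h1 hmul hX ha
  · intro s ε c hc hh
    have hF : ∀ j a d, coeff d ((X (ε j) : MvPolynomial σ ℚ) ^ c * a) =
        if Finsupp.single (ε j) c ≤ d then coeff (d - Finsupp.single (ε j) c) a else 0 := by
      intro j a d
      rw [X_pow_eq_monomial, coeff_monomial_mul', one_mul]
    have hPF : ∀ j a, divPow (ε j) c (X (ε j) ^ c * a) = a := by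
      intro j a
      ext d
      rw [coeff_divPow, hF, if_pos (by simp), add_tsub_cancel_left]
    have hPF' : ∀ i j, i ≠ j → ∀ a,
        divPow (ε i) c (X (ε j) ^ c * a) = X (ε j) ^ c * divPow (ε i) c a := by
      intro i j hij a
      ext d
      have hne : ε i ≠ ε j := fun h => hij (ε.injective h)
      rw [coeff_divPow, hF, hF, coeff_divPow]
      have hiff : Finsupp.single (ε j) c ≤ Finsupp.single (ε i) c + d ↔
          Finsupp.single (ε j) c ≤ d := by
        simp [hne]
      by_cases h : Finsupp.single (ε j) c ≤ d
      · rw [if_pos h, if_pos (hiff.2 h), add_tsub_assoc_of_le h]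
      · rw [if_neg h, if_neg (mt hiff.1 h)]
    have hPP : ∀ i j a, divPow (ε i) c (divPow (ε j) c a) = divPow (ε j) c (divPow (ε i) c a) := by
      intro i j a
      ext d
      simp only [coeff_divPow]
      rw [add_left_comm]
    have hPl : ∀ i (k : ℤ) (a : MvPolynomial σ ℚ),
        a ∈ zext (weightedHomogeneousSubmodule ℚ (1 : σ → ℕ)) k →
        divPow (ε i) c a ∈ zext (weightedHomogeneousSubmodule ℚ (1 : σ → ℕ)) (k - c) := by
      intro i k a ha
      rcases mem_zext ha with rfl | ⟨l, rfl, hl⟩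
      · rw [map_zero]; exact Submodule.zero_mem _
      · have hdeg : ∀ d, coeff d (divPow (ε i) c a) ≠ 0 → c + Finsupp.weight 1 d = l := by
          intro d hd
          rw [coeff_divPow] at hd
          rw [← hl hd, map_add, Finsupp.weight_single]
          simp
        by_cases hcl : c ≤ l
        · refine mem_zext_of_eq (j := l - c) (by omega) fun d hd => ?_
          have := hdeg d hd
          omega
        · have : divPow (ε i) c a = 0 := by
            by_contra h
            obtain ⟨d, hd⟩ := exists_coeff_ne_zero h
            have := hdeg d hd
            omega
          rw [this]
          exact Submodule.zero_mem _
    have hP0 : ∀ (k : ℤ), s * ((c : ℤ) - 1) < k → ∀ a : MvPolynomial σ ℚ,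
        a ∈ zext (weightedHomogeneousSubmodule ℚ (1 : σ → ℕ)) k →
        (∀ i, divPow (ε i) c a = 0) → a = 0 := by
      intro k hk a ha hP
      rcases mem_zext ha with rfl | ⟨l, rfl, hl⟩
      · rfl
      by_contra h
      obtain ⟨d, hd⟩ := exists_coeff_ne_zero h
      have hdl : Finsupp.weight (fun _ => 1) d = l := hl hd
      have : ∃ j, c ≤ d (ε j) := by
        by_contra! hlt
        have h1 : Finsupp.weight (fun _ => 1) d = ∑ j, d (ε j) := by
          have : Fintype σ := Fintype.ofEquiv _ ε
          rw [← Finsupp.degree_eq_weight_one, Finsupp.degree_eq_sum]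
          exact (Equiv.sum_comp ε d).symm
        have h2 : ∑ j, d (ε j) ≤ ∑ _j : Fin s, (c - 1) :=
          Finset.sum_le_sum fun j _ => by have := hlt j; omega
        rw [← h1, hdl] at h2
        simp only [Finset.sum_const, Finset.card_univ, Fintype.card_fin, smul_eq_mul] at h2
        have h3 : (l : ℤ) ≤ s * ((c : ℤ) - 1) := by
          have : ((c - 1 : ℕ) : ℤ) = (c : ℤ) - 1 := by omega
          rw [← this]
          exact_mod_cast h2
        omega
      obtain ⟨j, hj⟩ := this
      refine hd ?_
      have hle : Finsupp.single (ε j) c ≤ d := by simpa using hj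
      rw [← add_tsub_cancel_of_le hle, ← coeff_divPow, hP j, coeff_zero]
    exact KData.Split.kvan (P := fun j => divPow (ε j) c)
      ⟨hPF, hPF', hPP, fun i _ => map_zero (divPow (ε i) c), hPl⟩
      fun k hk a ha _ hP => ⟨0, Submodule.zero_mem _, (map_zero _).trans (hP0 k hk a ha hP).symm⟩

end Polynomials

section Presentation

variable {A : Type} [GCDGA A]

theorem adjoin_pr {s : Set A} (hs : ∀ a ∈ s, ∃ k, a ∈ Gr A k) (i : ℕ) :
    ∀ a ∈ Algebra.adjoin ℚ s, pr i a ∈ Algebra.adjoin ℚ s := by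
  have key : ∀ a ∈ Algebra.adjoin ℚ s, ∀ i, pr i a ∈ Algebra.adjoin ℚ s := by
    intro a ha
    induction ha using Algebra.adjoin_induction with
    | mem a ha =>
      intro i
      obtain ⟨k, hk⟩ := hs a ha
      by_cases h : i = k
      · subst h
        rw [pr, ipr_same _ hk]
        exact Algebra.subset_adjoin ha
      · rw [pr, ipr_ne _ hk h]
        exact zero_mem _
    | algebraMap q =>
      intro i
      have h1 : algebraMap ℚ A q ∈ Gr A 0 := by
        rw [Algebra.algebraMap_eq_smul_one]
        exact Submodule.smul_mem _ _ gr_one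
      by_cases h : i = 0
      · subst h
        rw [pr, ipr_same _ h1]
        exact Subalgebra.algebraMap_mem _ _
      · rw [pr, ipr_ne _ h1 h]
        exact zero_mem _
    | add a b _ _ ha hb =>
      intro i
      rw [map_add]
      exact add_mem (ha i) (hb i)
    | mul a b _ _ ha hb =>
      intro i
      obtain ⟨sa, hsa⟩ := exists_sum_ipr (gr_internal A) a
      obtain ⟨sb, hsb⟩ := exists_sum_ipr (gr_internal A) b
      rw [← hsa, ← hsb, Finset.sum_mul_sum, map_sum]
      refine sum_mem fun p _ => ?_
      rw [map_sum]
      refine sum_mem fun q _ => ?_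
      have hm := gr_mul (ipr_mem (gr_internal A) p a) (ipr_mem (gr_internal A) q b)
      by_cases h : i = p + q
      · subst h
        rw [pr, ipr_same _ hm]
        exact mul_mem (ha p) (hb q)
      · rw [pr, ipr_ne _ hm h]
        exact zero_mem _
  exact fun a ha => key a ha i

theorem adjoin_Dd {s : Set A} (hs : ∀ a ∈ s, ∃ k, a ∈ Gr A k)
    (hd : ∀ a ∈ s, Dd A a ∈ Algebra.adjoin ℚ s) :
    ∀ a ∈ Algebra.adjoin ℚ s, Dd A a ∈ Algebra.adjoin ℚ s := by
  intro a ha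
  induction ha using Algebra.adjoin_induction with
  | mem a ha => exact hd a ha
  | algebraMap q =>
    rw [Algebra.algebraMap_eq_smul_one, map_smul, Dd_one, smul_zero]
    exact zero_mem _
  | add a b _ _ ha hb =>
    rw [map_add]
    exact add_mem ha hb
  | mul a b ha' hb' ha hb =>
    rw [Dd_mul]
    have h : sg a ∈ Subalgebra.toSubmodule (Algebra.adjoin ℚ s) :=
      sg_eq_sum_pr a fun i => adjoin_pr hs i a ha'
    exact add_mem (mul_mem ha hb') (mul_mem h hb)

theorem LinearIndependent.exists_linearMap {ι M N : Type} [AddCommGroup M] [Module ℚ M]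
    [AddCommGroup N] [Module ℚ N] {v : ι → M} (hv : LinearIndependent ℚ v) (b : ι → N) :
    ∃ F : M →ₗ[ℚ] N, ∀ i, F (v i) = b i := by
  obtain ⟨F, hF⟩ := LinearMap.exists_extend ((Module.Basis.span hv).constr ℚ b)
  refine ⟨F, fun i => ?_⟩
  have h := LinearMap.congr_fun hF (Module.Basis.span hv i)
  rw [Module.Basis.constr_basis] at h
  simpa [Module.Basis.span_apply] using h

/-- A presentation of a pure quadratic model by homogeneous generators. -/
structure Pres (S : MinimalSullivan A) {n : ℕ} (x : Fin n → A) (e : Fin n → ℕ) where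
  τ : Type
  [fin : Finite τ]
  o : τ → ℕ
  y : τ → A
  c : τ → Fin n → Fin n → ℚ
  o_odd : ∀ j, Odd (o j)
  y_mem : ∀ j, y j ∈ Gr A (o j)
  y_odd : ∀ j, y j ∈ S.Vodd
  e_even : ∀ i, Even (e i)
  e_pos : ∀ i, 2 ≤ e i
  x_mem : ∀ i, x i ∈ Gr A (e i)
  x_closed : ∀ i, Dd A (x i) = 0
  x_len : ∀ i, x i ∈ S.lam 1
  y_len : ∀ j, y j ∈ S.lam 1
  c_deg : ∀ j i l, c j i l ≠ 0 → e i + e l = o j + 1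
  d_y : ∀ j, Dd A (y j) = ∑ i, ∑ l, c j i l • (x i * x l)
  gen : Algebra.adjoin ℚ (Set.range x ∪ Set.range y) = ⊤
  lift : ∀ (B : Type) [GCDGA B] (bx : Fin n → B) (b : τ → B), (∀ i, bx i ∈ Gr B (e i)) →
    (∀ i, Dd B (bx i) = 0) → (∀ j, b j ∈ Gr B (o j)) →
    (∀ j, Dd B (b j) = ∑ i, ∑ l, c j i l • (bx i * bx l)) →
    ∃ f : A →ₐ[ℚ] B, IsDGAHom f ∧ (∀ i, f (x i) = bx i) ∧ ∀ j, f (y j) = b j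

attribute [instance] Pres.fin

variable (S : MinimalSullivan A)

theorem MinimalSullivan.sg_veven {a : A} (ha : a ∈ S.Veven) : sg a = a := by
  have : S.Veven ≤ LinearMap.eqLocus (sg : A →ₗ[ℚ] A) LinearMap.id :=
    iSup_le fun n a ha => sg_even (by simp) (S.V_le _ ha)
  exact this ha

theorem MinimalSullivan.sg_vodd {a : A} (ha : a ∈ S.Vodd) : sg a = -a := by
  have : S.Vodd ≤ LinearMap.eqLocus (sg : A →ₗ[ℚ] A) (-LinearMap.id) :=
    iSup_le fun n a ha => sg_odd (by simp) (S.V_le _ ha)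
  exact this ha

theorem MinimalSullivan.disjoint : Disjoint S.Veven S.Vodd := by
  rw [Submodule.disjoint_def]
  intro a h1 h2
  have h := S.sg_veven h1
  rw [S.sg_vodd h2] at h
  have h3 : (2 : ℚ) • a = 0 := by
    rw [two_smul]
    nth_rewrite 1 [← h]
    exact neg_add_cancel a
  exact (smul_eq_zero.1 h3).resolve_left (by norm_num)

theorem MinimalSullivan.V_le_sup (n : ℕ) : S.V n ≤ S.Veven ⊔ S.Vodd := by
  rcases Nat.even_or_odd' n with ⟨k, rfl | rfl⟩
  · exact le_sup_of_le_left (le_iSup (fun k => S.V (2 * k)) k)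
  · exact le_sup_of_le_right (le_iSup (fun k => S.V (2 * k + 1)) k)

theorem MinimalSullivan.V_le_lam_one (n : ℕ) : S.V n ≤ S.lam 1 := by
  rw [S.lam_one]
  exact le_iSup S.V n

theorem MinimalSullivan.Vodd_le : S.Vodd ≤ ⨆ n, S.V n := iSup_le fun n => le_iSup S.V (2 * n + 1)

variable {S}

theorem nonempty_pres (hpure : S.Pure) (hcof : S.Coformal) (hell : Elliptic A S)
    {n : ℕ} (x : Fin n → A) (e : Fin n → ℕ)
    (heven : ∀ i, Even (e i)) (hmem : ∀ i, x i ∈ S.V (e i))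
    (hli : LinearIndependent ℚ x)
    (hspan : Submodule.span ℚ (Set.range x) = S.Veven) : Nonempty (Pres S x e) := by
  have hxG : ∀ i, x i ∈ Gr A (e i) := fun i => S.V_le _ (hmem i)
  have hxe : ∀ i, x i ∈ S.Veven := fun i => by
    rw [← hspan]; exact Submodule.subset_span ⟨i, rfl⟩
  have hxd : ∀ i, Dd A (x i) = 0 := fun i => hpure.1 _ (hxe i)
  have he2 : ∀ i, 2 ≤ e i := by
    intro i
    by_contra hlt
    have h0 : e i = 0 := by
      obtain ⟨k, hk⟩ := heven i
      omega
    have h1 := hmem i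
    rw [h0, S.V0, Submodule.mem_bot] at h1
    exact hli.ne_zero i h1
  let s : Set A := ⋃ k, (S.V (2 * k + 1) : Set A)
  have hs : Submodule.span ℚ s = S.Vodd := by
    rw [Submodule.span_iUnion]
    simp [MinimalSullivan.Vodd]
  obtain ⟨b, hbs, hb1, hb2⟩ := exists_linearIndependent ℚ s
  rw [hs] at hb1
  have hbo : ∀ j : b, ∃ k, (j : A) ∈ S.V (2 * k + 1) := fun j => by
    simpa [s] using hbs j.2
  choose o' ho' using hbo
  let y : b → A := fun j => j
  have hyr : Set.range y = b := Subtype.range_coe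
  have hyo : ∀ j, y j ∈ S.Vodd := fun j => by
    rw [← hb1]; exact Submodule.subset_span j.2
  have hfin : Finite b := by
    have := hell.1
    have h1 : LinearIndependent ℚ (fun j : b => (⟨y j, S.Vodd_le (hyo j)⟩ : (⨆ n, S.V n : Submodule ℚ A))) := by
      apply LinearIndependent.of_comp (⨆ n, S.V n : Submodule ℚ A).subtype
      exact hb2
    exact h1.finite
  let z : Fin n ⊕ b → A := Sum.elim x y
  let dz : Fin n ⊕ b → ℕ := Sum.elim e fun j => 2 * o' j + 1
  have hz : LinearIndependent ℚ z := by
    refine LinearIndependent.sum_type hli hb2 ?_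
    have : Submodule.span ℚ (Set.range (Subtype.val : b → A)) = S.Vodd := by
      rw [Subtype.range_coe, hb1]
    rw [hspan, this]
    exact S.disjoint
  have hzV : ∀ t, z t ∈ S.V (dz t) := by
    rintro (i | j)
    · exact hmem i
    · exact ho' j
  let H : ℕ → Submodule ℚ A := fun k => ⨆ t, ⨆ (_ : dz t = k), Submodule.span ℚ {z t}
  have hHG : ∀ k, H k ≤ Gr A k := by
    intro k
    refine iSup₂_le fun t ht => ?_
    rw [Submodule.span_singleton_le_iff_mem, ← ht]
    exact S.V_le _ (hzV t)
  have hVH : ∀ k, S.V k ≤ H k := by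
    intro k v hv
    refine mem_of_mem_iSup (gr_internal A) hHG ?_ (S.V_le _ hv)
    have hle : S.Veven ⊔ S.Vodd ≤ ⨆ k, H k := by
      rw [← hspan, ← hb1]
      refine sup_le (Submodule.span_le.2 ?_) (Submodule.span_le.2 ?_)
      · rintro _ ⟨i, rfl⟩
        refine Submodule.mem_iSup_of_mem (e i) (Submodule.mem_iSup_of_mem (Sum.inl i)
          (Submodule.mem_iSup_of_mem rfl (Submodule.mem_span_singleton_self _)))
      · intro a ha
        refine Submodule.mem_iSup_of_mem _ (Submodule.mem_iSup_of_mem (Sum.inr ⟨a, ha⟩)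
          (Submodule.mem_iSup_of_mem rfl (Submodule.mem_span_singleton_self _)))
    exact hle (S.V_le_sup k hv)
  -- the differential on odd generators
  have hdy : ∀ j, ∃ c : Fin n → Fin n → ℚ, (∀ i l, c i l ≠ 0 → e i + e l = 2 * o' j + 1 + 1) ∧
      Dd A (y j) = ∑ i, ∑ l, c i l • (x i * x l) := by
    intro j
    have h1 : Dd A (y j) ∈ S.lam 2 := hcof _ _ (ho' j)
    have h2 : Dd A (y j) ∈ Algebra.adjoin ℚ (Set.range x) := by
      have := hpure.2 _ (hyo j)
      rwa [← hspan, Algebra.adjoin_span] at this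
    let M : ℕ → Submodule ℚ A := fun k => Submodule.span ℚ (Set.range x) ^ k
    have hx1 : Submodule.span ℚ (Set.range x) ≤ S.lam 1 := by
      rw [Submodule.span_le]
      rintro _ ⟨i, rfl⟩
      exact S.V_le_lam_one _ (hmem i)
    have hM : ∀ k, M k ≤ S.lam k := by
      intro k
      induction k with
      | zero => simp [M, S.lam_zero]
      | succ k ih =>
        simp only [M, pow_succ] at ih ⊢
        exact (mul_le_mul' ih hx1).trans (S.lam_mul k 1)
    have h3 : Dd A (y j) ∈ M 2 := by
      refine mem_of_mem_iSup S.lam_internal hM ?_ h1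
      generalize Dd A (y j) = a at h2
      induction h2 using Algebra.adjoin_induction with
      | mem a ha =>
        exact Submodule.mem_iSup_of_mem 1 (by
          simp only [M, pow_one]; exact Submodule.subset_span ha)
      | algebraMap q => exact Submodule.mem_iSup_of_mem 0 (by
          simp only [M, pow_zero]; exact Submodule.algebraMap_mem q)
      | add a b _ _ ha hb => exact add_mem ha hb
      | mul a b _ _ ha hb =>
        have := Submodule.mul_mem_mul ha hb
        rw [Submodule.iSup_mul] at this
        refine (iSup_le fun p => ?_ : _ ≤ ⨆ k, M k) this
        rw [Submodule.mul_iSup]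
        refine iSup_le fun q => ?_
        refine le_trans (le_of_eq ?_) (le_iSup M (p + q))
        simp [M, pow_add]
    let Z : ℕ → Fin n × Fin n → A := fun k t => if e t.1 + e t.2 = k then x t.1 * x t.2 else 0
    have h4 : Dd A (y j) ∈ Submodule.span ℚ (Set.range (Z (2 * o' j + 1 + 1))) := by
      refine mem_of_mem_iSup (H := fun k => Submodule.span ℚ (Set.range (Z k)))
        (gr_internal A) ?_ ?_ (Dd_gr (S.V_le _ (ho' j)))
      · intro k
        rw [Submodule.span_le]
        rintro _ ⟨t, rfl⟩
        simp only [Z]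
        split_ifs with h
        · rw [← h]; exact gr_mul (hxG _) (hxG _)
        · exact zero_mem _
      · have : M 2 ≤ ⨆ k, Submodule.span ℚ (Set.range (Z k)) := by
          simp only [M, pow_two]
          rw [Submodule.span_mul_span, Submodule.span_le]
          rintro _ ⟨_, ⟨i, rfl⟩, _, ⟨l, rfl⟩, rfl⟩
          refine Submodule.mem_iSup_of_mem (e i + e l) (Submodule.subset_span ⟨(i, l), ?_⟩)
          simp [Z]
        exact this h3
    obtain ⟨c, hc⟩ := (Submodule.mem_span_range_iff_exists_fun ℚ).1 h4
    refine ⟨fun i l => if e i + e l = 2 * o' j + 1 + 1 then c (i, l) else 0, ?_, ?_⟩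
    · intro i l h
      by_contra h'
      simp [h'] at h
    · rw [← hc, Fintype.sum_prod_type]
      refine Finset.sum_congr rfl fun i _ => Finset.sum_congr rfl fun l _ => ?_
      simp only [Z]
      split_ifs <;> simp
  choose c hc1 hc2 using hdy
  let g : Set A := Set.range x ∪ Set.range y
  have hgG : ∀ a ∈ g, ∃ k, a ∈ Gr A k := by
    rintro _ (⟨i, rfl⟩ | ⟨j, rfl⟩)
    · exact ⟨_, hxG i⟩
    · exact ⟨_, S.V_le _ (ho' j)⟩
  have hxg : ∀ i, x i ∈ Algebra.adjoin ℚ g := fun i => Algebra.subset_adjoin (Or.inl ⟨i, rfl⟩)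
  have hyg : ∀ j, y j ∈ Algebra.adjoin ℚ g := fun j => Algebra.subset_adjoin (Or.inr ⟨j, rfl⟩)
  have hgd : ∀ a ∈ g, Dd A a ∈ Algebra.adjoin ℚ g := by
    rintro _ (⟨i, rfl⟩ | ⟨j, rfl⟩)
    · rw [hxd]; exact zero_mem _
    · rw [hc2]
      exact sum_mem fun i _ => sum_mem fun l _ =>
        Subalgebra.smul_mem _ (mul_mem (hxg i) (hxg l)) _
  have hgen : Algebra.adjoin ℚ g = ⊤ := by
    let S0 := Algebra.adjoin ℚ g
    have hVS : ∀ k, S.V k ≤ Subalgebra.toSubmodule S0 := by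
      intro k
      refine (hVH k).trans (iSup₂_le fun t _ => ?_)
      rw [Submodule.span_singleton_le_iff_mem]
      rcases t with i | j
      · exact hxg i
      · exact hyg j
    let _ : GCDGA S0 := GCDGA.subalg S0 (fun i => adjoin_pr hgG i) (adjoin_Dd hgG hgd)
    obtain ⟨f, ⟨hf1, hf2⟩, -⟩ := S.free S0 (fun k => Submodule.inclusion (hVS k))
      (fun k v => S.V_le k v.2)
    have hid : S0.val.comp f = AlgHom.id ℚ A := by
      refine (S.free A (fun k => (S.V k).subtype) (fun k v => S.V_le k v.2)).unique ⟨?_, ?_⟩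
        ⟨fun i a ha => ha, fun _ _ => rfl⟩
      · intro i a ha
        exact hf1 i a ha
      · intro k v
        have := hf2 k v
        change ((f (v : A) : S0) : A) = v
        rw [this]
        rfl
    rw [eq_top_iff]
    intro a _
    have := DFunLike.congr_fun hid a
    change ((f a : S0) : A) = a at this
    rw [← this]
    exact (f a).2
  refine ⟨{ τ := b, o := fun j => 2 * o' j + 1, y := y, c := c, o_odd := fun j => by simp
            y_mem := fun j => S.V_le _ (ho' j), y_odd := hyo, e_even := heven, e_pos := he2
            x_mem := hxG, x_closed := hxd, x_len := fun i => S.V_le_lam_one _ (hmem i)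
            y_len := fun j => S.V_le_lam_one _ (ho' j), c_deg := hc1, d_y := hc2, gen := hgen
            lift := ?_ }⟩
  intro B _ bx bb h1 h2 h3 h4
  obtain ⟨F, hF⟩ := LinearIndependent.exists_linearMap hz (Sum.elim bx bb)
  have hFV : ∀ k, ∀ v ∈ S.V k, F v ∈ Gr B k := by
    intro k v hv
    have : H k ≤ (Gr B k).comap F := by
      refine iSup₂_le fun t ht => ?_
      rw [Submodule.span_singleton_le_iff_mem, Submodule.mem_comap, hF, ← ht]
      rcases t with i | j
      · exact h1 i
      · exact h3 j
    exact this (hVH k hv)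
  obtain ⟨f, ⟨hf1, hf2⟩, -⟩ := S.free B (fun k => F.domRestrict (S.V k))
    (fun k v => hFV k v v.2)
  have hfx : ∀ i, f (x i) = bx i := fun i => by
    rw [hf2 _ ⟨x i, hmem i⟩]; exact hF (Sum.inl i)
  have hfy : ∀ j, f (y j) = bb j := fun j => by
    rw [hf2 _ ⟨y j, ho' j⟩]; exact hF (Sum.inr j)
  refine ⟨f, isDGAHom_of_generators hf1 hgen ?_, hfx, hfy⟩
  rintro _ (⟨i, rfl⟩ | ⟨j, rfl⟩)
  · rw [hxd, hfx, h2, map_zero]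
  · rw [hc2, hfy, h4]
    simp [hfx]

end Presentation

section QuadraticModels

/-- Degrees and structure constants of a pure quadratic model with even generators indexed by `σ`
and odd generators indexed by `τ`. -/
structure QData (σ τ : Type) where
  e : σ → ℕ
  e_even : ∀ i, Even (e i)
  e_pos : ∀ i, 2 ≤ e i
  o : τ → ℕ
  o_odd : ∀ j, Odd (o j)
  c : τ → σ → σ → ℚ
  c_deg : ∀ j i l, c j i l ≠ 0 → e i + e l = o j + 1

variable {σ τ : Type} [Fintype σ]

theorem QData.sum_mem (Q : QData σ τ) {B : Type} [GCDGA B] {b : σ → B}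
    (hb : ∀ i, b i ∈ Gr B (Q.e i)) (j : τ) :
    ∑ i, ∑ l, Q.c j i l • (b i * b l) ∈ Gr B (Q.o j + 1) := by
  refine _root_.sum_mem fun i _ => _root_.sum_mem fun l _ => ?_
  by_cases h : Q.c j i l = 0
  · rw [h, zero_smul]; exact zero_mem _
  · rw [← Q.c_deg j i l h]
    exact Submodule.smul_mem _ _ (gr_mul (hb i) (hb l))

/-- The free model on the data `Q`. -/
structure QModel (Q : QData σ τ) where
  D : Type
  [inst : GCDGA D]
  x : σ → D
  y : τ → D
  x_mem : ∀ i, x i ∈ Gr D (Q.e i)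
  x_closed : ∀ i, Dd D (x i) = 0
  y_mem : ∀ j, y j ∈ Gr D (Q.o j)
  d_y : ∀ j, Dd D (y j) = ∑ i, ∑ l, Q.c j i l • (x i * x l)
  gen : Algebra.adjoin ℚ (Set.range x ∪ Set.range y) = ⊤
  lift : ∀ (B : Type) [GCDGA B] (bx : σ → B) (b : τ → B), (∀ i, bx i ∈ Gr B (Q.e i)) →
    (∀ i, Dd B (bx i) = 0) → (∀ j, b j ∈ Gr B (Q.o j)) →
    (∀ j, Dd B (b j) = ∑ i, ∑ l, Q.c j i l • (bx i * bx l)) →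
    ∃ f : D →ₐ[ℚ] B, IsDGAHom f ∧ (∀ i, f (x i) = bx i) ∧ ∀ j, f (y j) = b j
  lam : ℕ → Submodule ℚ D
  lengthGrading : LengthGrading D lam
  x_len : ∀ i, x i ∈ lam 1
  y_len : ∀ j, y j ∈ lam 1
  map_len : ∀ (B : Type) [Ring B] [Algebra ℚ B] (f : D →ₐ[ℚ] B) (M : ℕ → Submodule ℚ B),
    (1 : B) ∈ M 0 → (∀ p q a b, a ∈ M p → b ∈ M q → a * b ∈ M (p + q)) →
    (∀ i, f (x i) ∈ M 1) → (∀ j, f (y j) ∈ M 1) → ∀ k, ∀ a ∈ lam k, f a ∈ M k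
  kvan : ∀ (s : ℕ) (ε : Fin s ≃ σ) (c : ℕ), 1 ≤ c →
    ∀ hh : KFam lam c fun j => x (ε j) ^ c,
      (TK lengthGrading hh).KVan (s * ((c : ℤ) - 1) + Nat.card τ)

attribute [instance] QModel.inst

theorem nonempty_qModel [Finite τ] (Q : QData σ τ) : Nonempty (QModel Q) := by
  obtain ⟨P⟩ := nonempty_polData Q.e Q.e_even
  let _ := P.inst
  let α : Attach P.R τ :=
    { k := Q.o, hk := Q.o_odd, f := fun j => ∑ i, ∑ l, Q.c j i l • (P.x i * P.x l)
      f_mem := fun j => Q.sum_mem P.x_mem j, f_closed := fun j => P.d_zero _ }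
  have hf2 : ∀ j, α.f j ∈ P.lam 2 := fun j => _root_.sum_mem fun i _ => _root_.sum_mem fun l _ =>
    Submodule.smul_mem _ _ (P.lengthGrading.mul 1 1 _ _ (P.x_len i) (P.x_len l))
  let E := extData α
  let _ := E.inst
  obtain ⟨lam', hL', h1, h2, h3, h4⟩ := E.len P.lam P.lengthGrading hf2
  have hR : ∀ (S : Subalgebra ℚ E.D), (∀ i, E.i (P.x i) ∈ S) → ∀ t, E.i t ∈ S := by
    intro S hS t
    have : Algebra.adjoin ℚ (Set.range P.x) ≤ S.comap E.i := by
      rw [Algebra.adjoin_le_iff]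
      rintro _ ⟨i, rfl⟩
      exact hS i
    rw [P.gen] at this
    exact this Algebra.mem_top
  refine ⟨{ D := E.D, x := fun i => E.i (P.x i), y := E.g, lam := lam', lengthGrading := hL'
            x_mem := fun i => E.i_dga.2 _ _ (P.x_mem i)
            x_closed := fun i => by rw [← E.i_dga.1, P.d_zero, map_zero]
            y_mem := E.g_mem, d_y := fun j => ?_, gen := ?_, lift := ?_
            x_len := fun i => h1 _ _ (P.x_len i), y_len := h2, map_len := ?_, kvan := ?_ }⟩
  · rw [E.g_d]
    simp [α]
  · refine E.gen _ (hR _ fun i => Algebra.subset_adjoin (Or.inl ⟨i, rfl⟩))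
      fun j => Algebra.subset_adjoin (Or.inr ⟨j, rfl⟩)
  · intro B _ bx b hx hdx hb hdb
    obtain ⟨f, hf, hfx⟩ := P.lift B bx hx hdx
    obtain ⟨H, hH, hHi, hHg⟩ := E.lift B f hf b hb (fun j => by rw [hdb]; simp [α, hfx])
    exact ⟨H, hH, fun i => by rw [hHi, hfx], hHg⟩
  · intro B _ _ f M hM1 hM hx hy
    refine h3 B M f hM ?_ hy
    intro k a ha
    exact P.map_len B (f.comp E.i) M hM1 hM hx k a ha
  · intro s ε c hc
    have hfun : (fun j => E.i (P.x (ε j)) ^ c) = fun j => E.i (P.x (ε j) ^ c) := by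
      funext j; rw [map_pow]
    rw [hfun]
    intro hh'
    have hh : KFam P.lam c fun j => P.x (ε j) ^ c := by
      refine ⟨fun j => ?_, fun j => P.d_zero _, fun j => ?_⟩
      · have hg : ∀ c : ℕ, P.x (ε j) ^ c ∈ Gr P.R (c * Q.e (ε j)) := by
          intro c
          rw [← smul_eq_mul]
          exact SetLike.pow_mem_graded c (P.x_mem (ε j))
        exact ⟨_, (Q.e_even _).mul_left c, hg c⟩
      · have hg : ∀ c : ℕ, P.x (ε j) ^ c ∈ P.lam c := by
          intro c
          induction c with
          | zero =>
            rw [pow_zero, P.lengthGrading.zero]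
            exact Submodule.one_le.1 le_rfl
          | succ c ih =>
            rw [pow_succ]
            exact P.lengthGrading.mul _ _ _ _ ih (P.x_len _)
        exact hg c
    exact h4 s c _ hh hh' _ (P.kvan s ε c hc hh)

namespace QModel

variable {Q : QData σ τ} (M : QModel Q)

theorem hom_ext {B : Type} [Ring B] [Algebra ℚ B] {f g : M.D →ₐ[ℚ] B}
    (hx : ∀ i, f (M.x i) = g (M.x i)) (hy : ∀ j, f (M.y j) = g (M.y j)) : f = g := by
  refine AlgHom.ext_of_adjoin_eq_top M.gen ?_
  rintro _ (⟨i, rfl⟩ | ⟨j, rfl⟩)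
  · exact hx i
  · exact hy j

theorem pow_len (i : σ) (c : ℕ) : M.x i ^ c ∈ M.lam c := by
  induction c with
  | zero =>
    rw [pow_zero, M.lengthGrading.zero]
    exact Submodule.one_le.1 le_rfl
  | succ c ih =>
    rw [pow_succ]
    exact M.lengthGrading.mul _ _ _ _ ih (M.x_len _)

theorem pow_mem (i : σ) (c : ℕ) : M.x i ^ c ∈ Gr M.D (c * Q.e i) := by
  rw [← smul_eq_mul]
  exact SetLike.pow_mem_graded c (M.x_mem i)

theorem pow_closed (i : σ) (c : ℕ) : Dd M.D (M.x i ^ c) = 0 := by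
  induction c with
  | zero => rw [pow_zero, Dd_one]
  | succ c ih => rw [pow_succ, Dd_mul, ih, M.x_closed, zero_mul, mul_zero, add_zero]

theorem kFam {s : ℕ} (ε : Fin s ≃ σ) (c : ℕ) : KFam M.lam c fun j => M.x (ε j) ^ c :=
  ⟨fun _ => ⟨_, (Q.e_even _).mul_left c, M.pow_mem _ c⟩, fun _ => M.pow_closed _ c,
    fun _ => M.pow_len _ c⟩

/-- If the length grading is eventually acyclic, it is so above the number of odd generators. -/
theorem lvan_of_lvan {w₀ : ℕ} (h : LVan M.lam w₀) : LVan M.lam (Nat.card τ) := by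
  have hh := M.kFam (Fintype.equivFin σ).symm 2
  rw [← M.lengthGrading.van_iff hh] at h ⊢
  refine KData.KVan.van (by norm_num) h ?_
  have := M.kvan _ (Fintype.equivFin σ).symm 2 (by norm_num) hh
  rwa [add_comm] at this

theorem exists_lvan_of_exact (c : ℕ) (hc : 1 ≤ c)
    (h : ∀ i, ∃ b ∈ M.lam (c - 1), ∃ k, Odd k ∧ b ∈ Gr M.D k ∧ Dd M.D b = M.x i ^ c) :
    ∃ w, LVan M.lam w := by
  choose b hb1 k hk hb2 hb3 using h
  let ε := (Fintype.equivFin σ).symm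
  have hh := M.kFam ε c
  have hn : KData.Null (TK M.lengthGrading hh) fun i => LinearMap.mulLeft ℚ (b (ε i)) := by
    refine ⟨fun i a => ?_, fun i j a => ?_, fun i k a ha => ?_⟩
    · have : ∀ a : M.D, Dd M.D (b (ε i) * a) + b (ε i) * Dd M.D a = M.x (ε i) ^ c * a := by
        intro a
        rw [Dd_mul, hb3, sg_odd (hk _) (hb2 _)]
        noncomm_ring
      exact this a
    · have : ∀ a : M.D, b (ε i) * (M.x (ε j) ^ c * a) = M.x (ε j) ^ c * (b (ε i) * a) := by
        intro a
        rw [← mul_assoc, ← mul_assoc,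
          even_comm ((Q.e_even _).mul_left c) (M.pow_mem (ε j) c) (b (ε i))]
      exact this a
    · have : ∀ a : M.D, a ∈ zext M.lam k → b (ε i) * a ∈ zext M.lam (k + c - 1) := by
        intro a ha
        rcases mem_zext ha with rfl | ⟨p, rfl, hp⟩
        · rw [mul_zero]; exact zero_mem _
        · refine mem_zext_of_eq (j := c - 1 + p) (by push_cast [hc]; ring) ?_
          exact M.lengthGrading.mul _ _ _ _ (hb1 _) hp
      exact this a ha
  have h1 := hn.van (by exact_mod_cast hc) (M.kvan _ ε c hc hh)
  refine ⟨Fintype.card σ * (c - 1) + Nat.card τ, ?_⟩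
  rw [← M.lengthGrading.van_iff hh]
  convert h1 using 1
  push_cast [hc]
  ring

end QModel

end QuadraticModels

section ModelOfPres

variable {A : Type} [GCDGA A] {S : MinimalSullivan A} {n : ℕ} {x : Fin n → A} {e : Fin n → ℕ}

/-- The data underlying a presentation. -/
def Pres.q (P : Pres S x e) : QData (Fin n) P.τ where
  e := e
  e_even := P.e_even
  e_pos := P.e_pos
  o := P.o
  o_odd := P.o_odd
  c := P.c
  c_deg := P.c_deg

theorem Pres.hom_ext (P : Pres S x e) {B : Type} [Ring B] [Algebra ℚ B] {f g : A →ₐ[ℚ] B}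
    (hx : ∀ i, f (x i) = g (x i)) (hy : ∀ j, f (P.y j) = g (P.y j)) : f = g := by
  refine AlgHom.ext_of_adjoin_eq_top P.gen ?_
  rintro _ (⟨i, rfl⟩ | ⟨j, rfl⟩)
  · exact hx i
  · exact hy j

theorem MinimalSullivan.lam_mul_mem (p q : ℕ) (a b : A) (ha : a ∈ S.lam p) (hb : b ∈ S.lam q) :
    a * b ∈ S.lam (p + q) := S.lam_mul p q (Submodule.mul_mem_mul ha hb)

/-- The algebra is isomorphic to the free model on the data of a presentation. -/
theorem Pres.exists_iso (P : Pres S x e) : ∃ (M : QModel P.q) (Φ : M.D →ₐ[ℚ] A)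
    (Ψ : A →ₐ[ℚ] M.D), IsDGAHom Φ ∧ IsDGAHom Ψ ∧ (∀ a, Φ (Ψ a) = a) ∧ (∀ a, Ψ (Φ a) = a) ∧
      (∀ i, Φ (M.x i) = x i) ∧ (∀ j, Φ (M.y j) = P.y j) ∧
      ∀ k a, a ∈ S.lam k ↔ Ψ a ∈ M.lam k := by
  obtain ⟨M⟩ := nonempty_qModel P.q
  obtain ⟨Φ, hΦ, hΦx, hΦy⟩ := M.lift A x P.y P.x_mem P.x_closed P.y_mem P.d_y
  obtain ⟨Ψ, hΨ, hΨx, hΨy⟩ := P.lift M.D M.x M.y M.x_mem M.x_closed M.y_mem M.d_y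
  have h1 : Φ.comp Ψ = AlgHom.id ℚ A :=
    P.hom_ext (fun i => by simp [hΨx, hΦx]) (fun j => by simp [hΨy, hΦy])
  have h2 : Ψ.comp Φ = AlgHom.id ℚ M.D :=
    M.hom_ext (fun i => by simp [hΨx, hΦx]) (fun j => by simp [hΨy, hΦy])
  have h1' : ∀ a, Φ (Ψ a) = a := DFunLike.congr_fun h1
  have h2' : ∀ a, Ψ (Φ a) = a := DFunLike.congr_fun h2
  have hle : ∀ k, ∀ a ∈ M.lam k, Φ a ∈ S.lam k := by
    refine M.map_len A Φ S.lam ?_ S.lam_mul_mem ?_ ?_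
    · rw [S.lam_zero]
      exact Submodule.one_le.1 le_rfl
    · intro i; rw [hΦx]; exact P.x_len i
    · intro i; rw [hΦy]; exact P.y_len i
  refine ⟨M, Φ, Ψ, hΦ, hΨ, h1', h2', hΦx, hΦy, fun k a => ⟨fun ha => ?_, fun ha => ?_⟩⟩
  · have h : a ∈ (M.lam k).map Φ.toLinearMap := by
      refine mem_of_mem_iSup (H := fun k => (M.lam k).map Φ.toLinearMap) S.lam_internal ?_ ?_ ha
      · rintro i _ ⟨b, hb, rfl⟩
        exact hle i b hb
      · rw [← Submodule.map_iSup, M.lengthGrading.internal.submodule_iSup_eq_top]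
        exact ⟨Ψ a, trivial, h1' a⟩
    obtain ⟨b, hb, rfl⟩ := h
    change Ψ (Φ b) ∈ _
    rwa [h2']
  · rw [← h1' a]
    exact hle k _ ha

theorem Pres.lengthGrading (P : Pres S x e) : LengthGrading A S.lam := by
  obtain ⟨M, Φ, Ψ, hΦ, hΨ, h1, h2, -, -, h⟩ := P.exists_iso
  refine ⟨S.lam_internal, S.lam_zero, S.lam_mul_mem, fun k a ha => ?_, fun k i a ha => ?_⟩
  · rw [h, hΨ.1]
    exact M.lengthGrading.d _ _ ((h _ _).1 ha)
  · rw [h, ← AlgHom.toLinearMap_apply, ← pr_of_hom Ψ.toLinearMap hΨ.2]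
    exact M.lengthGrading.hom _ _ _ ((h _ _).1 ha)

theorem Pres.map_len (P : Pres S x e) {B : Type} [Ring B] [Algebra ℚ B] (f : A →ₐ[ℚ] B)
    (N : ℕ → Submodule ℚ B) (h1 : (1 : B) ∈ N 0)
    (hN : ∀ p q a b, a ∈ N p → b ∈ N q → a * b ∈ N (p + q)) (hx : ∀ i, f (x i) ∈ N 1)
    (hy : ∀ j, f (P.y j) ∈ N 1) : ∀ k, ∀ a ∈ S.lam k, f a ∈ N k := by
  obtain ⟨M, Φ, Ψ, hΦ, hΨ, h3, h2, hx', hy', h⟩ := P.exists_iso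
  intro k a ha
  have := M.map_len B (f.comp Φ) N h1 hN (fun i => by simpa [hx'] using hx i)
    (fun i => by simpa [hy'] using hy i) k _ ((h _ _).1 ha)
  simpa [h3] using this

theorem Pres.lvan_of_lvan (P : Pres S x e) {w : ℕ} (hw : LVan S.lam w) :
    LVan S.lam (Nat.card P.τ) := by
  obtain ⟨M, Φ, Ψ, hΦ, hΨ, h1, h2, -, -, h⟩ := P.exists_iso
  have h3 : LVan M.lam w := by
    intro k hk a ha hd
    obtain ⟨b, hb, hbd⟩ := hw k hk (Φ a) ((h _ _).2 (by rwa [h2])) (by rw [← hΦ.1, hd, map_zero])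
    exact ⟨Ψ b, (h _ _).1 hb, by rw [← hΨ.1, hbd, h2]⟩
  have h4 := M.lvan_of_lvan h3
  intro k hk a ha hd
  obtain ⟨b, hb, hbd⟩ := h4 k hk (Ψ a) ((h _ _).1 ha) (by rw [← hΨ.1, hd, map_zero])
  exact ⟨Φ b, (h _ _).2 (by rwa [h2]), by rw [← hΦ.1, hbd, h1]⟩

/-- Finite-dimensional cohomology forces acyclicity in large length. -/
theorem LengthGrading.exists_lvan {lam : ℕ → Submodule ℚ A} (hL : LengthGrading A lam)
    (hfin : FiniteDimensional ℚ (CohClasses A)) : ∃ w, LVan lam w := by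
  by_contra! hno
  simp only [LVan, not_forall] at hno
  choose k hk a ha hd hne using hno
  let B : Submodule ℚ (LinearMap.ker (Dd A)) :=
    (LinearMap.range (Dd A)).comap (LinearMap.ker (Dd A)).subtype
  have hfin' : FiniteDimensional ℚ (LinearMap.ker (Dd A) ⧸ B) := hfin
  -- a strictly increasing sequence of lengths carrying non-exact cocycles
  obtain ⟨φ, hφ⟩ : ∃ φ : ℕ → ℕ, StrictMono (k ∘ φ) := by
    have : ∀ N, ∃ m, N < k m := fun N => ⟨N, hk N⟩
    exact ⟨fun i => Nat.rec 0 (fun _ m => k m) i, strictMono_nat_of_lt_succ fun i => hk _⟩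
  let v : ℕ → LinearMap.ker (Dd A) ⧸ B := fun i => B.mkQ ⟨a (φ i), hd (φ i)⟩
  have hv : LinearIndependent ℚ v := by
    rw [linearIndependent_iff']
    intro s g hg i hi
    by_contra hgi
    have h1 : B.mkQ (∑ j ∈ s, g j • ⟨a (φ j), hd (φ j)⟩) = 0 := by
      rw [map_sum, ← hg]
      exact Finset.sum_congr rfl fun j _ => by rw [map_smul]
    rw [Submodule.mkQ_apply, Submodule.Quotient.mk_eq_zero] at h1
    obtain ⟨b, hb⟩ := h1
    have h2 : Dd A b = ∑ j ∈ s, g j • a (φ j) := by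
      rw [hb]; simp
    obtain ⟨p, hp⟩ : ∃ p, k (φ i) = p + 1 := ⟨k (φ i) - 1, by have := hk (φ i); omega⟩
    have h3 := hL.Dd_ipr p b
    rw [h2, map_sum, Finset.sum_eq_single i, map_smul,
      ipr_same _ (by rw [← hp]; exact ha _)] at h3
    · refine hne (φ i) ⟨(g i)⁻¹ • ipr hL.internal p b, ?_, ?_⟩
      · rw [hp]
        exact Submodule.smul_mem _ _ (ipr_mem _ _ _)
      · rw [map_smul, ← h3, smul_smul, inv_mul_cancel₀ hgi, one_smul]
    · intro j _ hji
      rw [map_smul, ipr_ne hL.internal (ha (φ j)), smul_zero]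
      rw [← hp]
      exact fun h => hji (hφ.injective h).symm
    · exact fun h => absurd hi h
  have := hv.finite
  exact not_finite ℕ

theorem Pres.lvan (P : Pres S x e) (hell : Elliptic A S) : LVan S.lam (Nat.card P.τ) := by
  obtain ⟨w, hw⟩ := P.lengthGrading.exists_lvan hell.2
  exact P.lvan_of_lvan hw

theorem Pres.cat_le (P : Pres S x e) (hell : Elliptic A S) : cat A S ≤ Nat.card P.τ :=
  cat_le_of_lvan S P.lengthGrading (P.lvan hell)

end ModelOfPres

section Ideals

variable {T : Type} [GCDGA T]

theorem pr_mem_one (i : ℕ) : ∀ a ∈ (1 : Submodule ℚ T), pr i a ∈ (1 : Submodule ℚ T) := by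
  intro a ha
  obtain ⟨q, rfl⟩ := Submodule.mem_one.1 ha
  have h1 : algebraMap ℚ T q ∈ Gr T 0 := by
    rw [Algebra.algebraMap_eq_smul_one]
    exact Submodule.smul_mem _ _ gr_one
  by_cases h : i = 0
  · subst h
    rw [pr, ipr_same _ h1]
    exact Submodule.algebraMap_mem q
  · rw [pr, ipr_ne _ h1 h]
    exact zero_mem _

theorem pr_mem_mul {N M : Submodule ℚ T} (hN : ∀ i, ∀ a ∈ N, pr i a ∈ N)
    (hM : ∀ i, ∀ a ∈ M, pr i a ∈ M) (i : ℕ) : ∀ a ∈ N * M, pr i a ∈ N * M := by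
  have : N * M ≤ (N * M).comap (pr i) := by
    rw [Submodule.mul_le]
    intro a ha b hb
    rw [Submodule.mem_comap]
    obtain ⟨sa, hsa⟩ := exists_sum_ipr (gr_internal T) a
    obtain ⟨sb, hsb⟩ := exists_sum_ipr (gr_internal T) b
    rw [← hsa, ← hsb, Finset.sum_mul_sum, map_sum]
    refine sum_mem fun p _ => ?_
    rw [map_sum]
    refine sum_mem fun q _ => ?_
    have hm := gr_mul (ipr_mem (gr_internal T) p a) (ipr_mem (gr_internal T) q b)
    by_cases h : i = p + q
    · subst h
      rw [pr, ipr_same _ hm]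
      exact Submodule.mul_mem_mul (hN p a ha) (hM q b hb)
    · rw [pr, ipr_ne _ hm h]
      exact zero_mem _
  exact this

theorem Dd_mem_mul {N M : Submodule ℚ T} (hN : ∀ i, ∀ a ∈ N, pr i a ∈ N)
    (hN' : ∀ a ∈ N, Dd T a ∈ N) (hM' : ∀ a ∈ M, Dd T a ∈ M) : ∀ a ∈ N * M, Dd T a ∈ N * M := by
  have : N * M ≤ (N * M).comap (Dd T) := by
    rw [Submodule.mul_le]
    intro a ha b hb
    rw [Submodule.mem_comap, Dd_mul]
    exact add_mem (Submodule.mul_mem_mul (hN' a ha) hb)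
      (Submodule.mul_mem_mul (sg_eq_sum_pr a fun i => hN i a ha) (hM' b hb))
  exact this

theorem pr_mem_pow {N : Submodule ℚ T} (hN : ∀ i, ∀ a ∈ N, pr i a ∈ N) (p : ℕ) :
    ∀ i, ∀ a ∈ N ^ p, pr i a ∈ N ^ p := by
  induction p with
  | zero => simpa only [pow_zero] using pr_mem_one
  | succ p ih =>
    rw [pow_succ]
    exact pr_mem_mul ih hN

theorem Dd_mem_pow {N : Submodule ℚ T} (hN : ∀ i, ∀ a ∈ N, pr i a ∈ N)
    (hN' : ∀ a ∈ N, Dd T a ∈ N) (p : ℕ) : ∀ a ∈ N ^ p, Dd T a ∈ N ^ p := by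
  induction p with
  | zero =>
    rw [pow_zero]
    intro a ha
    obtain ⟨q, rfl⟩ := Submodule.mem_one.1 ha
    rw [Algebra.algebraMap_eq_smul_one, map_smul, Dd_one, smul_zero]
    exact zero_mem _
  | succ p ih =>
    rw [pow_succ]
    exact Dd_mem_mul (pr_mem_pow hN p) ih hN'

theorem mul_left_mem_pow_succ {R : Type} [Ring R] [Algebra ℚ R] {N : Submodule ℚ R}
    (hN : ∀ t, ∀ a ∈ N, t * a ∈ N) (p : ℕ) (t : R) :
    ∀ a ∈ N ^ (p + 1), t * a ∈ N ^ (p + 1) := by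
  have : N ^ (p + 1) ≤ (N ^ (p + 1)).comap (LinearMap.mulLeft ℚ t) := by
    nth_rewrite 1 [pow_succ']
    rw [Submodule.mul_le]
    intro a ha b hb
    rw [Submodule.mem_comap, LinearMap.mulLeft_apply, ← mul_assoc, pow_succ']
    exact Submodule.mul_mem_mul (hN t a ha) hb
  exact this

theorem mul_right_mem_pow_succ {R : Type} [Ring R] [Algebra ℚ R] {N : Submodule ℚ R}
    (hN : ∀ t, ∀ a ∈ N, a * t ∈ N) (p : ℕ) (t : R) :
    ∀ a ∈ N ^ (p + 1), a * t ∈ N ^ (p + 1) := by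
  have : N ^ (p + 1) ≤ (N ^ (p + 1)).comap (LinearMap.mulRight ℚ t) := by
    nth_rewrite 1 [pow_succ]
    rw [Submodule.mul_le]
    intro a ha b hb
    rw [Submodule.mem_comap, LinearMap.mulRight_apply, mul_assoc, pow_succ]
    exact Submodule.mul_mem_mul ha (hN t b hb)
  exact this

theorem LengthGrading.pow_le_lenGT {lam : ℕ → Submodule ℚ T} (hL : LengthGrading T lam)
    {N : Submodule ℚ T} (hN : N ≤ lenGT lam 0) (p : ℕ) : N ^ (p + 1) ≤ lenGT lam p := by
  induction p with
  | zero => simpa using hN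
  | succ p ih =>
    rw [pow_succ, Submodule.mul_le]
    intro a ha b hb
    have h1 : lenGT lam 0 ≤ (lenGT lam (p + 1)).comap (LinearMap.mulLeft ℚ a) := by
      refine lenGT_le fun k hk b hb => ?_
      have h2 : lenGT lam p ≤ (lenGT lam (p + 1)).comap (LinearMap.mulRight ℚ b) := by
        refine lenGT_le fun l hl a ha => ?_
        exact mem_lenGT (by omega) (hL.mul _ _ _ _ ha hb)
      exact h2 (ih ha)
    exact h1 (hN hb)

end Ideals

section Tensor

variable {A : Type} [GCDGA A] {r : ℕ} {T : Type} [GCDGA T] (TP : TensorPower A r T)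

theorem TensorPower.mu_dga : IsDGAHom TP.mu :=
  (TP.coprod A (fun _ => AlgHom.id ℚ A) (fun _ => isDGAHom_id A)).choose_spec.1.1

@[simp] theorem TensorPower.mu_ι (k : Fin r) (a : A) : TP.mu (TP.ι k a) = a :=
  DFunLike.congr_fun
    ((TP.coprod A (fun _ => AlgHom.id ℚ A) (fun _ => isDGAHom_id A)).choose_spec.1.2 k) a

theorem TensorPower.mem_kerMu {a : T} : a ∈ TP.kerMu ↔ TP.mu a = 0 := Iff.rfl

theorem TensorPower.kerMu_left (t : T) : ∀ a ∈ TP.kerMu, t * a ∈ TP.kerMu := by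
  intro a ha
  rw [mem_kerMu] at *
  rw [map_mul, ha, mul_zero]

theorem TensorPower.kerMu_right (t : T) : ∀ a ∈ TP.kerMu, a * t ∈ TP.kerMu := by
  intro a ha
  rw [mem_kerMu] at *
  rw [map_mul, ha, zero_mul]

theorem TensorPower.kerMu_pr (i : ℕ) : ∀ a ∈ TP.kerMu, pr i a ∈ TP.kerMu := by
  intro a ha
  rw [mem_kerMu] at *
  rw [← AlgHom.toLinearMap_apply, ← pr_of_hom TP.mu.toLinearMap TP.mu_dga.2,
    AlgHom.toLinearMap_apply, ha, map_zero]

theorem TensorPower.kerMu_Dd : ∀ a ∈ TP.kerMu, Dd T a ∈ TP.kerMu := by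
  intro a ha
  rw [mem_kerMu] at *
  rw [TP.mu_dga.1, ha, map_zero]

theorem TensorPower.sub_mem_kerMu (k l : Fin r) (a : A) : TP.ι k a - TP.ι l a ∈ TP.kerMu := by
  rw [mem_kerMu, map_sub, TP.mu_ι, TP.mu_ι, sub_self]

end Tensor

section RationalBase

/-- The ground field, in degree zero. -/
@[reducible] def ratGCDGA : GCDGA ℚ :=
  GCDGA.ofInternal ℚ (fun i => if i = 0 then ⊤ else ⊥)
    (isInternal_of_proj (fun i => if i = 0 then LinearMap.id else 0)
      (fun i a ha => by by_cases h : i = 0 <;> simp_all)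
      (fun i j hij a ha => by
        by_cases h : i = 0
        · subst h
          have hj : j ≠ 0 := hij.symm
          simpa [hj] using ha
        · simp [h])
      (fun a => Submodule.mem_iSup_of_mem 0 (by simp)))
    (by simp)
    (fun i j a b ha hb => by
      by_cases hi : i = 0
      · by_cases hj : j = 0
        · simp [hi, hj]
        · have : b = 0 := by simpa [hj] using hb
          simp [this]
      · have : a = 0 := by simpa [hi] using ha
        simp [this])
    (fun i j a b ha hb => by
      by_cases hi : i = 0
      · simp [hi, mul_comm]
      · have : a = 0 := by simpa [hi] using ha
        simp [this])
    0 (by simp) (by simp) (by simp)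

variable {A : Type} [GCDGA A] {S : MinimalSullivan A} {n : ℕ} {x : Fin n → A} {e : Fin n → ℕ}

theorem Pres.nontrivial (P : Pres S x e) : Nontrivial A := by
  let _ := ratGCDGA
  obtain ⟨f, -⟩ := P.lift ℚ 0 0 (fun _ => zero_mem _) (fun _ => map_zero _) (fun _ => zero_mem _)
    (fun _ => by simp)
  refine ⟨⟨1, 0, fun h => ?_⟩⟩
  have := congrArg f h
  rw [map_one, map_zero] at this
  exact one_ne_zero this

/-- The data of the `r`-fold tensor power. -/
def Pres.tq (P : Pres S x e) (r : ℕ) : QData (Fin n × Fin r) (P.τ × Fin r) where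
  e t := e t.1
  e_even t := P.e_even _
  e_pos t := P.e_pos _
  o t := P.o t.1
  o_odd t := P.o_odd _
  c j i l := if i.2 = j.2 ∧ l.2 = j.2 then P.c j.1 i.1 l.1 else 0
  c_deg j i l h := by
    apply P.c_deg
    intro h'
    simp [h'] at h

theorem Pres.tq_sum (P : Pres S x e) {r : ℕ} {B : Type} [Ring B] [Algebra ℚ B]
    (b : Fin n × Fin r → B) (j : P.τ × Fin r) :
    ∑ i, ∑ l, (P.tq r).c j i l • (b i * b l) =
      ∑ i, ∑ l, P.c j.1 i l • (b (i, j.2) * b (l, j.2)) := by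
  simp only [Fintype.sum_prod_type, Pres.tq]
  refine Finset.sum_congr rfl fun i _ => ?_
  rw [Finset.sum_eq_single j.2]
  · refine Finset.sum_congr rfl fun l _ => ?_
    rw [Finset.sum_eq_single j.2]
    · simp
    · intro k _ hk
      simp [hk]
    · simp
  · intro k _ hk
    simp [hk]
  · simp

theorem Pres.exists_tensorPower (P : Pres S x e) (r : ℕ) (M : QModel (P.tq r)) :
    ∃ TP : TensorPower A r M.D, (∀ k i, TP.ι k (x i) = M.x (i, k)) ∧
      ∀ k j, TP.ι k (P.y j) = M.y (j, k) := by
  have h : ∀ k : Fin r, ∃ f : A →ₐ[ℚ] M.D, IsDGAHom f ∧ (∀ i, f (x i) = M.x (i, k)) ∧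
      ∀ j, f (P.y j) = M.y (j, k) := fun k =>
    P.lift M.D (fun i => M.x (i, k)) (fun j => M.y (j, k)) (fun i => M.x_mem (i, k))
      (fun i => M.x_closed _) (fun j => M.y_mem (j, k))
      (fun j => by rw [M.d_y, P.tq_sum])
  choose ι hι hx hy using h
  refine ⟨⟨ι, hι, ?_⟩, hx, hy⟩
  intro B _ f hf
  obtain ⟨g, hg, hgx, hgy⟩ := M.lift B (fun t => f t.2 (x t.1)) (fun t => f t.2 (P.y t.1))
    (fun t => (hf _).2 _ _ (P.x_mem _)) (fun t => by rw [← (hf _).1, P.x_closed, map_zero])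
    (fun t => (hf _).2 _ _ (P.y_mem _))
    (fun t => by rw [← (hf _).1, P.d_y, P.tq_sum]; simp)
  refine ⟨g, ⟨hg, fun k => P.hom_ext (fun i => ?_) (fun j => ?_)⟩, ?_⟩
  · simp [hx, hgx]
  · simp [hy, hgy]
  · rintro g' ⟨-, h'⟩
    refine M.hom_ext (fun t => ?_) (fun t => ?_)
    · rw [hgx, ← h' t.2, AlgHom.comp_apply, hx]
    · rw [hgy, ← h' t.2, AlgHom.comp_apply, hy]

theorem Pres.exists_tcWitness (P : Pres S x e) (hell : Elliptic A S) (r : ℕ) :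
    ∃ w, Nonempty (TCWitness A r w) := by
  obtain ⟨M⟩ := nonempty_qModel (P.tq r)
  obtain ⟨TP, hx, hy⟩ := P.exists_tensorPower r M
  have hS := P.lvan hell
  have hex : ∀ i, ∃ b ∈ S.lam (Nat.card P.τ), ∃ k, Odd k ∧ b ∈ Gr A k ∧
      Dd A b = x i ^ (Nat.card P.τ + 1) := by
    intro i
    have hp : ∀ c : ℕ, x i ^ c ∈ S.lam c ∧ Dd A (x i ^ c) = 0 := by
      intro c
      induction c with
      | zero =>
        rw [pow_zero, S.lam_zero, Dd_one]
        exact ⟨Submodule.one_le.1 le_rfl, rfl⟩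
      | succ c ih =>
        rw [pow_succ, Dd_mul, ih.2, P.x_closed, zero_mul, mul_zero, add_zero]
        exact ⟨S.lam_mul_mem _ _ _ _ ih.1 (P.x_len i), rfl⟩
    have hg : x i ^ (Nat.card P.τ + 1) ∈ Gr A ((Nat.card P.τ + 1) * e i) := by
      rw [← smul_eq_mul]
      exact SetLike.pow_mem_graded _ (P.x_mem i)
    obtain ⟨b, hb, hbd⟩ := hS _ (Nat.lt_succ_self _) _ (hp _).1 (hp _).2
    have h2 : 2 ≤ (Nat.card P.τ + 1) * e i := le_trans (P.e_pos i) (Nat.le_mul_of_pos_left _ (by simp))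
    obtain ⟨q, hq⟩ : ∃ q, (Nat.card P.τ + 1) * e i = q + 1 := ⟨_, (Nat.sub_add_cancel (by omega)).symm⟩
    have hqo : Odd q := by
      have := (P.e_even i).mul_left (Nat.card P.τ + 1)
      rw [hq] at this
      rwa [Nat.even_add_one, Nat.not_even_iff_odd] at this
    refine ⟨pr q b, P.lengthGrading.hom _ _ _ hb, q, hqo, ipr_mem _ _ _, ?_⟩
    rw [← pr_Dd, hbd, pr, ← hq, ipr_same _ hg]
  have hιlen : ∀ k, ∀ l, ∀ a ∈ S.lam l, TP.ι k a ∈ M.lam l := fun k =>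
    P.map_len (TP.ι k) M.lam (by rw [M.lengthGrading.zero]; exact Submodule.one_le.1 le_rfl)
      M.lengthGrading.mul (fun i => by rw [hx]; exact M.x_len _)
      (fun j => by rw [hy]; exact M.y_len _)
  obtain ⟨w, hw⟩ := M.exists_lvan_of_exact (Nat.card P.τ + 1) (by omega) (by
    rintro ⟨i, k⟩
    obtain ⟨b, hb, q, hq, hbq, hbd⟩ := hex i
    refine ⟨TP.ι k b, hιlen k _ b hb, q, hq, (TP.ι_dga k).2 _ _ hbq, ?_⟩
    rw [← (TP.ι_dga k).1, hbd, map_pow, hx])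
  refine ⟨w, ?_⟩
  have hμlen : ∀ l, ∀ a ∈ M.lam l, TP.mu a ∈ S.lam l :=
    M.map_len A TP.mu S.lam (by rw [S.lam_zero]; exact Submodule.one_le.1 le_rfl)
      S.lam_mul_mem (fun t => by rw [← hx t.2 t.1, TP.mu_ι]; exact P.x_len _)
      (fun t => by rw [← hy t.2 t.1, TP.mu_ι]; exact P.y_len _)
  have hK : TP.kerMu ≤ lenGT M.lam 0 := by
    intro a ha
    rw [TP.mem_kerMu] at ha
    have hcomm : ∀ b, ipr S.lam_internal 0 (TP.mu b) = TP.mu (ipr M.lengthGrading.internal 0 b) := by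
      intro b
      induction b using internal_induction M.lengthGrading.internal with
      | h0 => simp
      | h1 i b hb =>
        by_cases h : 0 = i
        · subst h
          rw [ipr_same _ hb, ipr_same _ (hμlen _ _ hb)]
        · rw [ipr_ne _ hb h, ipr_ne _ (hμlen _ _ hb) h, map_zero]
      | h2 b b' hb hb' => rw [map_add, map_add, map_add, map_add, hb, hb']
    have h0 := hcomm a
    rw [ha, map_zero] at h0
    have h1 : ipr M.lengthGrading.internal 0 a = 0 := by
      have hm := ipr_mem M.lengthGrading.internal 0 a
      rw [M.lengthGrading.zero] at hm
      obtain ⟨q, hq⟩ := Submodule.mem_one.1 hm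
      rw [← hq, AlgHom.commutes] at h0
      have := P.nontrivial
      have hq0 : q = 0 := (map_eq_zero (algebraMap ℚ A)).1 h0.symm
      rw [← hq, hq0, map_zero]
    refine mem_of_ipr_mem M.lengthGrading.internal fun i => ?_
    rcases Nat.eq_zero_or_pos i with rfl | hi
    · rw [h1]; exact zero_mem _
    · exact mem_lenGT hi (ipr_mem _ _ _)
  obtain ⟨Q, _, ρ, h1, h2, h3⟩ := exists_quotient (TP.kerMu ^ (w + 1))
    (mul_left_mem_pow_succ TP.kerMu_left w) (mul_right_mem_pow_succ TP.kerMu_right w)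
    (pr_mem_pow TP.kerMu_pr _) (Dd_mem_pow TP.kerMu_pr TP.kerMu_Dd _)
  refine ⟨{ T := M.D, TP := TP, Q := Q, ρ := ρ, ρ_dga := h1, ρ_surj := h2, ρ_ker := h3
            retr := M.lengthGrading.nonempty_htpyRetraction hw h1 h2 fun a ha => ?_ }⟩
  refine M.lengthGrading.pow_le_lenGT hK w ?_
  rw [← h3]
  exact ha

/-- A homotopy retraction of algebras is one of modules. -/
def HtpyRetraction.toMod {T Q : Type} [GCDGA T] [GCDGA Q] {ρ : T →ₐ[ℚ] Q}
    (h : HtpyRetraction ρ) : ModHtpyRetraction ρ where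
  C := h.C
  j := h.j
  q := h.q
  τ := h.τ.toLinearMap
  j_dga := h.j_dga
  q_dga := h.q_dga
  q_surj := h.q_surj
  q_quasi := h.q_quasi
  hqj := h.hqj
  τ_chain := h.τ_dga.1
  τ_mod t c := by
    have := DFunLike.congr_fun h.hτj t
    simp only [AlgHom.comp_apply, AlgHom.id_apply] at this
    simp [this]
  hτj := DFunLike.congr_fun h.hτj

theorem Pres.tcWitness (P : Pres S x e) (hell : Elliptic A S) (r : ℕ) :
    Nonempty (TCWitness A r (TC A r)) := Nat.sInf_mem (P.exists_tcWitness hell r)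

theorem TCWitness.toMTC {r w : ℕ} (h : TCWitness A r w) : Nonempty (MTCWitness A r w) := by
  let _ := h.instT
  let _ := h.instQ
  exact ⟨{ T := h.T, TP := h.TP, Q := h.Q, ρ := h.ρ, ρ_dga := h.ρ_dga, ρ_surj := h.ρ_surj
           ρ_ker := h.ρ_ker, retr := h.retr.map HtpyRetraction.toMod }⟩

end RationalBase

section Core

variable {D : Type} [GCDGA D]

theorem mul_comm_le {N M : Submodule ℚ D} (hN : ∀ i, ∀ a ∈ N, pr i a ∈ N)
    (hM : ∀ i, ∀ a ∈ M, pr i a ∈ M) : N * M ≤ M * N := by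
  rw [Submodule.mul_le]
  intro a ha b hb
  obtain ⟨sa, hsa⟩ := exists_sum_ipr (gr_internal D) a
  obtain ⟨sb, hsb⟩ := exists_sum_ipr (gr_internal D) b
  rw [← hsa, ← hsb, Finset.sum_mul_sum]
  refine sum_mem fun p _ => sum_mem fun q _ => ?_
  rw [gr_comm (ipr_mem (gr_internal D) p a) (ipr_mem (gr_internal D) q b)]
  exact Submodule.smul_mem _ _ (Submodule.mul_mem_mul (hM q b hb) (hN p a ha))

/-- The ideal generated by the `p`-th power of a homogeneous subspace. -/
def idl (L : Submodule ℚ D) (p : ℕ) : Submodule ℚ D := ⊤ * L ^ p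

variable {L : Submodule ℚ D}

theorem mem_idl_zero (a : D) : a ∈ idl L 0 := by
  rw [idl, pow_zero, mul_one]
  trivial

theorem idl_mul (hL : ∀ i, ∀ a ∈ L, pr i a ∈ L) {p q : ℕ} {a b : D} (ha : a ∈ idl L p)
    (hb : b ∈ idl L q) : a * b ∈ idl L (p + q) := by
  have h : idl L p * idl L q ≤ idl L (p + q) := by
    have h1 : L ^ p * (⊤ : Submodule ℚ D) ≤ ⊤ * L ^ p :=
      mul_comm_le (pr_mem_pow hL p) fun _ _ _ => trivial
    calc idl L p * idl L q = ⊤ * (L ^ p * ⊤) * L ^ q := by simp only [idl, mul_assoc]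
      _ ≤ ⊤ * (⊤ * L ^ p) * L ^ q := mul_le_mul' (mul_le_mul' le_rfl h1) le_rfl
      _ = (⊤ * ⊤) * (L ^ p * L ^ q) := by simp only [mul_assoc]
      _ ≤ ⊤ * (L ^ p * L ^ q) := mul_le_mul' le_top le_rfl
      _ = idl L (p + q) := by rw [idl, pow_add]
  exact h (Submodule.mul_mem_mul ha hb)

theorem idl_mul_left (hL : ∀ i, ∀ a ∈ L, pr i a ∈ L) {q : ℕ} (a : D) {b : D}
    (hb : b ∈ idl L q) : a * b ∈ idl L q := by
  simpa using idl_mul hL (mem_idl_zero a) hb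

theorem idl_mul_right (hL : ∀ i, ∀ a ∈ L, pr i a ∈ L) {p : ℕ} {a : D} (b : D)
    (ha : a ∈ idl L p) : a * b ∈ idl L p := by
  simpa using idl_mul hL ha (mem_idl_zero b)

theorem idl_anti {p q : ℕ} (h : p ≤ q) : idl L q ≤ idl L p := by
  obtain ⟨k, rfl⟩ := Nat.exists_eq_add_of_le' h
  rw [idl, idl, pow_add, ← mul_assoc]
  exact mul_le_mul' le_top le_rfl

theorem mem_idl_one {a : D} (ha : a ∈ L) : a ∈ idl L 1 := by
  rw [idl, pow_one, ← one_mul a]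
  exact Submodule.mul_mem_mul trivial ha

/-- The elements annihilated by `P` on the left, together with all their left multiples. -/
def leftAnn (P : D) : Submodule ℚ D where
  carrier := {a | ∀ d, P * (d * a) = 0}
  add_mem' := fun ha hb d => by rw [mul_add, mul_add, ha d, hb d, add_zero]
  zero_mem' := fun d => by rw [mul_zero, mul_zero]
  smul_mem' := fun q a ha d => by rw [mul_smul_comm, mul_smul_comm, ha d, smul_zero]

theorem leftAnn_left {P a : D} (t : D) (ha : a ∈ leftAnn P) : t * a ∈ leftAnn P := by
  intro d
  rw [← mul_assoc d]
  exact ha _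

theorem leftAnn_right {P a : D} (t : D) (ha : a ∈ leftAnn P) : a * t ∈ leftAnn P := by
  intro d
  rw [← mul_assoc d, ← mul_assoc, ha d, zero_mul]

theorem prod_mul_odd_eq_zero {κ : Type} {η : κ → D} {a : κ} {k : ℕ} (hk : Odd k)
    (ha : η a ∈ Gr D k) {l : List κ} (hl : a ∈ l) : (l.map η).prod * η a = 0 := by
  obtain ⟨l₁, l₂, rfl⟩ := List.append_of_mem hl
  rw [List.map_append, List.prod_append, List.map_cons, List.prod_cons, mul_assoc, mul_assoc,
    odd_comm hk ha, ← mul_assoc (η a), odd_sq hk ha, zero_mul, mul_zero]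

theorem mem_leftAnn_prod {κ : Type} {η : κ → D} {a : κ} {k : ℕ} (hk : Odd k)
    (ha : η a ∈ Gr D k) {l : List κ} (hl : a ∈ l) : η a ∈ leftAnn (l.map η).prod := by
  intro d
  rw [odd_comm hk ha, ← mul_assoc, prod_mul_odd_eq_zero hk ha hl, zero_mul]

theorem Dd_list_prod {l : List D} (hl : ∀ a ∈ l, Dd D a = 0) : Dd D l.prod = 0 := by
  induction l with
  | nil => simp [Dd_one]
  | cons a l ih =>
    rw [List.prod_cons, Dd_mul, hl a (by simp), ih fun b hb => hl b (by simp [hb]), zero_mul,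
      mul_zero, add_zero]

theorem prod_mem_idl_sup (hL : ∀ i, ∀ a ∈ L, pr i a ∈ L) (P : D) {l : List D}
    (hl : ∀ a ∈ l, a ∈ idl L 1 ⊔ leftAnn P) : l.prod ∈ idl L l.length ⊔ leftAnn P := by
  induction l with
  | nil => exact Submodule.mem_sup_left (mem_idl_zero _)
  | cons a l ih =>
    obtain ⟨k, hk, m, hm, hkm⟩ := Submodule.mem_sup.1 (hl a (by simp))
    obtain ⟨k', hk', m', hm', hkm'⟩ := Submodule.mem_sup.1 (ih fun b hb => hl b (by simp [hb]))
    rw [List.prod_cons, ← hkm, ← hkm', mul_add, add_mul, List.length_cons, add_comm l.length]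
    exact add_mem (add_mem (Submodule.mem_sup_left (idl_mul hL hk hk'))
      (Submodule.mem_sup_right (leftAnn_right _ hm))) (Submodule.mem_sup_right (leftAnn_left _ hm'))

theorem prod_mem_idl_countP (hL : ∀ i, ∀ a ∈ L, pr i a ∈ L) {κ : Type} {η : κ → D} (p : κ → Bool)
    (hp : ∀ a, p a = true → η a ∈ idl L 1) (l : List κ) :
    (l.map η).prod ∈ idl L (l.countP p) := by
  induction l with
  | nil => exact mem_idl_zero _
  | cons a l ih =>
    rw [List.map_cons, List.prod_cons, List.countP_cons]
    split_ifs with h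
    · rw [add_comm]
      exact idl_mul hL (hp a h) ih
    · exact idl_mul_left hL _ ih

theorem sub_mem_of_generators {W : Type} [Ring W] [Algebra ℚ W] {v v' : W →ₐ[ℚ] D}
    {N : Submodule ℚ D} (h1 : ∀ t, ∀ a ∈ N, t * a ∈ N) (h2 : ∀ t, ∀ a ∈ N, a * t ∈ N)
    {s : Set W} (hs : ∀ U : Subalgebra ℚ W, s ⊆ U → U = ⊤) (h : ∀ w ∈ s, v w - v' w ∈ N) (w : W) :
    v w - v' w ∈ N := by
  let U : Subalgebra ℚ W :=
    { carrier := {w | v w - v' w ∈ N}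
      mul_mem' := fun {a b} ha hb => by
        have : v (a * b) - v' (a * b) = (v a - v' a) * v b + v' a * (v b - v' b) := by
          rw [map_mul, map_mul]; noncomm_ring
        change _ ∈ N
        rw [this]
        exact add_mem (h2 _ _ ha) (h1 _ _ hb)
      add_mem' := fun {a b} ha hb => by
        have : v (a + b) - v' (a + b) = (v a - v' a) + (v b - v' b) := by
          rw [map_add, map_add]; abel
        change _ ∈ N
        rw [this]
        exact add_mem ha hb
      algebraMap_mem' := fun q => by
        change _ ∈ N
        rw [AlgHom.commutes, AlgHom.commutes, sub_self]
        exact zero_mem _ }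
  have : w ∈ U := by
    rw [hs U h]
    trivial
  exact this

/-- The length estimate behind the lower bound. -/
theorem length_le_of_exact {M W : Type} [GCDGA M] [GCDGA W] (hL : ∀ i, ∀ a ∈ L, pr i a ∈ L)
    {κ : Type} {η : κ → D} {g : κ → M} {Ψ : D →ₐ[ℚ] M} (hΨ : IsDGAHom Ψ) {π : M →ₐ[ℚ] W}
    {v v' : W →ₐ[ℚ] D} (hv : IsDGAHom v) (hv' : IsDGAHom v') {p : κ → Bool}
    (hp : ∀ a, p a = true → η a ∈ idl L 1)
    (hodd : ∀ a, p a = false → ∃ k, Odd k ∧ η a ∈ Gr D k)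
    (hη : ∀ a, Dd D (η a) = 0) (hΨη : ∀ a, Ψ (η a) = g a) {l : List κ} (hl : ∀ a, a ∈ l)
    {s : Set W} (hs : ∀ U : Subalgebra ℚ W, s ⊆ U → U = ⊤)
    (hvs : ∀ w ∈ s, v w - v' w ∈ idl L 1 ∨ ∃ a, p a = false ∧ v w - v' w - η a ∈ idl L 1)
    {N : ℕ} {J : Submodule ℚ D} (hJ : idl L (N + 1) ≤ J)
    (hJex : ∀ z ∈ J, Dd D z = 0 → ∃ e, z = Dd D e)
    (htop : ∀ m e, (l.map g).prod * m = Dd M e → ∃ e', π m = Dd W e')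
    {i : ℕ} {z : Fin i → W} (hz : ∀ j, Dd W (z j) = 0)
    (hzv : ∀ j, π (Ψ (v (z j) - v' (z j))) = (2 : ℚ) • z j)
    (hne : ∀ c, (List.ofFn z).prod ≠ Dd W c) : l.countP p + i ≤ N := by
  by_contra hlt
  set P := (l.map η).prod with hP
  have hS : ∀ w, v w - v' w ∈ idl L 1 ⊔ leftAnn P := by
    refine sub_mem_of_generators ?_ ?_ hs ?_
    · intro t a ha
      obtain ⟨b, hb, c, hc, rfl⟩ := Submodule.mem_sup.1 ha
      rw [mul_add]
      exact add_mem (Submodule.mem_sup_left (idl_mul_left hL _ hb))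
        (Submodule.mem_sup_right (leftAnn_left _ hc))
    · intro t a ha
      obtain ⟨b, hb, c, hc, rfl⟩ := Submodule.mem_sup.1 ha
      rw [add_mul]
      exact add_mem (Submodule.mem_sup_left (idl_mul_right hL _ hb))
        (Submodule.mem_sup_right (leftAnn_right _ hc))
    · intro w hw
      rcases hvs w hw with h | ⟨a, ha, h⟩
      · exact Submodule.mem_sup_left h
      · obtain ⟨k, hk, hka⟩ := hodd a ha
        rw [← sub_add_cancel (v w - v' w) (η a)]
        exact add_mem (Submodule.mem_sup_left h)
          (Submodule.mem_sup_right (mem_leftAnn_prod hk hka (hl a)))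
  let ws : List D := List.ofFn fun j => v (z j) - v' (z j)
  have hws : ws.prod ∈ idl L i ⊔ leftAnn P := by
    have := prod_mem_idl_sup hL P (l := ws) (by
      intro a ha
      obtain ⟨j, rfl⟩ := (List.mem_ofFn' _ _).1 ha
      exact hS _)
    rwa [List.length_ofFn] at this
  have hZ : P * ws.prod ∈ idl L (l.countP p + i) := by
    obtain ⟨b, hb, c, hc, hbc⟩ := Submodule.mem_sup.1 hws
    have h0 := hc 1
    rw [one_mul] at h0
    rw [← hbc, mul_add, h0, add_zero]
    exact idl_mul hL (prod_mem_idl_countP hL p hp l) hb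
  have hclosed : Dd D (P * ws.prod) = 0 := by
    rw [Dd_mul, hP, Dd_list_prod, Dd_list_prod, zero_mul, mul_zero, add_zero]
    · intro a ha
      obtain ⟨j, rfl⟩ := (List.mem_ofFn' _ _).1 ha
      rw [map_sub, ← hv.1, ← hv'.1, hz, map_zero, map_zero, sub_zero]
    · intro a ha
      obtain ⟨b, -, rfl⟩ := List.mem_map.1 ha
      exact hη b
  obtain ⟨e, he⟩ := hJex _ (hJ (idl_anti (by omega) hZ)) hclosed
  have hΨP : Ψ (l.map η).prod = (l.map g).prod := by
    rw [map_list_prod, List.map_map]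
    congr 2
    exact funext hΨη
  obtain ⟨e', he'⟩ := htop (Ψ ws.prod) (Ψ e) (by rw [← hΨ.1, ← he, map_mul, hP, hΨP])
  have hprod : π (Ψ ws.prod) = ((2 : ℚ) ^ i) • (List.ofFn z).prod := by
    rw [map_list_prod, map_list_prod, List.map_ofFn, List.map_ofFn]
    have : (⇑π ∘ ⇑Ψ ∘ fun j => v (z j) - v' (z j)) = fun j => (2 : ℚ) • z j := by
      funext j
      exact hzv j
    rw [this]
    clear * -
    induction i with
    | zero => simp
    | succ i ih =>
      rw [List.ofFn_succ, List.ofFn_succ, List.prod_cons, List.prod_cons, ih (z := fun j => z j.succ),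
        smul_mul_smul_comm, pow_succ']
  refine hne (((2 : ℚ) ^ i)⁻¹ • e') ?_
  rw [map_smul, ← he', hprod, smul_smul, inv_mul_cancel₀ (by positivity), one_smul]

end Core

section RetractionData

theorem exists_acyclic_ker {C Q : Type} [GCDGA C] [GCDGA Q] {q : C →ₐ[ℚ] Q} (hq : IsDGAHom q)
    (hs : Function.Surjective q) (hqi : QuasiIso q) {c : C} (hc : q c = 0) (hd : Dd C c = 0) :
    ∃ e, q e = 0 ∧ Dd C e = c := by
  obtain ⟨a, rfl⟩ := hqi.2 c hd ⟨0, by rw [hc, map_zero]⟩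
  obtain ⟨a', ha', b, hb⟩ := hqi.1 (q a) (by rw [← hq.1, hc])
  obtain ⟨b', rfl⟩ := hs b
  refine ⟨a - a' + Dd C b', ?_, ?_⟩
  · rw [map_add, map_sub, hq.1, ← hb]
    abel
  · rw [map_add, map_sub, ha', Dd_Dd, sub_zero, add_zero]

/-- A module retraction, in the form used by odd extensions. -/
def ModHtpyRetraction.toRetr {T Q : Type} [GCDGA T] [GCDGA Q] {ρ : T →ₐ[ℚ] Q}
    (h : ModHtpyRetraction ρ) {ι : Type} {f : ι → T}
    (hf : ∀ a, ∃ k, Even k ∧ f a ∈ Gr T k) (hfd : ∀ a, Dd T (f a) = 0) :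
    Retr T f (LinearMap.ker ρ.toLinearMap) where
  C := h.C
  d := Dd h.C
  F a := LinearMap.mulLeft ℚ (h.j (f a))
  j := h.j.toLinearMap
  τ := h.τ
  N := LinearMap.ker h.q.toLinearMap
  d_F a c := by
    obtain ⟨k, hk, hfk⟩ := hf a
    simp [Dd_mul, ← h.j_dga.1, hfd, sg_even hk (h.j_dga.2 _ _ hfk)]
  F_F a b c := by
    obtain ⟨k, hk, hfk⟩ := hf a
    simp [← mul_assoc, even_comm hk (h.j_dga.2 _ _ hfk) (h.j (f b))]
  j_d := h.j_dga.1
  j_F a t := by simp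
  τ_d := h.τ_chain
  τ_F a c := h.τ_mod _ _
  τ_j := h.hτj
  F_N a c hc := by
    have hc' : h.q c = 0 := hc
    change h.q (h.j (f a) * c) = 0
    rw [map_mul, hc', mul_zero]
  N_acyclic c hc hd := exists_acyclic_ker h.q_dga h.q_surj h.q_quasi hc hd
  j_I t ht := by
    have ht' : ρ t = 0 := ht
    change h.q (h.j t) = 0
    rw [← AlgHom.comp_apply, h.hqj, ht']

end RetractionData

section LExtFacts

variable {A : Type} [GCDGA A] {S : MinimalSullivan A} {n : ℕ} {x : Fin n → A} {e : Fin n → ℕ}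
  {W : Type} [GCDGA W]

/-- The generators adjoined in `ΛW_B`. -/
def Pres.sqAttach (P : Pres S x e) : Attach A (Fin n) where
  k i := 2 * e i - 1
  hk i := by
    have := P.e_pos i
    exact ⟨e i - 1, by omega⟩
  f i := x i ^ 2
  f_mem i := by
    have := P.e_pos i
    have h := gr_mul (P.x_mem i) (P.x_mem i)
    rw [← pow_two] at h
    rwa [show e i + e i = 2 * e i - 1 + 1 by omega] at h
  f_closed i := by rw [pow_two, Dd_mul, P.x_closed, zero_mul, mul_zero, add_zero]

theorem LExt.exists_section (ext : LExt A S x e W) (P : Pres S x e) :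
    ∃ (F : W →ₐ[ℚ] (extData P.sqAttach).D) (G : (extData P.sqAttach).D →ₐ[ℚ] W),
      IsDGAHom F ∧ (∀ w, G (F w) = w) ∧ (∀ a, G ((extData P.sqAttach).i a) = ext.incl a) ∧
        ∀ i, G ((extData P.sqAttach).g i) = ext.u i := by
  let E := extData P.sqAttach
  obtain ⟨F, ⟨hF, hFi, hFu⟩, -⟩ := ext.free E.D E.i E.i_dga E.g E.g_mem fun i =>
    (E.g_d i).trans (map_pow _ _ _)
  obtain ⟨G, hG, hGi, hGu⟩ := E.lift W ext.incl ext.incl_dga ext.u ext.u_mem fun i =>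
    (ext.hdu i).trans (map_pow _ _ _).symm
  refine ⟨F, G, hF, fun w => ?_, hGi, hGu⟩
  have h := (ext.free W ext.incl ext.incl_dga ext.u ext.u_mem ext.hdu).unique
    (y₁ := G.comp F) (y₂ := AlgHom.id ℚ W)
    ⟨hG.comp hF, ?_, fun i => ?_⟩ ⟨isDGAHom_id W, rfl, fun i => rfl⟩
  · exact DFunLike.congr_fun h w
  · ext a
    exact (congrArg G (DFunLike.congr_fun hFi a)).trans (hGi a)
  · change G (F (ext.u i)) = _
    rw [hFu]
    exact hGu i

theorem LExt.gen (ext : LExt A S x e W) (P : Pres S x e) (U : Subalgebra ℚ W)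
    (hU : Set.range ext.incl ∪ Set.range ext.u ⊆ U) : U = ⊤ := by
  obtain ⟨F, G, -, hGF, hGi, hGu⟩ := ext.exists_section P
  have h := (extData P.sqAttach).gen (U.comap G)
    (fun t => by
      change G _ ∈ U
      rw [hGi]
      exact hU (Or.inl ⟨t, rfl⟩))
    (fun i => by
      change G _ ∈ U
      rw [hGu]
      exact hU (Or.inr ⟨i, rfl⟩))
  refine eq_top_iff.2 fun w _ => ?_
  have hw : F w ∈ U.comap G := by
    rw [h]
    trivial
  rw [← hGF w]
  exact hw

theorem LExt.hom_ext (ext : LExt A S x e W) (P : Pres S x e) {B : Type} [Ring B] [Algebra ℚ B]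
    {f g : W →ₐ[ℚ] B} (hx : ∀ i, f (ext.incl (x i)) = g (ext.incl (x i)))
    (hy : ∀ j, f (ext.incl (P.y j)) = g (ext.incl (P.y j))) (hu : ∀ i, f (ext.u i) = g (ext.u i)) :
    f = g := by
  have h := ext.gen P (AlgHom.equalizer f g) (by
    rintro w (⟨a, rfl⟩ | ⟨i, rfl⟩)
    · exact DFunLike.congr_fun
        (P.hom_ext (f := f.comp ext.incl) (g := g.comp ext.incl) hx hy) a
    · exact hu i)
  ext w
  have hw : w ∈ AlgHom.equalizer f g := by
    rw [h]
    trivial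
  exact hw

theorem one_ne_Dd {B : Type} [GCDGA B] [Nontrivial B] (c : B) : (1 : B) ≠ Dd B c := fun h => by
  have h1 : pr 0 (1 : B) = 1 := ipr_same _ gr_one
  rw [h, pr_zero_Dd, ← h] at h1
  exact zero_ne_one h1

theorem LExt.one_ne_Dd (ext : LExt A S x e W) (P : Pres S x e) (c : W) : (1 : W) ≠ Dd W c := by
  obtain ⟨F, -, hF, -⟩ := ext.exists_section P
  have := P.nontrivial
  have : Nontrivial (extData P.sqAttach).D := (extData P.sqAttach).i_inj.nontrivial
  intro h
  refine RHT.one_ne_Dd (F c) ?_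
  rw [← hF.1, ← h, map_one]

/-- The involution changing the sign of the `x_i` is `-1` in odd word length in `X`. -/
theorem LExt.map_eq_neg (ext : LExt A S x e W) (P : Pres S x e) {F : W →ₐ[ℚ] W}
    (hx : ∀ i, F (ext.incl (x i)) = -ext.incl (x i))
    (hy : ∀ j, F (ext.incl (P.y j)) = ext.incl (P.y j)) (hu : ∀ i, F (ext.u i) = ext.u i)
    {z : W} (hz : z ∈ ⨆ (p : ℕ) (_ : Odd p) (q : ℕ), ext.bl p q) : F z = -z := by
  let b : ℕ × ℕ → Submodule ℚ W := fun pq => ext.bl pq.1 pq.2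
  let E : ℕ → Submodule ℚ W := fun p =>
    LinearMap.ker (F.toLinearMap - ((-1 : ℚ) ^ p) • LinearMap.id)
  have hE : ∀ p w, w ∈ E p ↔ F w = ((-1 : ℚ) ^ p) • w := fun p w => by
    change F w - ((-1 : ℚ) ^ p) • w = 0 ↔ _
    exact sub_eq_zero
  let M : ℕ × ℕ → Submodule ℚ W := fun pq => b pq ⊓ E pq.1
  have hM1 : (1 : W) ∈ M (0, 0) := ⟨ext.bl_one, (hE _ _).2 (by simp)⟩
  have hMm : ∀ i j a c, a ∈ M i → c ∈ M j → a * c ∈ M (i + j) := by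
    rintro i j a c ⟨ha, ha'⟩ ⟨hc, hc'⟩
    refine ⟨ext.bl_mul _ _ _ _ _ _ ha hc, (hE _ _).2 ?_⟩
    rw [map_mul, (hE _ _).1 ha', (hE _ _).1 hc', smul_mul_smul_comm, ← pow_add]
    rfl
  have hMT : ∀ w, w ∈ ⨆ i, M i := by
    let U : Subalgebra ℚ W :=
      { carrier := (⨆ i, M i : Submodule ℚ W)
        mul_mem' := fun {a c} ha hc => by
          refine Submodule.iSup_induction M (motive := fun a => a * c ∈ ⨆ i, M i) ha ?_ ?_ ?_
          · intro i a ha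
            refine Submodule.iSup_induction M (motive := fun c => a * c ∈ ⨆ i, M i) hc ?_ ?_ ?_
            · exact fun j c hc => Submodule.mem_iSup_of_mem (i + j) (hMm i j a c ha hc)
            · rw [mul_zero]
              exact zero_mem _
            · intro c c' h h'
              rw [mul_add]
              exact add_mem h h'
          · rw [zero_mul]
            exact zero_mem _
          · intro a a' h h'
            rw [add_mul]
            exact add_mem h h'
        add_mem' := fun ha hc => Submodule.add_mem _ ha hc
        algebraMap_mem' := fun q => by
          change algebraMap ℚ W q ∈ ⨆ i, M i
          rw [Algebra.algebraMap_eq_smul_one]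
          exact Submodule.smul_mem _ _ (Submodule.mem_iSup_of_mem (0, 0) hM1) }
    have hA : U.comap ext.incl = ⊤ := by
      rw [eq_top_iff, ← P.gen, Algebra.adjoin_le_iff]
      rintro _ (⟨i, rfl⟩ | ⟨j, rfl⟩)
      · refine Submodule.mem_iSup_of_mem (p := M) (1, 0) ⟨ext.bl_x i, (hE _ _).2 ?_⟩
        exact (hx i).trans (by rw [pow_one, neg_one_smul]; rfl)
      · refine Submodule.mem_iSup_of_mem (p := M) (0, 1) ⟨ext.bl_y _ (P.y_odd j), (hE _ _).2 ?_⟩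
        exact (hy j).trans (by rw [pow_zero, one_smul]; rfl)
    have hU : U = ⊤ := by
      refine ext.gen P U ?_
      rintro _ (⟨a, rfl⟩ | ⟨i, rfl⟩)
      · have ha : a ∈ U.comap ext.incl := by
          rw [hA]
          trivial
        exact ha
      · refine Submodule.mem_iSup_of_mem (p := M) (0, 1) ⟨ext.bl_u i, (hE _ _).2 ?_⟩
        rw [hu, pow_zero, one_smul]
    intro w
    have hw : w ∈ U := by
      rw [hU]
      trivial
    exact hw
  have key : ∀ i w, w ∈ b i → w ∈ M i := fun i w hw =>
    mem_of_mem_iSup (G := b) ext.bl_internal (fun _ => inf_le_left) (hMT w) hw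
  have hle : (⨆ (p : ℕ) (_ : Odd p) (q : ℕ), ext.bl p q) ≤ E 1 := by
    refine iSup_le fun p => iSup_le fun hp => iSup_le fun q w hw => (hE _ _).2 ?_
    rw [(hE _ _).1 (key (p, q) w hw).2, hp.neg_one_pow, pow_one]
  have := (hE _ _).1 (hle hz)
  rwa [pow_one, neg_one_smul] at this

end LExtFacts

section Construction

variable {A : Type} [GCDGA A] {S : MinimalSullivan A} {n : ℕ} {x : Fin n → A} {e : Fin n → ℕ}

/-- Generators adjoined to `T = A^{⊗(r+1)}`: the `u_{i,k}` with `du_{i,k} = x_{i,k}²`, and the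
`s_{i,k}` with `ds_{i,k} = x_{i,0} + x_{i,k+1}`. -/
def Pres.tensorAttach (P : Pres S x e) {r : ℕ} {T : Type} [GCDGA T]
    (TP : TensorPower A (r + 1) T) : Attach T ((Fin n × Fin (r + 1)) ⊕ (Fin n × Fin r)) where
  k := Sum.elim (fun a => 2 * e a.1 - 1) fun b => e b.1 - 1
  hk := by
    rintro (a | b)
    · have := P.e_pos a.1
      exact ⟨e a.1 - 1, by dsimp only [Sum.elim_inl]; omega⟩
    · have := P.e_pos b.1
      exact Nat.Even.sub_odd (by omega) (P.e_even b.1) odd_one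
  f := Sum.elim (fun a => TP.ι a.2 (x a.1) ^ 2) fun b => TP.ι 0 (x b.1) + TP.ι b.2.succ (x b.1)
  f_mem := by
    rintro (a | b)
    · have := P.e_pos a.1
      have h := gr_mul ((TP.ι_dga a.2).2 _ _ (P.x_mem a.1)) ((TP.ι_dga a.2).2 _ _ (P.x_mem a.1))
      rw [← pow_two] at h
      rwa [show e a.1 + e a.1 = 2 * e a.1 - 1 + 1 by omega] at h
    · have := P.e_pos b.1
      have h := add_mem ((TP.ι_dga 0).2 _ _ (P.x_mem b.1)) ((TP.ι_dga b.2.succ).2 _ _ (P.x_mem b.1))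
      rwa [show e b.1 = e b.1 - 1 + 1 by omega] at h
  f_closed := by
    rintro (a | b)
    · change Dd T (TP.ι a.2 (x a.1) ^ 2) = 0
      rw [pow_two, Dd_mul, ← (TP.ι_dga _).1, P.x_closed, map_zero, zero_mul, mul_zero, add_zero]
    · change Dd T (TP.ι 0 (x b.1) + TP.ι b.2.succ (x b.1)) = 0
      rw [map_add, ← (TP.ι_dga _).1, ← (TP.ι_dga _).1, P.x_closed, map_zero, map_zero, add_zero]

theorem Pres.tensorAttach_even (P : Pres S x e) {r : ℕ} {T : Type} [GCDGA T]
    (TP : TensorPower A (r + 1) T) (a) :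
    ∃ k, Even k ∧ (P.tensorAttach TP).f a ∈ Gr T k :=
  ⟨_, ((P.tensorAttach TP).hk a).add_odd odd_one, (P.tensorAttach TP).f_mem a⟩

/-- The closed generators adjoined to `ΛW_B`. -/
def Pres.trivialAttach (P : Pres S x e) (W : Type) [GCDGA W] (r : ℕ) :
    Attach W ((P.τ ⊕ Fin n) × Fin r) where
  k a := Sum.elim P.o (fun i => 2 * e i - 1) a.1
  hk := by
    rintro ⟨j | i, k⟩
    · exact P.o_odd j
    · have := P.e_pos i
      exact ⟨e i - 1, by dsimp only [Sum.elim_inr]; omega⟩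
  f _ := 0
  f_mem _ := zero_mem _
  f_closed _ := map_zero _

theorem Pres.ι_x_comm (P : Pres S x e) {r : ℕ} {T : Type} [GCDGA T] {TP : TensorPower A r T}
    (k : Fin r) (i : Fin n) (t : T) : TP.ι k (x i) * t = t * TP.ι k (x i) :=
  even_comm (P.e_even i) ((TP.ι_dga k).2 _ _ (P.x_mem i)) t

variable (P : Pres S x e) {W : Type} [GCDGA W] (ext : LExt A S x e W) {r : ℕ} {T : Type} [GCDGA T]
  {TP : TensorPower A (r + 1) T} (E : ExtData T (P.tensorAttach TP))
  (M : ExtData W (P.trivialAttach W r))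

theorem Pres.exists_slice (k : Fin (r + 1)) : ∃ v : W →ₐ[ℚ] E.D, IsDGAHom v ∧
    (∀ a, v (ext.incl a) = E.i (TP.ι k a)) ∧ ∀ i, v (ext.u i) = E.g (Sum.inl (i, k)) := by
  obtain ⟨v, ⟨hv, hvi, hvu⟩, -⟩ := ext.free E.D (E.i.comp (TP.ι k)) (E.i_dga.comp (TP.ι_dga k))
    (fun i => E.g (Sum.inl (i, k))) (fun i => E.g_mem (Sum.inl (i, k))) fun i =>
      (E.g_d (Sum.inl (i, k))).trans (map_pow _ _ _)
  exact ⟨v, hv, fun a => DFunLike.congr_fun hvi a, hvu⟩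

theorem Pres.exists_projection : ∃ π : M.D →ₐ[ℚ] W, IsDGAHom π ∧ (∀ t, π (M.i t) = t) ∧
    ∀ a, π (M.g a) = 0 :=
  M.lift W (AlgHom.id ℚ W) (isDGAHom_id W) (fun _ => 0) (fun _ => zero_mem _) fun _ => map_zero _

theorem Pres.exists_reflection (k : Fin r) : ∃ f : A →ₐ[ℚ] M.D, IsDGAHom f ∧
    (∀ i, f (x i) = -M.i (ext.incl (x i))) ∧
      ∀ j, f (P.y j) = M.i (ext.incl (P.y j)) - M.g (Sum.inl j, k) := by
  have hc : IsDGAHom (M.i.comp ext.incl) := M.i_dga.comp ext.incl_dga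
  refine P.lift M.D _ _ (fun i => neg_mem (hc.2 _ _ (P.x_mem i))) (fun i => ?_)
    (fun j => sub_mem (hc.2 _ _ (P.y_mem j)) (M.g_mem (Sum.inl j, k))) fun j => ?_
  · rw [map_neg, ← M.i_dga.1, ← ext.incl_dga.1, P.x_closed, map_zero, map_zero, neg_zero]
  · have h : Dd M.D (M.g (Sum.inl j, k)) = 0 := (M.g_d _).trans (map_zero _)
    rw [map_sub, h, sub_zero, ← M.i_dga.1, ← ext.incl_dga.1, P.d_y]
    simp only [map_sum, map_smul, map_mul, neg_mul_neg]

theorem Pres.exists_comparison : ∃ Ψ : E.D →ₐ[ℚ] M.D, IsDGAHom Ψ ∧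
    (∀ a, Ψ (E.i (TP.ι 0 a)) = M.i (ext.incl a)) ∧
    (∀ k i, Ψ (E.i (TP.ι (Fin.succ k) (x i))) = -M.i (ext.incl (x i))) ∧
    (∀ k j, Ψ (E.i (TP.ι (Fin.succ k) (P.y j))) =
      M.i (ext.incl (P.y j)) - M.g (Sum.inl j, k)) ∧
    (∀ i, Ψ (E.g (Sum.inl (i, 0))) = M.i (ext.u i)) ∧
    (∀ i k, Ψ (E.g (Sum.inl (i, Fin.succ k))) = M.i (ext.u i) - M.g (Sum.inr i, k)) ∧
    ∀ i k, Ψ (E.g (Sum.inr (i, k))) = 0 := by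
  choose f hf hfx hfy using P.exists_reflection ext M
  have hc : IsDGAHom (M.i.comp ext.incl) := M.i_dga.comp ext.incl_dga
  obtain ⟨h, ⟨hh, hhι⟩, -⟩ := TP.coprod M.D (Fin.cons (M.i.comp ext.incl) f)
    (Fin.cases hc hf)
  have h0 : ∀ a, h (TP.ι 0 a) = M.i (ext.incl a) := fun a => DFunLike.congr_fun (hhι 0) a
  have hs : ∀ k a, h (TP.ι (Fin.succ k) a) = f k a := fun k a =>
    DFunLike.congr_fun (hhι k.succ) a
  have hMg : ∀ a, Dd M.D (M.g a) = 0 := fun a => (M.g_d a).trans (map_zero _)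
  have hMu : ∀ i, Dd M.D (M.i (ext.u i)) = M.i (ext.incl (x i)) ^ 2 := fun i => by
    rw [← M.i_dga.1, ext.hdu, map_pow]
  obtain ⟨Ψ, hΨ, hΨi, hΨg⟩ := E.lift M.D h hh
    (Sum.elim (fun a => (Fin.cons (M.i (ext.u a.1)) fun k =>
      M.i (ext.u a.1) - M.g (Sum.inr a.1, k) : Fin (r + 1) → M.D) a.2) fun _ => 0) (by
      rintro (⟨i, k⟩ | b)
      · refine Fin.cases ?_ (fun k => ?_) k
        · exact M.i_dga.2 _ _ (ext.u_mem i)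
        · exact sub_mem (M.i_dga.2 _ _ (ext.u_mem i)) (M.g_mem (Sum.inr i, k))
      · exact zero_mem _) (by
      rintro (⟨i, k⟩ | ⟨i, k⟩)
      · refine Fin.cases ?_ (fun k => ?_) k
        · change Dd M.D (M.i (ext.u i)) = h (TP.ι 0 (x i) ^ 2)
          rw [hMu, map_pow, h0]
        · change Dd M.D (M.i (ext.u i) - M.g (Sum.inr i, k)) = h (TP.ι k.succ (x i) ^ 2)
          rw [map_sub, hMu, hMg, map_pow, hs, hfx, neg_sq, sub_zero]
      · change Dd M.D 0 = h (TP.ι 0 (x i) + TP.ι k.succ (x i))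
        rw [map_zero, map_add, h0, hs, hfx, add_neg_cancel])
  exact ⟨Ψ, hΨ, fun a => (hΨi _).trans (h0 a), fun k i => (hΨi _).trans ((hs k _).trans (hfx k i)),
    fun k j => (hΨi _).trans ((hs k _).trans (hfy k j)), fun i => hΨg (Sum.inl (i, 0)),
    fun i k => hΨg (Sum.inl (i, k.succ)), fun i k => hΨg (Sum.inr (i, k))⟩

/-- The difference `x_{i,0} - x_{i,k+1}`. -/
def Pres.dx (i : Fin n) (k : Fin r) : E.D := E.i (TP.ι 0 (x i) - TP.ι k.succ (x i))

/-- The cocycles of the extension of `T` lifting the generators of the extension of `ΛW_B`. -/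
def Pres.eta : (P.τ ⊕ Fin n) × Fin r → E.D
  | (Sum.inl j, k) => E.i (TP.ι 0 (P.y j) - TP.ι k.succ (P.y j)) -
      (1 / 2 : ℚ) • ∑ i, ∑ l, P.c j i l •
        (P.dx E i k * E.g (Sum.inr (l, k)) + P.dx E l k * E.g (Sum.inr (i, k)))
  | (Sum.inr i, k) => E.g (Sum.inl (i, 0)) - E.g (Sum.inl (i, k.succ)) -
      P.dx E i k * E.g (Sum.inr (i, k))

theorem Pres.dx_mem (i : Fin n) (k : Fin r) : P.dx E i k ∈ Gr E.D (e i) :=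
  E.i_dga.2 _ _ (sub_mem ((TP.ι_dga _).2 _ _ (P.x_mem i)) ((TP.ι_dga _).2 _ _ (P.x_mem i)))

theorem Pres.Dd_dx_mul (i l : Fin n) (k : Fin r) :
    Dd E.D (P.dx E i k * E.g (Sum.inr (l, k))) =
      P.dx E i k * E.i (TP.ι 0 (x l) + TP.ι k.succ (x l)) := by
  have h : Dd E.D (P.dx E i k) = 0 := by
    rw [dx, ← E.i_dga.1, map_sub, ← (TP.ι_dga _).1, ← (TP.ι_dga _).1, P.x_closed, map_zero,
      map_zero, sub_zero, map_zero]
  rw [Dd_mul, h, zero_mul, zero_add, sg_even (P.e_even i) (P.dx_mem E i k), E.g_d]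
  rfl

theorem Pres.Dd_eta (a) : Dd E.D (P.eta E a) = 0 := by
  obtain ⟨j | i, k⟩ := a
  · simp only [eta, map_sub, map_smul, map_sum, map_add, P.Dd_dx_mul, ← E.i_dga.1,
      ← (TP.ι_dga _).1, P.d_y, map_mul, Finset.smul_sum, ← Finset.sum_sub_distrib]
    refine Finset.sum_eq_zero fun i _ => Finset.sum_eq_zero fun l _ => ?_
    simp only [dx, ← map_add, ← map_sub, ← map_mul, ← map_smul]
    have h : (TP.ι 0 (x i) - TP.ι k.succ (x i)) * (TP.ι 0 (x l) + TP.ι k.succ (x l)) +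
        (TP.ι 0 (x l) - TP.ι k.succ (x l)) * (TP.ι 0 (x i) + TP.ι k.succ (x i)) =
        (2 : ℚ) • (TP.ι 0 (x i) * TP.ι 0 (x l) - TP.ι k.succ (x i) * TP.ι k.succ (x l)) := by
      simp only [sub_mul, mul_add, P.ι_x_comm 0 l, P.ι_x_comm k.succ l, two_smul]
      abel
    rw [map_smul, map_smul, map_mul, map_mul, h, ← map_zero E.i]
    congr 1
    module
  · have h : E.i (TP.ι 0 (x i) - TP.ι k.succ (x i)) * E.i (TP.ι 0 (x i) + TP.ι k.succ (x i)) =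
        E.i (TP.ι 0 (x i) ^ 2 - TP.ι k.succ (x i) ^ 2) := by
      rw [← map_mul]
      congr 1
      rw [sub_mul, mul_add, mul_add, P.ι_x_comm 0 i (TP.ι k.succ (x i)), pow_two, pow_two]
      abel
    rw [eta, map_sub, map_sub, P.Dd_dx_mul, E.g_d, E.g_d, dx, h, map_sub]
    exact sub_self _

theorem Pres.eta_odd (i : Fin n) (k : Fin r) :
    P.eta E (Sum.inr i, k) ∈ Gr E.D (2 * e i - 1) := by
  have h := gr_mul (P.dx_mem E i k) (E.g_mem (Sum.inr (i, k)))
  have h' : e i + (P.tensorAttach TP).k (Sum.inr (i, k)) = 2 * e i - 1 := by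
    have := P.e_pos i
    change e i + (e i - 1) = _
    omega
  rw [h'] at h
  exact sub_mem (sub_mem (E.g_mem (Sum.inl (i, 0))) (E.g_mem (Sum.inl (i, k.succ)))) h

/-- The subspace of zero divisors. -/
abbrev zd : Submodule ℚ E.D := TP.kerMu.map E.i.toLinearMap

theorem Pres.sub_mem_zd (k l : Fin (r + 1)) (a : A) :
    E.i (TP.ι k a - TP.ι l a) ∈ idl (zd P E) 1 :=
  mem_idl_one ⟨_, TP.sub_mem_kerMu k l a, rfl⟩

end Construction

section LowerBound

variable {A : Type} [GCDGA A] {S : MinimalSullivan A} {n : ℕ} {x : Fin n → A} {e : Fin n → ℕ}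

theorem card_mul_le_countP {τ σ : Type} [Finite τ] {r : ℕ} {l : List ((τ ⊕ σ) × Fin r)}
    (hl : ∀ a, a ∈ l) : r * Nat.card τ ≤ l.countP fun a => a.1.isLeft := by
  classical
  have := Fintype.ofFinite τ
  rw [List.countP_eq_length_filter]
  refine le_trans ?_ (List.toFinset_card_le _)
  have hc : r * Nat.card τ = (Finset.univ : Finset (τ × Fin r)).card := by
    rw [Finset.card_univ, Fintype.card_prod, Fintype.card_fin, Nat.card_eq_fintype_card, mul_comm]
  rw [hc]
  refine Finset.card_le_card_of_injOn (fun a => (Sum.inl a.1, a.2)) (fun a _ => ?_) ?_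
  · simp [hl]
  · rintro ⟨a, k⟩ - ⟨b, k'⟩ - h
    simpa using h

theorem Pres.mul_card_add_le (P : Pres S x e) {W : Type} [GCDGA W] (ext : LExt A S x e W) {r N : ℕ}
    (w : MTCWitness A (r + 1) N) (hr : 0 < r) {i : ℕ} (z : LWitness ext i) :
    r * Nat.card P.τ + i ≤ N := by
  let _ := w.instT
  let _ := w.instQ
  let E := extData (P.tensorAttach w.TP)
  let M := extData (P.trivialAttach W r)
  let k₀ : Fin r := ⟨0, hr⟩
  obtain ⟨v, hv, hvi, hvu⟩ := P.exists_slice ext E 0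
  obtain ⟨v', hv', hvi', hvu'⟩ := P.exists_slice ext E k₀.succ
  obtain ⟨π, hπ, hπi, hπg⟩ := P.exists_projection M
  obtain ⟨Ψ, hΨ, hΨ0, hΨx, hΨy, hΨu0, hΨu, hΨs⟩ := P.exists_comparison ext E M
  obtain ⟨l, hl, htop⟩ := M.top
  obtain ⟨R⟩ := w.retr
  have hI : ∀ a, a ∈ LinearMap.ker w.ρ.toLinearMap ↔ a ∈ w.TP.kerMu ^ (N + 1) := fun a => by
    rw [w.ρ_ker]
  obtain ⟨J, hJl, hJi, hJex⟩ := E.retr _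
    (R.toRetr (P.tensorAttach_even w.TP) (P.tensorAttach w.TP).f_closed) fun t a ha =>
      (hI _).2 (mul_left_mem_pow_succ w.TP.kerMu_left N t a ((hI a).1 ha))
  have hL : ∀ i, ∀ a ∈ zd P E, pr i a ∈ zd P E := by
    rintro i _ ⟨a, ha, rfl⟩
    exact ⟨pr i a, w.TP.kerMu_pr i a ha, (pr_of_hom _ E.i_dga.2 i a).symm⟩
  have hJ : idl (zd P E) (N + 1) ≤ J := by
    rw [idl, Submodule.mul_le]
    intro t _ a ha
    rw [zd, ← Submodule.map_pow] at ha
    obtain ⟨b, hb, rfl⟩ := ha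
    exact hJl t _ (hJi b ((hI b).2 hb))
  have hπv : ∀ a, π (Ψ (v a)) = a := by
    have := ext.hom_ext P (f := (π.comp Ψ).comp v) (g := AlgHom.id ℚ W)
      (fun i => by simp [hvi, hΨ0, hπi]) (fun j => by simp [hvi, hΨ0, hπi])
      (fun i => by simp [hvu, hΨu0, hπi])
    exact fun a => DFunLike.congr_fun this a
  have hπv' : ∀ j, π (Ψ (v' (z.z j))) = -z.z j := fun j =>
    ext.map_eq_neg P (F := (π.comp Ψ).comp v') (fun i => by simp [hvi', hΨx, hπi])
      (fun j => by simp [hvi', hΨy, hπi, hπg]) (fun i => by simp [hvu', hΨu, hπi, hπg])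
      (z.odd_wl j)
  have hdx : ∀ i k, P.dx E i k ∈ idl (zd P E) 1 := fun i k => P.sub_mem_zd E _ _ _
  refine (Nat.add_le_add_right (card_mul_le_countP hl) i).trans
    (length_le_of_exact hL (η := P.eta E) (g := M.g) hΨ hv hv' (π := π)
      (s := Set.range ext.incl ∪ Set.range ext.u) (z := z.z) (J := J) ?_ ?_ (P.Dd_eta E) ?_ hl
      (ext.gen P) ?_ hJ hJex (htop (fun _ => rfl) π hπ hπi hπg) z.closed (fun j => ?_) z.prod_ne)
  · rintro ⟨j | i, k⟩ ha
    · exact sub_mem (P.sub_mem_zd E _ _ _) (Submodule.smul_mem _ _ (Submodule.sum_mem _ fun i _ =>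
        Submodule.sum_mem _ fun l _ => Submodule.smul_mem _ _
          (add_mem (idl_mul_right hL _ (hdx _ _)) (idl_mul_right hL _ (hdx _ _)))))
    · simp at ha
  · rintro ⟨j | i, k⟩ ha
    · simp at ha
    · have := P.e_pos i
      exact ⟨_, ⟨e i - 1, by omega⟩, P.eta_odd E i k⟩
  · rintro ⟨j | i, k⟩
    · simp [Pres.eta, hΨ0, hΨy, hΨs]
    · simp [Pres.eta, hΨu0, hΨu, hΨs]
  · rintro _ (⟨a, rfl⟩ | ⟨i, rfl⟩)
    · left
      rw [hvi, hvi', ← map_sub]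
      exact P.sub_mem_zd E _ _ _
    · refine Or.inr ⟨(Sum.inr i, k₀), rfl, ?_⟩
      rw [hvu, hvu', Pres.eta, sub_sub_cancel]
      exact idl_mul_right hL _ (hdx _ _)
  · rw [map_sub, map_sub, hπv, hπv', sub_neg_eq_add, two_smul]

end LowerBound

/-- For a pure coformal elliptic minimal Sullivan model
`(ΛV,d)` together with a (homogeneous) basis `B = {x₁,…,x_n}` of `V^even`, and
every `r ≥ 2`: `(r−1)·cat(ΛV) + L(ΛV,B) ≤ MTC_r(ΛV) ≤ TC_r(ΛV)`. -/
theorem L_lower_bound_TC (A : Type) [GCDGA A] (S : MinimalSullivan A)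
    (hpure : S.Pure) (hcof : S.Coformal) (hell : Elliptic A S)
    {n : ℕ} (x : Fin n → A) (e : Fin n → ℕ)
    (heven : ∀ i, Even (e i)) (hmem : ∀ i, x i ∈ S.V (e i))
    (hli : LinearIndependent ℚ x)
    (hspan : Submodule.span ℚ (Set.range x) = S.Veven)
    (W : Type) [GCDGA W] (ext : LExt A S x e W) (r : ℕ) (hr : 2 ≤ r) :
    (r - 1) * cat A S + Lval ext ≤ MTC A r ∧ MTC A r ≤ TC A r := by
  obtain ⟨P⟩ := nonempty_pres hpure hcof hell x e heven hmem hli hspan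
  obtain ⟨t⟩ := P.tcWitness hell r
  have ht := t.toMTC
  refine ⟨?_, Nat.sInf_le ht⟩
  obtain ⟨w⟩ : Nonempty (MTCWitness A r (MTC A r)) :=
    Nat.sInf_mem (s := {n | Nonempty (MTCWitness A r n)}) ⟨_, ht⟩
  obtain ⟨r, rfl⟩ : ∃ s, r = s + 1 := ⟨r - 1, by omega⟩
  have hbound : ∀ i ∈ {i | Nonempty (LWitness ext i)}, r * Nat.card P.τ + i ≤ MTC A (r + 1) := by
    rintro i ⟨z⟩
    exact P.mul_card_add_le ext w (by omega) z
  have h0 : 0 ∈ {i | Nonempty (LWitness ext i)} :=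
    ⟨⟨Fin.elim0, fun j => j.elim0, fun j => j.elim0, fun c => by
      rw [List.ofFn_zero, List.prod_nil]
      exact ext.one_ne_Dd P c⟩⟩
  have hmem : Lval ext ∈ {i | Nonempty (LWitness ext i)} :=
    Nat.sSup_mem ⟨0, h0⟩ ⟨MTC A (r + 1), fun i hi => by have := hbound i hi; omega⟩
  have := hbound _ hmem
  have h1 : r * cat A S ≤ r * Nat.card P.τ := Nat.mul_le_mul_left r (P.cat_le hell)
  rw [Nat.add_sub_cancel]
  omega

end RHT
end
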